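/- In every stochastic game, for every ε > 0, there exists an ε-solvable subgame: there is a history h ∈ H such that the subgame Γ_h admits an ε-equilibrium, i.e., a strategy profile σ̂ such that E_{h',σ̂}[f_{·,h}] is within ε of being a best response for each player in Γ_h (formally: E_{s_h,σ̂}[f_{i,h}] ≥ E_{s_h,σ_i,σ̂_{-i}}[f_{i,h}] − ε for every player i ∈ I and every strategy σ_i of player i, where f_{i,h}(r) := f_i(hr)). -/

import Mathlib

open scoped ENNReal NNReal Classical

/-- A multiplayer stochastic game: a nonempty finite set of players `I`, a nonempty
countable set of states `S`, nonempty finite action sets `A i`, a transition function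
`trans` and bounded Borel payoff functions `payoff i` on runs. -/
structure StochGame where
  I : Type
  S : Type
  A : I → Type
  [fintypeI : Fintype I]
  [nonemptyI : Nonempty I]
  [countableS : Countable S]
  [nonemptyS : Nonempty S]
  [fintypeA : ∀ i, Fintype (A i)]
  [nonemptyA : ∀ i, Nonempty (A i)]
  trans : S → (∀ i, A i) → PMF S
  payoff : I → S × (ℕ → (∀ i, A i) × S) → ℝ

open MeasureTheory

attribute [instance] StochGame.fintypeI StochGame.nonemptyI StochGame.countableS
  StochGame.nonemptyS StochGame.fintypeA StochGame.nonemptyA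

namespace StochGame

variable (G : StochGame)

noncomputable instance : DecidableEq G.I := Classical.decEq _

noncomputable instance (i : G.I) : DecidableEq (G.A i) := Classical.decEq _

/-- Action profiles. -/
abbrev ActionProfile := ∀ i, G.A i

/-- Runs `(s¹,a¹,s²,a²,…)`, encoded as an initial state together with a sequence of
(action profile, next state) pairs. -/
abbrev Run := G.S × (ℕ → G.ActionProfile × G.S)

/-- Histories `(s¹,a¹,…,s^n)`, encoded as an initial state together with a finite list of
(action profile, next state) pairs. -/
abbrev History := G.S × List (G.ActionProfile × G.S)

instance : MeasurableSpace G.S := ⊤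
instance : MeasurableSpace G.ActionProfile := ⊤

variable {G}

/-- The final state `s_h` of a history. -/
def lastState (h : G.History) : G.S := h.2.getLast?.elim h.1 Prod.snd

/-- The stage (length) of a history: a history `(s¹,a¹,…,s^n)` is in stage `n`. -/
def stage (h : G.History) : ℕ := h.2.length + 1

/-- The history obtained by appending one action profile and one state. -/
def snocH (h : G.History) (a : G.ActionProfile) (s : G.S) : G.History :=
  (h.1, h.2 ++ [(a, s)])

/-- The history obtained by appending a finite list of (action profile, state) pairs. -/
def catH (h : G.History) (l : List (G.ActionProfile × G.S)) : G.History := (h.1, h.2 ++ l)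

/-- The history in stage 1 consisting of the initial state `s` only. -/
def initH (G : StochGame) (s : G.S) : G.History := (s, [])

/-- All transitions along the list have positive probability when starting from `s`. -/
def ValidFrom (G : StochGame) : G.S → List (G.ActionProfile × G.S) → Prop
  | _, [] => True
  | s, (a, t) :: l => G.trans s a t ≠ 0 ∧ ValidFrom G t l

/-- A history belongs to the set `H` of histories of the game iff all its transitions have
positive probability. -/
def Valid (h : G.History) : Prop := ValidFrom G h.1 h.2

/-- `Ext h h'` means that the history `h'` extends the history `h` (possibly `h = h'`),
written `h ⪯ h'` in the paper. -/
def Ext (h h' : G.History) : Prop := h.1 = h'.1 ∧ h.2 <+: h'.2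

/-- A behavior strategy of player `i`: a mixed action at every history. -/
abbrev Strategy (G : StochGame) (i : G.I) := G.History → PMF (G.A i)

/-- A strategy profile: one behavior strategy for each player. -/
abbrev Profile (G : StochGame) := ∀ i, G.Strategy i

/-- The probability, under the strategy profile `σ`, that after the history `h` play continues
exactly along the finite continuation `l`. -/
noncomputable def contProb (σ : G.Profile) : G.History → List (G.ActionProfile × G.S) → ℝ≥0∞
  | _, [] => 1
  | h, (a, s) :: l =>
      (∏ i, σ i h (a i)) * G.trans (lastState h) a s * contProb σ (snocH h a s) l

/-- The cylinder set `C(h)` of all runs extending the history `h`. -/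
def cyl (h : G.History) : Set G.Run :=
  {r | r.1 = h.1 ∧ ∀ k, (hk : k < h.2.length) → r.2 k = h.2.get ⟨k, hk⟩}

/-- `P` is the family of probability measures `P_{h,σ}` on runs induced, via the
Ionescu-Tulcea/Kolmogorov extension, by a history `h` and a strategy profile `σ`:
each `P h σ` is a probability measure, and the measure of the cylinder set of any finite
extension of `h` is the product of the transition probabilities prescribed by `σ` and `p`.
(These properties determine `P h σ` uniquely, since `P h σ (cyl h) = 1`.) -/
def IsInducedFamily (G : StochGame) (P : G.History → G.Profile → Measure G.Run) : Prop :=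
  (∀ h σ, IsProbabilityMeasure (P h σ)) ∧
    ∀ (h : G.History) (σ : G.Profile) (l : List (G.ActionProfile × G.S)),
      P h σ (cyl (catH h l)) = contProb σ h l

/-- The expected payoff `E_{h,σ}[f_i]` of player `i` in the subgame at `h` under `σ`. -/
noncomputable def expPay (P : G.History → G.Profile → Measure G.Run) (h : G.History)
    (σ : G.Profile) (i : G.I) : ℝ :=
  ∫ r, G.payoff i r ∂(P h σ)

/-- The minmax value `v̄_i(h)` of player `i` at the history `h`. -/
noncomputable def minmaxVal (P : G.History → G.Profile → Measure G.Run) (i : G.I)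
    (h : G.History) : ℝ :=
  ⨅ σ : G.Profile, ⨆ τ : G.Strategy i, expPay P h (Function.update σ i τ) i

/-- The maxmin value `v̲_i(h)` of player `i` at the history `h`. -/
noncomputable def maxminVal (P : G.History → G.Profile → Measure G.Run) (i : G.I)
    (h : G.History) : ℝ :=
  ⨆ τ : G.Strategy i, ⨅ σ : G.Profile, expPay P h (Function.update σ i τ) i

/-- `E[D | h, x]`: the expected value of `D` at the next history, when at history `h` the
players use the mixed action profile `x` and the next state is drawn according to `p`. -/
noncomputable def oneShotExp (D : G.History → ℝ) (h : G.History) (x : ∀ i, PMF (G.A i)) : ℝ :=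
  ∑ a : G.ActionProfile, (∏ i, (x i (a i)).toReal) *
    ∑' s : G.S, (G.trans (lastState h) a s).toReal * D (snocH h a s)

/-- The minmax value `v̄_{O,i}(D,h)` of player `i` in the one-shot game `G_O(D,h)`. -/
noncomputable def oneShotMinmax (D : G.History → ℝ) (i : G.I) (h : G.History) : ℝ :=
  ⨅ x : ∀ j, PMF (G.A j), ⨆ y : PMF (G.A i), oneShotExp D h (Function.update x i y)

/-- The maxmin value `v̲_{O,i}(D,h)` of player `i` in the one-shot game `G_O(D,h)`. -/
noncomputable def oneShotMaxmin (D : G.History → ℝ) (i : G.I) (h : G.History) : ℝ :=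
  ⨆ y : PMF (G.A i), ⨅ x : ∀ j, PMF (G.A j), oneShotExp D h (Function.update x i y)

end StochGame

set_option linter.unusedSectionVars false

namespace BD

/-- Two plays agree below level `n`. -/
def Agr {X : ℕ → Type} (n : ℕ) (x y : ∀ n, X n) : Prop := ∀ m, m < n → x m = y m

theorem Agr.refl {X : ℕ → Type} (n : ℕ) (x : ∀ n, X n) : Agr n x x := fun _ _ => rfl
theorem Agr.symm {X : ℕ → Type} {n : ℕ} {x y : ∀ n, X n} (h : Agr n x y) : Agr n y x :=
  fun m hm => (h m hm).symm
theorem Agr.trans {X : ℕ → Type} {n : ℕ} {x y z : ∀ n, X n} (h : Agr n x y) (h' : Agr n y z) :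
    Agr n x z := fun m hm => (h m hm).trans (h' m hm)
theorem Agr.mono {X : ℕ → Type} {n k : ℕ} {x y : ∀ n, X n} (h : Agr n x y) (hk : k ≤ n) :
    Agr k x y := fun m hm => h m (lt_of_lt_of_le hm hk)
theorem Agr.succ {X : ℕ → Type} {n : ℕ} {x y : ∀ n, X n} (h : Agr n x y) (hn : x n = y n) :
    Agr (n+1) x y := fun m hm => by
  rcases Nat.lt_succ_iff_lt_or_eq.mp hm with h1 | h1
  · exact h m h1
  · subst h1; exact hn
theorem Agr.upd {X : ℕ → Type} {n : ℕ} {x y : ∀ n, X n} (h : Agr n x y) (a : X n) :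
    Agr (n+1) (Function.update x n a) (Function.update y n a) := fun m hm => by
  by_cases hmn : m = n
  · subst hmn; simp
  · simp only [Function.update_of_ne hmn]; exact h m (by omega)
theorem Agr.upd_self {X : ℕ → Type} (n : ℕ) (x : ∀ n, X n) (a : X n) :
    Agr n x (Function.update x n a) := fun m hm => by
  simp [Function.update_of_ne (Nat.ne_of_lt hm)]

/-- A (total) strategy: a move at each level, depending on the previous moves only. -/
structure Strat (X : ℕ → Type) where
  f : ∀ n, (∀ m, X m) → X n
  loc : ∀ n x y, Agr n x y → f n x = f n y

@[ext] theorem Strat.ext {X : ℕ → Type} {S T : Strat X} (h : ∀ n, S.f n = T.f n) : S = T := by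
  cases S; cases T; congr; exact funext h

section build
variable {X : ℕ → Type}

/-- finite stages of the play obtained by following a rule -/
noncomputable def stg (S : Strat X) (x0 : ∀ n, X n) : ℕ → (∀ n, X n)
  | 0 => x0
  | n+1 => Function.update (stg S x0 n) n (S.f n (stg S x0 n))

/-- The play obtained by following `S` at the levels in `c` and `y` elsewhere. -/
noncomputable def mixS (c : ℕ → Prop) (S : Strat X) (y : ∀ n, X n) : Strat X where
  f n x := if c n then S.f n x else y n
  loc n x y' h := by rw [S.loc n x y' h]

noncomputable def run (c : ℕ → Prop) (S : Strat X) (y : ∀ n, X n) : ∀ n, X n :=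
  fun n => stg (mixS c S y) y (n+1) n

theorem stg_stable (S : Strat X) (x0 : ∀ n, X n) (n m k : ℕ) (h : m < n) (hk : n ≤ k) :
    stg S x0 k m = stg S x0 n m := by
  induction k, hk using Nat.le_induction with
  | base => rfl
  | succ k hk ih =>
    rw [stg, Function.update_of_ne (by omega), ih]

theorem stg_run (c : ℕ → Prop) (S : Strat X) (y : ∀ n, X n) (n : ℕ) :
    Agr n (stg (mixS c S y) y n) (run c S y) := fun m hm => by
  unfold run
  exact stg_stable _ _ (m+1) m n (by omega) (by omega)

theorem run_eq (c : ℕ → Prop) (S : Strat X) (y : ∀ n, X n) (n : ℕ) :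
    run c S y n = if c n then S.f n (run c S y) else y n := by
  have : run c S y n = (mixS c S y).f n (run c S y) := by
    conv_lhs => rw [run, stg]
    rw [Function.update_self]
    exact (mixS c S y).loc n _ _ (stg_run c S y n)
  rw [this]; rfl

theorem run_pos {c : ℕ → Prop} (S : Strat X) (y : ∀ n, X n) {n : ℕ} (h : c n) :
    run c S y n = S.f n (run c S y) := by rw [run_eq, if_pos h]
theorem run_neg {c : ℕ → Prop} (S : Strat X) (y : ∀ n, X n) {n : ℕ} (h : ¬ c n) :
    run c S y n = y n := by rw [run_eq, if_neg h]

/-- `run` depends on the data in a level-local way. -/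
theorem run_congr {c : ℕ → Prop} {S S' : Strat X} {y y' : ∀ n, X n} {n : ℕ}
    (hS : ∀ m, m < n → S.f m = S'.f m) (hy : ∀ m, m < n → ¬ c m → y m = y' m) :
    Agr n (run c S y) (run c S' y') := by
  intro m
  induction m using Nat.strong_induction_on with
  | _ m ih =>
    intro hm
    by_cases hc : c m
    · rw [run_pos S y hc, run_pos S' y' hc, hS m hm]
      exact S'.loc m _ _ (fun j hj => ih j hj (by omega))
    · rw [run_neg S y hc, run_neg S' y' hc]; exact hy m hm hc

/-- a play following the rule is the run -/
theorem run_unique {c : ℕ → Prop} {S : Strat X} {y x : ∀ n, X n} {n : ℕ}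
    (h1 : ∀ m, m < n → c m → x m = S.f m x) (h2 : ∀ m, m < n → ¬ c m → x m = y m) :
    Agr n (run c S y) x := by
  intro m
  induction m using Nat.strong_induction_on with
  | _ m ih =>
    intro hm
    by_cases hc : c m
    · rw [run_pos S y hc, h1 m hm hc]
      exact S.loc m _ _ (fun j hj => ih j hj (by omega))
    · rw [run_neg S y hc, h2 m hm hc]

end build

section win
variable {X : ℕ → Type}

/-- `x` follows `S` for player `b` from level `n` on. -/
def Fol (b : ℕ) (S : Strat X) (n : ℕ) (x : ∀ n, X n) : Prop :=
  ∀ m, n ≤ m → m % 2 = b → x m = S.f m x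

/-- Player `b` can force the play into `B` from the position `(n,x)`. -/
def Win (b : ℕ) (B : Set (∀ n, X n)) (n : ℕ) (x : ∀ n, X n) : Prop :=
  ∃ S : Strat X, ∀ y, Agr n x y → Fol b S n y → y ∈ B

theorem win_congr {b : ℕ} {B : Set (∀ n, X n)} {n : ℕ} {x y : ∀ n, X n} (h : Agr n x y) :
    Win b B n x ↔ Win b B n y := by
  constructor
  · rintro ⟨S, hS⟩; exact ⟨S, fun z hz => hS z (h.trans hz)⟩
  · rintro ⟨S, hS⟩; exact ⟨S, fun z hz => hS z (h.symm.trans hz)⟩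

theorem win_of_own {b : ℕ} {B : Set (∀ n, X n)} {n : ℕ} {x : ∀ n, X n} (hn : n % 2 = b) (a : X n)
    (h : Win b B (n+1) (Function.update x n a)) : Win b B n x := by
  obtain ⟨S, hS⟩ := h
  refine ⟨⟨fun m y => if h : m = n then h ▸ a else S.f m y, ?_⟩, ?_⟩
  · intro m y y' hy
    by_cases hm : m = n
    · simp [hm]
    · simp [hm, S.loc m y y' hy]
  · intro y hy hf
    have hyn : y n = a := by
      have := hf n le_rfl hn
      simpa using this
    refine hS y ?_ ?_
    · refine Agr.succ ((Agr.upd_self n x a).symm.trans hy) ?_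
      simp [hyn]
    · intro m hm hb
      have := hf m (by omega) hb
      simpa [show m ≠ n by omega] using this

theorem win_of_opp {b : ℕ} {B : Set (∀ n, X n)} {n : ℕ} {x : ∀ n, X n} (hn : n % 2 ≠ b)
    (h : ∀ a, Win b B (n+1) (Function.update x n a)) : Win b B n x := by
  choose S hS using h
  refine ⟨⟨fun m y => if n < m then (S (y n)).f m y else (S (x n)).f m y, ?_⟩, ?_⟩
  · intro m y y' hy
    by_cases hm : n < m
    · simp only [hm, if_true]
      rw [hy n hm]; exact (S (y' n)).loc m y y' hy
    · simp only [hm, if_false]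
      exact (S _).loc m y y' hy
  · intro y hy hf
    refine hS (y n) y ?_ ?_
    · refine Agr.succ ((Agr.upd_self n x _).symm.trans hy) ?_
      simp
    · intro m hm hb
      have := hf m (by omega) hb
      simpa [show n < m by omega] using this

theorem win_triv {b : ℕ} {B : Set (∀ n, X n)} {n : ℕ} {x : ∀ n, X n}
    (h : ∀ y, Agr n x y → y ∈ B) : Win b B n x :=
  ⟨⟨fun m _ => x m, fun _ _ _ _ => rfl⟩, fun y hy _ => h y hy⟩

theorem win_exists {b : ℕ} {B : Set (∀ n, X n)} {n : ℕ} {x : ∀ n, X n}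
    (h : Win b B n x) : ∃ y, Agr n x y ∧ y ∈ B := by
  obtain ⟨S, hS⟩ := h
  have h1 : Agr n x (run (fun m => n ≤ m ∧ m % 2 = b) S x) := fun m hm => by
    rw [run_neg]; omega
  refine ⟨_, h1, hS _ h1 ?_⟩
  intro m hm hb
  rw [run_pos (c := fun m => n ≤ m ∧ m % 2 = b) S x ⟨hm, hb⟩]

/-- Finite depth sets. -/
def FD (A : Set (∀ n, X n)) : Prop := ∃ n, ∀ x y, Agr n x y → (x ∈ A ↔ y ∈ A)

/-- Determinacy of the game where player 0 wants the play to be in `A`. -/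
def Det (A : Set (∀ n, X n)) : Prop :=
  (∃ S : Strat X, ∀ x, Fol 0 S 0 x → x ∈ A) ∨ (∃ S : Strat X, ∀ x, Fol 1 S 0 x → x ∉ A)

theorem det_of_FD [hX : ∀ n, Nonempty (X n)] {A : Set (∀ n, X n)} (h : FD A) : Det A := by
  obtain ⟨n, hn⟩ := h
  have key : ∀ d m, m + d = n → ∀ x, Win 0 A m x ∨ Win 1 Aᶜ m x := by
    intro d
    induction d with
    | zero =>
      intro m hm x
      by_cases hx : x ∈ A
      · exact Or.inl (win_triv fun y hy => (hn x y (by rwa [← hm])).1 hx)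
      · exact Or.inr (win_triv fun y hy hA => hx ((hn x y (by rwa [← hm])).2 hA))
    | succ d ih =>
      intro m hm x
      have ih' := ih (m+1) (by omega)
      rcases Nat.mod_two_eq_zero_or_one m with h0 | h1
      · by_cases hex : ∃ a, Win 0 A (m+1) (Function.update x m a)
        · obtain ⟨a, ha⟩ := hex
          exact Or.inl (win_of_own h0 a ha)
        · push Not at hex
          refine Or.inr (win_of_opp (by omega) fun a => ?_)
          exact (ih' _).resolve_left (hex a)
      · by_cases hex : ∃ a, Win 1 Aᶜ (m+1) (Function.update x m a)
        · obtain ⟨a, ha⟩ := hex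
          exact Or.inr (win_of_own h1 a ha)
        · push Not at hex
          refine Or.inl (win_of_opp (by omega) fun a => ?_)
          exact (ih' _).resolve_right (hex a)
  have x0 : ∀ n, X n := fun n => (hX n).some
  have ag0 : ∀ y, Agr 0 x0 y := fun y m hm => by omega
  rcases key n 0 (by omega) x0 with ⟨S, hS⟩ | ⟨S, hS⟩
  · exact Or.inl ⟨S, fun x hx => hS x (ag0 x) hx⟩
  · exact Or.inr ⟨S, fun x hx => hS x (ag0 x) hx⟩

end win

/-- Level-preserving maps. -/
def Lip {X X' : ℕ → Type} (p : (∀ n, X' n) → (∀ n, X n)) : Prop :=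
  ∀ n x y, Agr n x y → Agr n (p x) (p y)

/-- A covering of `X` by `X'` which is the identity (up to bijections) below level `k`. -/
structure Cov (X X' : ℕ → Type) (k : ℕ) where
  π : (∀ n, X' n) → (∀ n, X n)
  lip : Lip π
  φ : ℕ → Strat X' → Strat X
  φ_lip : ∀ b S T n, (∀ m, m ≤ n → S.f m = T.f m) → (φ b S).f n = (φ b T).f n
  lift : ∀ b, b < 2 → ∀ S x, Fol b (φ b S) 0 x → ∃ x', Fol b S 0 x' ∧ π x' = x
  e : ∀ n, n < k → X' n ≃ X n
  π_fix : ∀ n (h : n < k) x', π x' n = e n h (x' n)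
  φ_fix : ∀ b, b < 2 → ∀ S n (h : n < k) x', (φ b S).f n (π x') = e n h (S.f n x')

theorem FD.preimage {X X' : ℕ → Type} {p : (∀ n, X' n) → (∀ n, X n)} (hp : Lip p)
    {A : Set (∀ n, X n)} (h : FD A) : FD (p ⁻¹' A) := by
  obtain ⟨n, hn⟩ := h
  exact ⟨n, fun x y hxy => hn _ _ (hp n x y hxy)⟩

theorem Cov.det {X X' : ℕ → Type} {k : ℕ} (c : Cov X X' k) {A : Set (∀ n, X n)}
    (h : Det (c.π ⁻¹' A)) : Det A := by
  rcases h with ⟨S, hS⟩ | ⟨S, hS⟩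
  · refine Or.inl ⟨c.φ 0 S, fun x hx => ?_⟩
    obtain ⟨x', h1, rfl⟩ := c.lift 0 (by omega) S x hx
    exact hS x' h1
  · refine Or.inr ⟨c.φ 1 S, fun x hx => ?_⟩
    obtain ⟨x', h1, rfl⟩ := c.lift 1 (by omega) S x hx
    exact hS x' h1

/-- identity covering -/
def Cov.id (X : ℕ → Type) (k : ℕ) : Cov X X k where
  π x := x
  lip _ _ _ h := h
  φ _ S := S
  φ_lip _ _ _ n h := h n le_rfl
  lift _ _ _ x h := ⟨x, h, rfl⟩
  e _ _ := Equiv.refl _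
  π_fix _ _ _ := rfl
  φ_fix _ _ _ _ _ _ := rfl

def Cov.comp {X X' X'' : ℕ → Type} {k : ℕ} (c : Cov X X' k) (d : Cov X' X'' k) : Cov X X'' k where
  π x := c.π (d.π x)
  lip n x y h := c.lip n _ _ (d.lip n x y h)
  φ b S := c.φ b (d.φ b S)
  φ_lip b S T n h := c.φ_lip b _ _ n fun m hm => d.φ_lip b S T m fun j hj => h j (hj.trans hm)
  lift b hb S x h := by
    obtain ⟨x', h1, rfl⟩ := c.lift b hb _ x h
    obtain ⟨x'', h2, rfl⟩ := d.lift b hb _ x' h1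
    exact ⟨x'', h2, rfl⟩
  e n h := (d.e n h).trans (c.e n h)
  π_fix n h x := by simp [c.π_fix n h, d.π_fix n h]
  φ_fix b hb S n h x := by simp [c.φ_fix b hb _ n h, d.φ_fix b hb _ n h]

def Cov.weaken {X X' : ℕ → Type} {k k' : ℕ} (c : Cov X X' k) (h : k' ≤ k) : Cov X X' k' where
  π := c.π
  lip := c.lip
  φ := c.φ
  φ_lip := c.φ_lip
  lift := c.lift
  e n hn := c.e n (by omega)
  π_fix n hn := c.π_fix n (by omega)
  φ_fix b hb S n hn := c.φ_fix b hb S n (by omega)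

end BD

namespace BD

theorem chain_exists (n : ℕ) : ∀ (V : ℕ → Type) (g : ∀ i, V (i+1) → V i),
    (∀ i, n ≤ i → Function.Surjective (g i)) → ∀ a : V n,
    ∃ v : ∀ i, V i, v n = a ∧ ∀ i, v i = g i (v (i+1)) := by
  induction n with
  | zero =>
    intro V g hg a
    choose r hr using fun i => hg i (Nat.zero_le i)
    exact ⟨fun i => Nat.rec a (fun i b => r i b) i, rfl, fun i => (hr i _).symm⟩
  | succ n ih =>
    intro V g hg a
    obtain ⟨v, h1, h2⟩ := ih (fun i => V (i+1)) (fun i => g (i+1)) (fun i hi => hg (i+1) (by omega)) a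
    refine ⟨fun i => Nat.casesOn i (g 0 (v 0)) (fun i => v i), h1, fun i => ?_⟩
    cases i with
    | zero => rfl
    | succ i => exact h2 i

theorem chain_unique (n : ℕ) (V : ℕ → Type) (g g' : ∀ i, V (i+1) → V i) (hgg : g = g')
    (hg : ∀ i, n ≤ i → Function.Injective (g i)) (v v' : ∀ i, V i)
    (h : ∀ i, v i = g i (v (i+1))) (h' : ∀ i, v' i = g' i (v' (i+1))) (hn : v n = v' n) :
    ∀ i, v i = v' i := by
  subst hgg
  have up : ∀ i, n ≤ i → v i = v' i := by
    intro i hi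
    induction i, hi using Nat.le_induction with
    | base => exact hn
    | succ i hi ih => exact hg i hi (by rw [← h, ← h', ih])
  have down : ∀ d i, i + d = n → v i = v' i := by
    intro d
    induction d with
    | zero => intro i hi; exact up i (by omega)
    | succ d ih => intro i hi; rw [h, h', ih (i+1) (by omega)]
  intro i
  rcases le_total n i with h1 | h1
  · exact up i h1
  · exact down (n-i) i (by omega)

section thread
variable {Y : ℕ → ℕ → Type} (p : ∀ i, (∀ n, Y (i+1) n) → (∀ n, Y i n))

/-- level bijectivity -/
def LevBij : Prop := ∀ i n, n ≤ i → ∀ w : ∀ n, Y (i+1) n,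
  Function.Bijective (fun a => p i (Function.update w n a) n)

variable {p}

theorem thread_unique (hl : ∀ i, Lip (p i)) (hb : LevBij p) (y y' : ∀ i n, Y i n)
    (hy : ∀ i, p i (y (i+1)) = y i) (hy' : ∀ i, p i (y' (i+1)) = y' i) (n : ℕ)
    (h : ∀ m, m < n → y m m = y' m m) (i : ℕ) : Agr n (y i) (y' i) := by
  induction n generalizing i with
  | zero => intro m hm; omega
  | succ n ih =>
    have ih' := ih (fun m hm => h m (by omega))
    refine Agr.succ (ih' i) ?_
    have e1 : ∀ (z : ∀ i n, Y i n) (hz : ∀ i, p i (z (i+1)) = z i) i,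
        z i n = p i (Function.update (z (i+1)) n (z (i+1) n)) n := by
      intro z hz i; rw [Function.update_eq_self, hz]
    refine chain_unique n (fun i => Y i n) (fun i a => p i (Function.update (y (i+1)) n a) n)
      (fun i a => p i (Function.update (y' (i+1)) n a) n) ?_ (fun i hi => (hb i n hi _).1)
      (fun i => y i n) (fun i => y' i n) (e1 y hy) (e1 y' hy') (h n (by omega)) i
    funext i a
    exact hl i (n+1) _ _ ((ih' (i+1)).upd a) n (by omega)

theorem thread_exists [hne : ∀ i n, Nonempty (Y i n)] (hl : ∀ i, Lip (p i)) (hb : LevBij p) (x : ∀ n, Y n n) :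
    ∃ y : ∀ i n, Y i n, (∀ i, p i (y (i+1)) = y i) ∧ ∀ n, y n n = x n := by
  have step : ∀ (n : ℕ) (T : ∀ i n, Y i n), ∃ v : ∀ i, Y i n,
      v n = x n ∧ ∀ i, v i = p i (Function.update (T (i+1)) n (v (i+1))) n := fun n T =>
    chain_exists n (fun i => Y i n) (fun i a => p i (Function.update (T (i+1)) n a) n)
      (fun i hi => (hb i n hi _).2) (x n)
  choose v hv1 hv2 using step
  let T : ℕ → ∀ i n, Y i n := fun n => Nat.rec (fun i n => (hne i n).some)
    (fun n T i => Function.update (T i) n (v n T i)) n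
  have hT : ∀ n i, T (n+1) i = Function.update (T n i) n (v n (T n) i) := fun n i => rfl
  have stab : ∀ m n i, m < n → T n i m = v m (T m) i := by
    intro m n i hmn
    induction n, hmn using Nat.le_induction with
    | base => rw [hT]; simp
    | succ n hn ih => rw [hT, Function.update_of_ne (by omega), ih]
  have agr : ∀ n i, Agr n (T n i) (fun m => T (m+1) i m) := fun n i m hm => by
    show T n i m = T (m+1) i m
    rw [stab m n i hm, stab m (m+1) i (by omega)]
  refine ⟨fun i n => T (n+1) i n, fun i => ?_, fun n => ?_⟩
  · funext n
    have h1 := hl i (n+1) _ _ (agr (n+1) (i+1)) n (by omega)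
    show _ = T (n+1) i n
    rw [← h1, hT, ← hv2 n (T n) i, stab n (n+1) i (by omega)]
  · simp only [stab n (n+1) n (by omega), hv1]

end thread

/-- local functions at a level -/
abbrev LF (X : ℕ → Type) (n : ℕ) : Type := {f : (∀ m, X m) → X n // ∀ x y, Agr n x y → f x = f y}

instance {X : ℕ → Type} [h : ∀ n, Nonempty (X n)] (n : ℕ) : Nonempty (LF X n) :=
  ⟨⟨fun _ => (h n).some, fun _ _ _ => rfl⟩⟩

def Strat.toLF {X : ℕ → Type} (S : Strat X) : ∀ n, LF X n := fun n => ⟨S.f n, S.loc n⟩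
def Strat.ofLF {X : ℕ → Type} (S : ∀ n, LF X n) : Strat X := ⟨fun n => (S n).1, fun n => (S n).2⟩

theorem Cov.levbij_π {X X' : ℕ → Type} {K : ℕ} (c : Cov X X' K) (n : ℕ) (hn : n < K) (w : ∀ n, X' n) :
    Function.Bijective (fun a => c.π (Function.update w n a) n) := by
  have : (fun a => c.π (Function.update w n a) n) = c.e n hn := by
    funext a; rw [c.π_fix n hn]; simp
  rw [this]; exact (c.e n hn).bijective

theorem Cov.π_surj {X X' : ℕ → Type} [hne : ∀ n, Nonempty (X' n)] {K : ℕ} (c : Cov X X' K)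
    (x : ∀ n, X n) : ∃ x', Agr K (c.π x') x := by
  refine ⟨fun n => if h : n < K then (c.e n h).symm (x n) else (hne n).some, fun m hm => ?_⟩
  rw [c.π_fix m hm]; simp [hm]

theorem Cov.levbij_φ {X X' : ℕ → Type} [hne : ∀ n, Nonempty (X' n)] {K : ℕ} (c : Cov X X' K) (b : ℕ)
    (hb : b < 2) (n : ℕ) (hn : n < K) (w : ∀ n, LF X' n) :
    Function.Bijective (fun a => (c.φ b (Strat.ofLF (Function.update w n a))).toLF n) := by
  have key : ∀ a x', (c.φ b (Strat.ofLF (Function.update w n a))).f n (c.π x') = c.e n hn (a.1 x') := by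
    intro a x'
    rw [c.φ_fix b hb _ n hn]; simp [Strat.ofLF]
  constructor
  · intro a a' h
    have h' : ∀ x, (c.φ b (Strat.ofLF (Function.update w n a))).f n x
        = (c.φ b (Strat.ofLF (Function.update w n a'))).f n x := fun x =>
      congrFun (congrArg Subtype.val h) x
    apply Subtype.ext; funext x'
    have := h' (c.π x')
    rw [key, key] at this
    exact (c.e n hn).injective this
  · intro F
    refine ⟨⟨fun x' => (c.e n hn).symm (F.1 (c.π x')), fun x y h => by
      show (c.e n hn).symm _ = (c.e n hn).symm _
      rw [F.2 _ _ (c.lip n x y h)]⟩, ?_⟩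
    apply Subtype.ext; funext x
    obtain ⟨x', hx'⟩ := c.π_surj x
    have hx := (hx'.mono hn.le)
    show (c.φ b _).f n x = F.1 x
    rw [← (c.φ b _).loc n _ _ hx, key, ← F.2 _ _ hx]
    simp

section limit
variable {X : ℕ → ℕ → Type} [hne : ∀ i n, Nonempty (X i n)] {k : ℕ}
  (c : ∀ i, Cov (X i) (X (i+1)) (k+i+1))

theorem dn_exists (j : ℕ) (w : ∀ n, X j n) :
    ∃ y : ∀ i n, X i n, y j = w ∧ ∀ i, i < j → (c i).π (y (i+1)) = y i := by
  induction j with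
  | zero =>
    exact ⟨Function.update (fun i n => (hne i n).some) 0 w, by simp, fun i hi => by omega⟩
  | succ j ih =>
    obtain ⟨y, h1, h2⟩ := ih ((c j).π w)
    refine ⟨Function.update y (j+1) w, by simp, fun i hi => ?_⟩
    rw [Function.update_of_ne (show i ≠ j+1 by omega)]
    rcases Nat.lt_succ_iff_lt_or_eq.mp hi with h | h
    · rw [Function.update_of_ne (show i+1 ≠ j+1 by omega)]; exact h2 i h
    · subst h; simp [h1]

theorem dn_agr (j n : ℕ) (y y' : ∀ i n, X i n) (h : Agr n (y j) (y' j))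
    (hy : ∀ i, i < j → (c i).π (y (i+1)) = y i) (hy' : ∀ i, i < j → (c i).π (y' (i+1)) = y' i)
    (i : ℕ) (hi : i ≤ j) : Agr n (y i) (y' i) := by
  have down : ∀ d i, i + d = j → Agr n (y i) (y' i) := by
    intro d
    induction d with
    | zero => intro i hi; obtain rfl : i = j := by omega
              exact h
    | succ d ih =>
      intro i hi; rw [← hy i (by omega), ← hy' i (by omega)]
      exact (c i).lip n _ _ (ih (i+1) (by omega))
  exact down (j-i) i (by omega)

/-- diagonal of the projections of a play at stage `j` -/
noncomputable def rdiag (j : ℕ) (w : ∀ n, X j n) : ∀ n, X n n :=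
  fun m => (dn_exists c j w).choose m m

theorem rdiag_eq (y : ∀ i n, X i n) (j : ℕ) (hy : ∀ i, i < j → (c i).π (y (i+1)) = y i) :
    Agr (j+1) (rdiag c j (y j)) (fun m => y m m) := fun m hm => by
  have h := (dn_exists c j (y j)).choose_spec
  exact dn_agr c j (m+1) _ _ (by rw [h.1]; exact Agr.refl _ _) h.2 hy m (by omega) m (by omega)

theorem rdiag_agr (j : ℕ) (w w' : ∀ n, X j n) (h : Agr j w w') :
    Agr j (rdiag c j w) (rdiag c j w') := fun m hm => by
  have h1 := (dn_exists c j w).choose_spec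
  have h2 := (dn_exists c j w').choose_spec
  exact dn_agr c j j _ _ (by rw [h1.1, h2.1]; exact h) h1.2 h2.2 m (by omega) m (by omega)

theorem play_thread (x : ∀ n, X n n) : ∃ y : ∀ i n, X i n,
    (∀ i, (c i).π (y (i+1)) = y i) ∧ ∀ n, y n n = x n :=
  thread_exists (p := fun i => (c i).π) (fun i => (c i).lip)
    (fun i n hn w => (c i).levbij_π n (by omega) w) x

noncomputable def thr (x : ∀ n, X n n) : ∀ i n, X i n := (play_thread c x).choose
theorem thr_π (x : ∀ n, X n n) (i : ℕ) : (c i).π (thr c x (i+1)) = thr c x i :=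
  (play_thread c x).choose_spec.1 i
theorem thr_diag (x : ∀ n, X n n) (n : ℕ) : thr c x n n = x n :=
  (play_thread c x).choose_spec.2 n
theorem thr_unique (y y' : ∀ i n, X i n)
    (hy : ∀ i, (c i).π (y (i+1)) = y i) (hy' : ∀ i, (c i).π (y' (i+1)) = y' i) (n : ℕ)
    (h : ∀ m, m < n → y m m = y' m m) (i : ℕ) : Agr n (y i) (y' i) :=
  thread_unique (p := fun i => (c i).π) (fun i => (c i).lip)
    (fun i n hn w => (c i).levbij_π n (by omega) w) y y' hy hy' n h i
theorem thr_lip (i : ℕ) : Lip (fun x : ∀ n, X n n => thr c x i) := fun n x y h =>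
  thr_unique c _ _ (thr_π c x) (thr_π c y) n (fun m hm => by rw [thr_diag, thr_diag, h m hm]) i

/-- strategy map in LF form -/
noncomputable def sp (b : ℕ) (i : ℕ) (S : ∀ n, LF (X (i+1)) n) : ∀ n, LF (X i) n :=
  ((c i).φ b (Strat.ofLF S)).toLF

theorem sp_lip (b i : ℕ) : Lip (sp c b i) := by
  intro n S T h m hm
  apply Subtype.ext
  exact (c i).φ_lip b _ _ m (fun j hj => by simp [Strat.ofLF, h j (by omega)])

theorem sp_bij (b : ℕ) (hb : b < 2) : LevBij (Y := fun i n => LF (X i) n) (sp c b) := fun i n hn w =>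
  (c i).levbij_φ b hb n (by omega) w

noncomputable def sdiag (S : Strat (fun n => X n n)) : ∀ n, LF (X n) n :=
  fun n => ⟨fun w => S.f n (rdiag c n w), fun w w' h => S.loc n _ _ (rdiag_agr c n w w' h)⟩

theorem strat_thread (b : ℕ) (hb : b < 2) (S : Strat (fun n => X n n)) :
    ∃ y : ∀ i n, LF (X i) n, (∀ i, sp c b i (y (i+1)) = y i) ∧ ∀ n, y n n = sdiag c S n :=
  thread_exists (Y := fun i n => LF (X i) n) (sp_lip c b) (sp_bij c b hb) _

noncomputable def sthr (b : ℕ) (S : Strat (fun n => X n n)) (i : ℕ) : Strat (X i) :=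
  if hb : b < 2 then Strat.ofLF ((strat_thread c b hb S).choose i)
  else Strat.ofLF (fun n => ⟨fun _ => (hne i n).some, fun _ _ _ => rfl⟩)

theorem sthr_φ (b : ℕ) (hb : b < 2) (S : Strat (fun n => X n n)) (i : ℕ) :
    (c i).φ b (sthr c b S (i+1)) = sthr c b S i := by
  have := (strat_thread c b hb S).choose_spec.1 i
  simp only [sthr, hb, dif_pos]
  rw [← this]; rfl

theorem sthr_diag (b : ℕ) (hb : b < 2) (S : Strat (fun n => X n n)) (n : ℕ) (w : ∀ m, X n m) :
    (sthr c b S n).f n w = S.f n (rdiag c n w) := by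
  have := (strat_thread c b hb S).choose_spec.2 n
  simp only [sthr, hb, dif_pos]
  show ((strat_thread c b hb S).choose n n).1 w = _
  rw [this]; rfl

theorem sthr_lip (b : ℕ) (S T : Strat (fun n => X n n)) (n : ℕ)
    (h : ∀ m, m ≤ n → S.f m = T.f m) (i : ℕ) : (sthr c b S i).f n = (sthr c b T i).f n := by
  by_cases hb : b < 2
  · have h1 := (strat_thread c b hb S).choose_spec
    have h2 := (strat_thread c b hb T).choose_spec
    have := thread_unique (Y := fun i n => LF (X i) n) (sp_lip c b) (sp_bij c b hb) _ _ h1.1 h2.1 (n+1)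
      (fun m hm => by rw [h1.2, h2.2]; apply Subtype.ext; simp [sdiag, h m (by omega)]) i n (by omega)
    simp only [sthr, hb, dif_pos]
    exact congrArg Subtype.val this
  · simp only [sthr, hb, dif_neg, not_false_iff]

noncomputable def elim (n : ℕ) (hn : n < k) : ∀ i, X i n ≃ X 0 n
  | 0 => Equiv.refl _
  | i+1 => ((c i).e n (by omega)).trans (elim n hn i)

theorem elim_play (n : ℕ) (hn : n < k) (y : ∀ i n, X i n) (hy : ∀ i, (c i).π (y (i+1)) = y i)
    (i : ℕ) : elim c n hn i (y i n) = y 0 n := by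
  induction i with
  | zero => rfl
  | succ i ih =>
    rw [← ih, ← hy i, (c i).π_fix n (by omega)]; rfl

theorem elim_strat (n : ℕ) (hn : n < k) (y : ∀ i n, X i n) (hy : ∀ i, (c i).π (y (i+1)) = y i)
    (b : ℕ) (hb : b < 2) (S : Strat (fun n => X n n))
    (i : ℕ) : elim c n hn i ((sthr c b S i).f n (y i)) = (sthr c b S 0).f n (y 0) := by
  induction i with
  | zero => rfl
  | succ i ih =>
    rw [← ih, ← hy i, ← sthr_φ c b hb S i, (c i).φ_fix b hb _ n (by omega)]; rfl

/-- The limit covering. -/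
noncomputable def Cov.lim : Cov (X 0) (fun n => X n n) k where
  π x := thr c x 0
  lip := thr_lip c 0
  φ b S := sthr c b S 0
  φ_lip b S T n h := sthr_lip c b S T n h 0
  lift b hb S x hx := by
    have step : ∀ i (z : {z : ∀ n, X i n // Fol b (sthr c b S i) 0 z}),
        ∃ z' : {z : ∀ n, X (i+1) n // Fol b (sthr c b S (i+1)) 0 z}, (c i).π z'.1 = z.1 := by
      rintro i ⟨z, hz⟩
      rw [← sthr_φ c b hb S i] at hz
      obtain ⟨z', h1, h2⟩ := (c i).lift b hb _ z hz
      exact ⟨⟨z', h1⟩, h2⟩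
    choose nx hnx using step
    let y : ∀ i, {z : ∀ n, X i n // Fol b (sthr c b S i) 0 z} := fun i =>
      Nat.rec ⟨x, hx⟩ (fun i z => nx i z) i
    have hy : ∀ i, (c i).π (y (i+1)).1 = (y i).1 := fun i => hnx i (y i)
    refine ⟨fun n => (y n).1 n, ?_, ?_⟩
    · intro n _ hn
      show (y n).1 n = _
      rw [(y n).2 n (Nat.zero_le _) hn, sthr_diag c b hb]
      exact S.loc n _ _ ((rdiag_eq c (fun i => (y i).1) n (fun i _ => hy i)).mono (by omega))
    · show thr c _ 0 = (y 0).1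
      funext n
      exact thr_unique c _ (fun i => (y i).1) (thr_π c _) hy (n+1)
        (fun m _ => by rw [thr_diag]) 0 n (by omega)
  e n hn := elim c n hn n
  π_fix n hn x := by
    rw [← thr_diag c x n]
    exact (elim_play c n hn (thr c x) (thr_π c x) n).symm
  φ_fix b hb S n hn x := by
    have := elim_strat c n hn (thr c x) (thr_π c x) b hb S n
    rw [← this, sthr_diag c b hb]
    congr 1
    refine S.loc n _ _ (((rdiag_eq c (thr c x) n (fun i _ => thr_π c x i)).mono (by omega)).trans ?_)
    intro m _; exact thr_diag c x m

theorem limit_cov : ∃ d : Cov (X 0) (fun n => X n n) k,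
    ∃ q : ∀ i, (∀ n, X n n) → (∀ n, X i n), (∀ i, Lip (q i)) ∧ q 0 = d.π ∧
      ∀ i x, (c i).π (q (i+1) x) = q i x :=
  ⟨Cov.lim c, fun i x => thr c x i, thr_lip c, rfl, fun i x => thr_π c x i⟩

end limit

end BD

namespace BD

section unravel
variable {X : ℕ → Type} [hX : ∀ n, Nonempty (X n)]

/-- open sets -/
def Opn (O : Set (∀ n, X n)) : Prop := ∀ x ∈ O, ∃ n, ∀ y, Agr n x y → y ∈ O

variable (O : Set (∀ n, X n)) (k : ℕ)

noncomputable def Nn (u : ∀ n, X n) : ℕ := sInf {n | k + 2 ≤ n ∧ ∀ y, Agr n u y → y ∈ O}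

def sat (W : Set (∀ n, X n)) : Set (∀ n, X n) := {x | ∃ u ∈ W, Agr (Nn O k u) u x}

variable {O k}

theorem Nn_spec (hO : Opn O) {u : ∀ n, X n} (hu : u ∈ O) :
    k + 2 ≤ Nn O k u ∧ ∀ y, Agr (Nn O k u) u y → y ∈ O := by
  have : {n | k + 2 ≤ n ∧ ∀ y, Agr n u y → y ∈ O}.Nonempty := by
    obtain ⟨n, hn⟩ := hO u hu
    exact ⟨n + (k+2), by omega, fun y hy => hn y (hy.mono (by omega))⟩
  exact Nat.sInf_mem this

theorem Nn_congr (hO : Opn O) {u y : ∀ n, X n} (hu : u ∈ O) (h : Agr (Nn O k u) u y) :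
    Nn O k y = Nn O k u := by
  have h1 := Nn_spec (k := k) hO hu
  have hy := h1.2 y h
  have h2 := Nn_spec (k := k) hO hy
  have a : Nn O k y ≤ Nn O k u := Nat.sInf_le ⟨h1.1, fun z hz => h1.2 z (h.trans hz)⟩
  refine le_antisymm a (Nat.sInf_le ⟨h2.1, fun z hz => h2.2 z (((h.mono a).symm).trans hz)⟩)

theorem sat_sub (hO : Opn O) {W : Set (∀ n, X n)} (hW : W ⊆ O) : sat O k W ⊆ O := by
  rintro x ⟨u, hu, h⟩; exact (Nn_spec hO (hW hu)).2 x h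

theorem sub_sat {W : Set (∀ n, X n)} : W ⊆ sat O k W := fun u hu => ⟨u, hu, Agr.refl _ _⟩

theorem sat_cyl (hO : Opn O) {W : Set (∀ n, X n)} (hW : W ⊆ O) {x y : ∀ n, X n} (hx : x ∈ sat O k W)
    (h : Agr (Nn O k x) x y) : y ∈ sat O k W := by
  obtain ⟨u, hu, hux⟩ := hx
  exact ⟨u, hu, hux.trans (by rwa [Nn_congr hO (hW hu) hux] at h)⟩

theorem cosat_cyl (hO : Opn O) {W : Set (∀ n, X n)} (hW : W ⊆ O) {x y : ∀ n, X n} (hx : x ∈ O \ sat O k W)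
    (h : Agr (Nn O k x) x y) : y ∈ O \ sat O k W := by
  refine ⟨(Nn_spec hO hx.1).2 y h, fun hy => hx.2 (sat_cyl hO hW hy ?_)⟩
  rw [Nn_congr hO hx.1 h]; exact h.symm

theorem sat_cosat (hO : Opn O) {W : Set (∀ n, X n)} (hW : W ⊆ O) :
    sat O k (O \ sat O k W) = O \ sat O k W := by
  refine Set.Subset.antisymm ?_ sub_sat
  rintro x ⟨u, hu, h⟩
  exact cosat_cyl hO hW hu h

theorem cosat_cosat (hO : Opn O) {W : Set (∀ n, X n)} (hW : W ⊆ O) :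
    O \ sat O k (O \ sat O k W) = sat O k W := by
  rw [sat_cosat hO hW]
  exact Set.diff_diff_cancel_left (sat_sub hO hW)

theorem sat_O (hO : Opn O) : sat O k O = O := Set.Subset.antisymm (sat_sub hO le_rfl) sub_sat

variable (O k)
/-- undecided positions -/
def R2 (W : Set (∀ n, X n)) (n : ℕ) (x : ∀ n, X n) : Prop :=
  ¬ Win 0 (sat O k W) n x ∧ ¬ Win 1 (O \ sat O k W) n x
variable {O k}

theorem R2_congr {W : Set (∀ n, X n)} {n : ℕ} {x y : ∀ n, X n} (h : Agr n x y) :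
    R2 O k W n x ↔ R2 O k W n y := by
  unfold R2; rw [win_congr h, win_congr h]

theorem R2_step {W : Set (∀ n, X n)} {n : ℕ} {x : ∀ n, X n} (h : R2 O k W n x) :
    ∃ a, R2 O k W (n+1) (Function.update x n a) := by
  by_contra hc
  push Not at hc
  rcases Nat.mod_two_eq_zero_or_one n with h0 | h1
  · refine h.2 (win_of_opp (by omega) fun a => ?_)
    by_contra h2
    exact hc a ⟨fun h3 => h.1 (win_of_own h0 a h3), h2⟩
  · refine h.1 (win_of_opp (by omega) fun a => ?_)
    by_contra h2
    exact hc a ⟨h2, fun h3 => h.2 (win_of_own h1 a h3)⟩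

theorem R2_opp0 {W : Set (∀ n, X n)} {n : ℕ} {x : ∀ n, X n} (h : R2 O k W n x) (hn : n % 2 ≠ 0)
    (h' : ¬ R2 O k W (n+1) x) : Win 0 (sat O k W) (n+1) x := by
  by_contra h2
  refine h' ⟨h2, fun h3 => h.2 (win_of_own (by omega) (x n) ?_)⟩
  rwa [Function.update_eq_self]

theorem R2_opp1 {W : Set (∀ n, X n)} {n : ℕ} {x : ∀ n, X n} (h : R2 O k W n x) (hn : n % 2 ≠ 1)
    (h' : ¬ R2 O k W (n+1) x) : Win 1 (O \ sat O k W) (n+1) x := by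
  by_contra h2
  refine h' ⟨fun h3 => h.1 (win_of_own (by omega) (x n) ?_), h2⟩
  rwa [Function.update_eq_self]

theorem R2_lim (hO : Opn O) {W : Set (∀ n, X n)} (hW : W ⊆ O) {n0 : ℕ} {x : ∀ n, X n}
    (h : ∀ n, n0 ≤ n → R2 O k W n x) : x ∉ O := by
  intro hx
  have h1 := h (n0 + Nn O k x) (by omega)
  by_cases hs : x ∈ sat O k W
  · exact h1.1 (win_triv fun y hy => sat_cyl hO hW hs (hy.mono (by omega)))
  · exact h1.2 (win_triv fun y hy => cosat_cyl hO hW ⟨hx, hs⟩ (hy.mono (by omega)))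

/-- the rule staying in undecided positions -/
noncomputable def corr (O : Set (∀ n, X n)) (k : ℕ) (W : Set (∀ n, X n)) (raw : ∀ n, X n) : Strat X where
  f n x := if R2 O k W (n+1) (Function.update x n (raw n)) then raw n
    else Classical.epsilon (fun a => R2 O k W (n+1) (Function.update x n a))
  loc n x y h := by
    have : ∀ a, R2 O k W (n+1) (Function.update x n a) ↔ R2 O k W (n+1) (Function.update y n a) :=
      fun a => R2_congr (h.upd a)
    simp only [this]

theorem corr_R2 {W : Set (∀ n, X n)} {raw : ∀ n, X n} {n : ℕ} {x : ∀ n, X n} (h : R2 O k W n x) :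
    R2 O k W (n+1) (Function.update x n ((corr O k W raw).f n x)) := by
  unfold corr; dsimp only
  split_ifs with h1
  · exact h1
  · exact Classical.epsilon_spec (p := fun a => R2 O k W (n+1) (Function.update x n a)) (R2_step h)

/-- decoding of a play -/
noncomputable def dec (O : Set (∀ n, X n)) (k : ℕ) (W : Set (∀ n, X n)) (o : Option (∀ n, X n)) (raw : ∀ n, X n) : ∀ n, X n :=
  match o with
  | some u => fun n => if n < Nn O k u then u n else raw n
  | none => run (fun n => k + 1 ≤ n) (corr O k W raw) raw

theorem dec_lip (W : Set (∀ n, X n)) (o : Option (∀ n, X n)) : Lip (dec O k W o) := by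
  intro n x y h
  cases o with
  | some u => intro m hm; simp only [dec]; rw [h m hm]
  | none =>
    exact run_congr (fun m hm => by unfold corr; simp only [h m hm]) (fun m hm _ => h m hm)

theorem dec_low (W : Set (∀ n, X n)) (o : Option (∀ n, X n)) (raw : ∀ n, X n)
    (ho : ∀ u ∈ o, Agr (k+1) u raw) : Agr (k+1) (dec O k W o raw) raw := by
  intro m hm
  cases o with
  | some u =>
    simp only [dec]
    split_ifs
    · exact ho u rfl m hm
    · rfl
  | none => simp only [dec]; rw [run_neg]; omega

theorem dec_none_R2 (W : Set (∀ n, X n)) (raw : ∀ n, X n) (h : R2 O k W (k+1) raw) (n : ℕ)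
    (hn : k + 1 ≤ n) : R2 O k W n (dec O k W none raw) := by
  induction n, hn using Nat.le_induction with
  | base => exact (R2_congr (dec_low W none raw (by simp))).2 h
  | succ n hn ih =>
    have := corr_R2 (raw := raw) ih
    rwa [show (corr O k W raw).f n (dec O k W none raw) = dec O k W none raw n from
      (run_pos (c := fun n => k+1 ≤ n) _ raw hn).symm, Function.update_eq_self] at this

variable (X) in
abbrev Aux : Type := Set (∀ n, X n) × Option (∀ n, X n)

variable (X k) in
/-- The covering levels -/
abbrev XX (n : ℕ) : Type := X n × (k ≤ n → Aux X)

instance (n : ℕ) : Nonempty (XX X k n) := ⟨((hX n).some, fun _ => (∅, none))⟩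

def raw (x : ∀ n, XX X k n) : ∀ n, X n := fun n => (x n).1
def emb (x : ∀ n, X n) (a : Aux X) : ∀ n, XX X k n := fun n => (x n, fun _ => a)

theorem raw_lip : Lip (raw : (∀ n, XX X k n) → _) := fun n x y h m hm => by
  unfold raw; rw [h m hm]

variable (O k)
noncomputable def Wd (x : ∀ n, XX X k n) : Set (∀ n, X n) :=
  if ((x k).2 le_rfl).1 ⊆ O ∧ ¬ Win 1 (O \ sat O k ((x k).2 le_rfl).1) (k+1) (raw x) then
    ((x k).2 le_rfl).1 else O

def Vu (x : ∀ n, XX X k n) (u : ∀ n, X n) : Prop := u ∈ Wd O k x ∧ Agr (k+1) u (raw x)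

noncomputable def acc (x : ∀ n, XX X k n) : Option (∀ n, X n) :=
  if ∃ u, ((x (k+1)).2 (by omega)).2 = some u ∧ Vu O k x u then ((x (k+1)).2 (by omega)).2
  else if R2 O k (Wd O k x) (k+1) (raw x) then none
  else some (Classical.epsilon (Vu O k x))

noncomputable def pi' (x : ∀ n, XX X k n) : ∀ n, X n := dec O k (Wd O k x) (acc O k x) (raw x)
variable {O k}

theorem Wd_congr {x y : ∀ n, XX X k n} (h : Agr (k+1) x y) : Wd O k x = Wd O k y := by
  unfold Wd; rw [h k (by omega), win_congr (raw_lip _ _ _ h)]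

theorem Vu_congr {x y : ∀ n, XX X k n} (h : Agr (k+1) x y) : Vu O k x = Vu O k y := by
  funext u; unfold Vu; rw [Wd_congr h]
  have := raw_lip _ _ _ h
  exact propext (and_congr_right fun _ => ⟨fun h1 => h1.trans this, fun h1 => h1.trans this.symm⟩)

theorem acc_congr {x y : ∀ n, XX X k n} (h : Agr (k+2) x y) : acc O k x = acc O k y := by
  have h' := h.mono (show k+1 ≤ k+2 by omega)
  unfold acc; rw [h (k+1) (by omega), Wd_congr h', R2_congr (raw_lip _ _ _ h'), Vu_congr h']

theorem Wd_sub (x : ∀ n, XX X k n) : Wd O k x ⊆ O := by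
  unfold Wd; split_ifs with h
  · exact h.1
  · exact le_rfl

theorem Wd_legal (hO : Opn O) (x : ∀ n, XX X k n) : ¬ Win 1 (O \ sat O k (Wd O k x)) (k+1) (raw x) := by
  unfold Wd; split_ifs with h
  · exact h.2
  · rw [sat_O hO, Set.diff_self]; intro h; obtain ⟨y, _, hy⟩ := win_exists h; exact hy

theorem acc_none {x : ∀ n, XX X k n} (h : acc O k x = none) : R2 O k (Wd O k x) (k+1) (raw x) := by
  unfold acc at h
  split_ifs at h with h1 h2
  · obtain ⟨u, hu, _⟩ := h1; rw [hu] at h; cases h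
  · exact h2

theorem acc_some (hO : Opn O) {x : ∀ n, XX X k n} {u : ∀ n, X n} (h : acc O k x = some u) : Vu O k x u := by
  unfold acc at h
  split_ifs at h with h1 h2
  · obtain ⟨v, hv, hv'⟩ := h1; rw [hv] at h; cases h; exact hv'
  · cases h
    refine Classical.epsilon_spec (p := Vu O k x) ?_
    have hw : Win 0 (sat O k (Wd O k x)) (k+1) (raw x) := by
      by_contra hc; exact h2 ⟨hc, Wd_legal hO x⟩
    obtain ⟨y, hy, u, hu, huy⟩ := win_exists hw
    exact ⟨u, hu, (huy.mono (by have := (Nn_spec (k := k) hO (Wd_sub x hu)).1; omega)).trans hy.symm⟩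

theorem pi_low (hO : Opn O) (x : ∀ n, XX X k n) : Agr (k+1) (pi' O k x) (raw x) :=
  dec_low _ _ _ fun _ hu => (acc_some hO hu).2

theorem pi_lip (hO : Opn O) : Lip (pi' O k) := by
  intro n x y h
  by_cases hn : n ≤ k + 1
  · exact ((pi_low hO x).mono hn).trans ((raw_lip _ _ _ h).trans ((pi_low hO y).mono hn).symm)
  · unfold pi'
    rw [acc_congr (h.mono (by omega)), Wd_congr (h.mono (by omega))]
    exact dec_lip _ _ n _ _ (raw_lip _ _ _ h)

theorem pi_mem (hO : Opn O) (x : ∀ n, XX X k n) : pi' O k x ∈ O ↔ acc O k x ≠ none := by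
  constructor
  · intro h ha
    refine R2_lim hO (Wd_sub x) (n0 := k+1) (x := pi' O k x) (k := k) (fun n hn => ?_) h
    unfold pi'; rw [ha]
    exact dec_none_R2 _ _ (acc_none ha) n hn
  · intro h
    obtain ⟨u, hu⟩ := Option.ne_none_iff_exists'.1 h
    have := acc_some hO hu
    refine (Nn_spec (k := k) hO (Wd_sub x this.1)).2 _ fun m hm => ?_
    unfold pi'; rw [hu]; simp [dec, hm]

theorem pi_FD (hO : Opn O) : FD (pi' O k ⁻¹' O) :=
  ⟨k+2, fun x y h => by
    show pi' O k x ∈ O ↔ pi' O k y ∈ O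
    rw [pi_mem hO, pi_mem hO, acc_congr h]⟩

end unravel
end BD

namespace BD

section transfer
variable {X : ℕ → Type} [hX : ∀ n, Nonempty (X n)]

/-- transfer data -/
structure TD (O : Set (∀ n, X n)) (k : ℕ) where
  Z : (∀ n, X n) → Set (∀ n, X n)
  Wm : (∀ n, X n) → Set (∀ n, X n)
  V : (∀ n, X n) → (∀ n, X n) → Aux X
  loc : ∀ x y, Agr (k+1) x y → Z x = Z y ∧ Wm x = Wm y ∧ V x = V y
  sub : ∀ x, Z x ⊆ O

variable {O : Set (∀ n, X n)} {k : ℕ}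

instance : Nonempty (Strat X) := ⟨⟨fun n _ => (hX n).some, fun _ _ _ _ => rfl⟩⟩

def TD.ex (D : TD O k) (n : ℕ) (x : ∀ n, X n) : Prop :=
  ∃ u ∈ D.Z x, Nn O k u ≤ n ∧ Agr (Nn O k u) u x
noncomputable def TD.u0 (D : TD O k) (x : ∀ n, X n) : ∀ n, X n :=
  Classical.epsilon (fun u => u ∈ D.Z x ∧ Agr (Nn O k u) u x)
noncomputable def TD.m0 (D : TD O k) (x : ∀ n, X n) : ℕ :=
  sInf {m | k+1 ≤ m ∧ ¬ R2 O k (D.Wm x) m x}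
noncomputable def TD.sw (D : TD O k) (b m : ℕ) (x : ∀ n, X n) : Strat X :=
  Classical.epsilon (fun S => ∀ y, Agr m x y → Fol b S m y → y ∈ sat O k (D.Z x))

theorem TD.ex_congr (D : TD O k) {n : ℕ} (hn : k+1 ≤ n) {x y : ∀ n, X n} (h : Agr n x y) (he : D.ex n x) :
    D.ex n y := by
  obtain ⟨u, hu, h1, h2⟩ := he
  rw [(D.loc x y (h.mono hn)).1] at hu
  exact ⟨u, hu, h1, h2.trans (h.mono h1)⟩

theorem TD.u0_congr (hO : Opn O) (D : TD O k) {n : ℕ} (hn : k+1 ≤ n) {x y : ∀ n, X n} (h : Agr n x y)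
    (he : D.ex n x) : D.u0 x = D.u0 y := by
  unfold TD.u0; congr 1; funext u
  have hz := (D.loc x y (h.mono hn)).1
  have he' := D.ex_congr hn h he
  rw [hz]
  have key : ∀ x y, Agr n x y → D.ex n x → ∀ u ∈ D.Z x, Agr (Nn O k u) u x → Agr (Nn O k u) u y := by
    intro x y h ⟨v, hv, h1, h2⟩ u hu hux
    have e1 := Nn_congr hO (D.sub x hv) h2
    have e2 := Nn_congr hO (D.sub x hu) hux
    exact hux.trans (h.mono (by omega))
  refine propext (and_congr_right fun hu => ⟨key x y h he u (hz ▸ hu), key y x h.symm he' u hu⟩)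

theorem TD.m0_congr (D : TD O k) {n : ℕ} (hn : k+1 ≤ n) {x y : ∀ n, X n} (h : Agr n x y)
    (hb : ∃ m, k+1 ≤ m ∧ m ≤ n ∧ ¬ R2 O k (D.Wm x) m x) : D.m0 x = D.m0 y ∧ D.m0 x ≤ n := by
  have hw := (D.loc x y (h.mono hn)).2.1
  have key : ∀ x y, Agr n x y → D.Wm x = D.Wm y → (∃ m, k+1 ≤ m ∧ m ≤ n ∧ ¬ R2 O k (D.Wm x) m x) →
      D.m0 y ≤ D.m0 x ∧ D.m0 x ≤ n := by
    intro x y h hw ⟨m, h1, h2, h3⟩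
    have hs : D.m0 x ∈ {m | k+1 ≤ m ∧ ¬ R2 O k (D.Wm x) m x} := Nat.sInf_mem ⟨m, h1, h3⟩
    have hle : D.m0 x ≤ m := Nat.sInf_le ⟨h1, h3⟩
    refine ⟨Nat.sInf_le ⟨hs.1, ?_⟩, by omega⟩
    have := hs.2
    rwa [hw, R2_congr (h.mono (by omega))] at this
  have hb' : ∃ m, k+1 ≤ m ∧ m ≤ n ∧ ¬ R2 O k (D.Wm y) m y := by
    obtain ⟨m, h1, h2, h3⟩ := hb
    exact ⟨m, h1, h2, by rwa [hw, R2_congr (h.mono h2)] at h3⟩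
  have a := key x y h hw hb
  have b := key y x h.symm hw.symm hb'
  exact ⟨le_antisymm b.1 a.1, a.2⟩

theorem TD.sw_congr (D : TD O k) (b m : ℕ) (hm : k+1 ≤ m) {x y : ∀ n, X n} (h : Agr m x y) :
    D.sw b m x = D.sw b m y := by
  unfold TD.sw; rw [(D.loc x y (h.mono hm)).1]; congr 1; funext S
  refine propext ⟨fun h1 z hz => h1 z (h.trans hz), fun h1 z hz => h1 z (h.symm.trans hz)⟩

theorem run_emb_agr (b : ℕ) (S : Strat (XX X k)) {n : ℕ} (hn : n % 2 = b) {x y : ∀ n, X n} (h : Agr n x y)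
    (a : Aux X) : Agr (n+1) (run (fun m => m % 2 = b) S (emb x a)) (run (fun m => m % 2 = b) S (emb y a)) :=
  run_congr (fun _ _ => rfl) fun m hm hb => by
    unfold emb; rw [h m]
    have : m ≠ n := by rintro rfl; exact hb hn
    omega

theorem Agr.all {x y : ∀ n, X n} {P : ℕ → (∀ n, X n) → Prop} (n : ℕ) (h : Agr n x y) 
    (hP : ∀ m x y, Agr m x y → P m x → P m y) (k : ℕ) :
    (∀ m, k ≤ m → m ≤ n → P m x) ↔ (∀ m, k ≤ m → m ≤ n → P m y) :=
  ⟨fun h1 m a b => hP m _ _ (h.mono b) (h1 m a b), fun h1 m a b => hP m _ _ (h.symm.mono b) (h1 m a b)⟩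

noncomputable def trf (D : TD O k) (b : ℕ) (S : Strat (XX X k)) (n : ℕ) (x : ∀ n, X n) : X n :=
  if n < k + 1 then (S.f n (emb x (∅, none))).1
  else if n % 2 = b then
    if D.ex n x then pi' O k (run (fun m => m % 2 = b) S (emb x (D.V x (D.u0 x)))) n
    else if ∀ m, k+1 ≤ m → m ≤ n → R2 O k (D.Wm x) m x then
      pi' O k (run (fun m => m % 2 = b) S (emb x (D.Wm x, none))) n
    else (D.sw b (D.m0 x) x).f n x
  else (hX n).some

theorem trf_loc (hO : Opn O) (D : TD O k) (b : ℕ) (S : Strat (XX X k)) (n : ℕ) (x y : ∀ n, X n) (h : Agr n x y) :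
    trf D b S n x = trf D b S n y := by
  unfold trf
  by_cases hn : n < k + 1
  · simp only [hn, if_true]
    rw [S.loc n (emb x (∅, none)) (emb y (∅, none)) (fun m hm => by simp [emb, h m hm])]
  simp only [hn, if_false]
  by_cases hb : n % 2 = b
  swap
  · simp [hb]
  simp only [hb, if_true]
  have hkn : k+1 ≤ n := by omega
  obtain ⟨hZ, hW, hV⟩ := D.loc x y (h.mono hkn)
  by_cases he : D.ex n x
  · rw [if_pos he, if_pos (D.ex_congr hkn h he), ← D.u0_congr hO hkn h he, hV]
    exact pi_lip hO (n+1) _ _ (run_emb_agr b S hb h _) n (by omega)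
  have he' : ¬ D.ex n y := fun h' => he (D.ex_congr hkn h.symm h')
  rw [if_neg he, if_neg he']
  have hg : (∀ m, k+1 ≤ m → m ≤ n → R2 O k (D.Wm x) m x) ↔ (∀ m, k+1 ≤ m → m ≤ n → R2 O k (D.Wm y) m y) := by
    rw [hW]; exact Agr.all n h (fun m x y h => (R2_congr h).1) (k+1)
  by_cases h1 : ∀ m, k+1 ≤ m → m ≤ n → R2 O k (D.Wm x) m x
  · rw [if_pos h1, if_pos (hg.1 h1), hW]
    exact pi_lip hO (n+1) _ _ (run_emb_agr b S hb h _) n (by omega)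
  · rw [if_neg h1, if_neg (fun h2 => h1 (hg.2 h2))]
    push Not at h1
    have := D.m0_congr hkn h h1
    have hm : k+1 ≤ D.m0 x := by
      obtain ⟨m, h1, h2, h3⟩ := h1
      exact (Nat.sInf_mem (s := {m | k+1 ≤ m ∧ ¬ R2 O k (D.Wm x) m x}) ⟨m, h1, h3⟩).1
    rw [← this.1, D.sw_congr b _ hm (h.mono this.2)]
    exact (D.sw b _ y).loc n x y h

noncomputable def tr (hO : Opn O) (D : TD O k) (b : ℕ) (S : Strat (XX X k)) : Strat X :=
  ⟨trf D b S, trf_loc hO D b S⟩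

/-- low part -/
theorem low_run (hO : Opn O) (D : TD O k) (b : ℕ) (S : Strat (XX X k)) (x : ∀ n, X n)
    (hx : Fol b (tr hO D b S) 0 x) (a : Aux X) :
    Agr (k+1) (raw (run (fun m => m % 2 = b) S (emb x a))) x := by
  have h1 : Agr k (run (fun m => m % 2 = b) S (emb x a)) (emb x (∅, none)) := by
    refine run_unique (fun m hm hb => ?_) (fun m hm _ => ?_)
    · have := hx m (by omega) hb
      simp only [tr, trf, show m < k+1 by omega, if_true] at this
      refine Prod.ext this ?_
      funext h; omega
    · refine Prod.ext rfl ?_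
      funext h; omega
  intro m hm
  by_cases hb : m % 2 = b
  · have := hx m (by omega) hb
    simp only [tr, trf, hm, if_true] at this
    rw [this]; unfold raw
    rw [run_pos (c := fun m => m % 2 = b) _ _ hb]
    rw [S.loc m _ _ (h1.mono (by omega))]
  · unfold raw; rw [run_neg (c := fun m => m % 2 = b) _ _ hb]; rfl

/-- The main lifting lemma. -/
theorem tr_lift (hO : Opn O) (D : TD O k) (b : ℕ) (hb2 : b < 2) (S : Strat (XX X k)) (x : ∀ n, X n)
    (hx : Fol b (tr hO D b S) 0 x)
    (C1 : R2 O k (D.Wm x) (k+1) x → acc O k (run (fun m => m % 2 = b) S (emb x (D.Wm x, none))) = none ∧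
      Wd O k (run (fun m => m % 2 = b) S (emb x (D.Wm x, none))) = D.Wm x)
    (C2 : ¬ R2 O k (D.Wm x) (k+1) x → Win b (sat O k (D.Z x)) (k+1) x)
    (C3 : (b = 0 → sat O k (D.Z x) = sat O k (D.Wm x)) ∧ (b = 1 → sat O k (D.Z x) = O \ sat O k (D.Wm x)))
    (C4 : ∀ u ∈ D.Z x, Agr (Nn O k u) u x → 
      acc O k (run (fun m => m % 2 = b) S (emb x (D.V x u))) = some u) :
    ∃ x', Fol b S 0 x' ∧ pi' O k x' = x := by
  have fol : ∀ a, Fol b S 0 (run (fun m => m % 2 = b) S (emb x a)) := fun a m _ hm => by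
    conv_lhs => rw [run_pos (c := fun m => m % 2 = b) _ _ hm]
  have low := low_run hO D b S x hx
  have rawopp : ∀ a m, m % 2 ≠ b → raw (run (fun m => m % 2 = b) S (emb x a)) m = x m := fun a m hm => by
    unfold raw; rw [run_neg (c := fun m => m % 2 = b) _ _ hm]; rfl
  by_cases hex : ∃ n, k + 1 ≤ n ∧ D.ex n x
  · -- phase three
    obtain ⟨n, hn, u, hu, hun, hux⟩ := hex
    have hspec : D.u0 x ∈ D.Z x ∧ Agr (Nn O k (D.u0 x)) (D.u0 x) x :=
      Classical.epsilon_spec (p := fun u => u ∈ D.Z x ∧ Agr (Nn O k u) u x) ⟨u, hu, hux⟩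
    have hacc := C4 _ hspec.1 hspec.2
    refine ⟨_, fol (D.V x (D.u0 x)), ?_⟩
    funext m
    by_cases hm : m < Nn O k (D.u0 x)
    · unfold pi'; rw [hacc]; simp only [dec, hm, if_true]; exact hspec.2 m hm
    · by_cases hmb : m % 2 = b
      · have hk := (Nn_spec (k := k) hO (D.sub x hspec.1)).1
        have := hx m (by omega) hmb
        have hexm : D.ex m x := ⟨_, hspec.1, by omega, hspec.2⟩
        simp only [tr, trf, show ¬ m < k+1 by omega, if_false, hmb, if_true, hexm] at this
        exact this.symm
      · unfold pi'; rw [hacc]; simp only [dec, hm, if_false]; exact rawopp _ m hmb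
  push Not at hex
  have phase1 : ∀ n, k + 1 ≤ n → (∀ m, k+1 ≤ m → m ≤ n → R2 O k (D.Wm x) m x) →
      n % 2 = b → x n = pi' O k (run (fun m => m % 2 = b) S (emb x (D.Wm x, none))) n := by
    intro n hn hg hb
    have := hx n (by omega) hb
    simp only [tr, trf, show ¬ n < k+1 by omega, if_false, hb, if_true, hex n hn] at this
    rwa [if_pos hg] at this
  have phase1' : ∀ n, (∀ m, k+1 ≤ m → m ≤ n → R2 O k (D.Wm x) m x) → 
      Agr n (pi' O k (run (fun m => m % 2 = b) S (emb x (D.Wm x, none)))) x := by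
    intro n hg m
    induction m using Nat.strong_induction_on with
    | _ m ih =>
    intro hm
    by_cases hmk : m < k + 1
    · rw [pi_low hO _ m hmk, low _ m hmk]
    by_cases hmb : m % 2 = b
    · exact (phase1 m (by omega) (fun j h1 h2 => hg j h1 (by omega)) hmb).symm
    · obtain ⟨ha, hW⟩ := C1 (hg (k+1) le_rfl (by omega))
      have hag : Agr m (pi' O k (run (fun m => m % 2 = b) S (emb x (D.Wm x, none)))) x :=
        fun j hj => ih j hj (by omega)
      have hpi : pi' O k (run (fun m => m % 2 = b) S (emb x (D.Wm x, none))) =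
          run (fun n => k + 1 ≤ n) (corr O k (D.Wm x) (raw (run (fun m => m % 2 = b) S (emb x (D.Wm x, none)))))
          (raw (run (fun m => m % 2 = b) S (emb x (D.Wm x, none)))) := by
        conv_lhs => unfold pi'
        rw [ha, hW]; rfl
      rw [hpi, run_pos (c := fun n => k+1 ≤ n) _ _ (by omega), ← hpi]
      unfold corr; dsimp only
      rw [rawopp _ m hmb, if_pos]
      refine (R2_congr (hag.upd (x m))).2 ?_
      rw [Function.update_eq_self]
      exact hg (m+1) (by omega) (by omega)
  by_cases hgood : ∀ m, k+1 ≤ m → R2 O k (D.Wm x) m x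
  · refine ⟨_, fol (D.Wm x, none), ?_⟩
    funext m
    exact phase1' (m+1) (fun j h1 _ => hgood j h1) m (by omega)
  exfalso
  push Not at hgood
  have hm0 : D.m0 x ∈ {m | k+1 ≤ m ∧ ¬ R2 O k (D.Wm x) m x} := Nat.sInf_mem hgood
  have hmin : ∀ m, k+1 ≤ m → m < D.m0 x → R2 O k (D.Wm x) m x := by
    intro m h1 h2; by_contra h3
    exact absurd (Nat.sInf_le (s := {m | k+1 ≤ m ∧ ¬ R2 O k (D.Wm x) m x}) ⟨h1, h3⟩) (by unfold TD.m0 at h2; omega)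
  have hwin : Win b (sat O k (D.Z x)) (D.m0 x) x := by
    obtain ⟨h1, h2⟩ := hm0
    generalize D.m0 x = M at *
    rcases Nat.lt_or_eq_of_le h1 with h3 | h3
    · obtain ⟨j, rfl⟩ : ∃ j, M = j + 1 := ⟨M - 1, by omega⟩
      have hj := hmin j (by omega) (by omega)
      by_cases hjb : j % 2 = b
      · exfalso
        have hg : ∀ m, k+1 ≤ m → m ≤ j → R2 O k (D.Wm x) m x := fun m a c => hmin m a (by omega)
        have hag := phase1' j hg
        have hag' := hag.succ (phase1 j (by omega) hg hjb).symm
        obtain ⟨ha, hW⟩ := C1 (hg (k+1) le_rfl (by omega))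
        refine h2 ((R2_congr hag').1 ?_)
        have hr := (R2_congr (low (D.Wm x, none))).2 (hg (k+1) le_rfl (by omega))
        have := dec_none_R2 _ _ hr (j+1) (by omega)
        unfold pi'; rwa [ha, hW]
      · interval_cases b
        · rw [C3.1 rfl]; exact R2_opp0 hj hjb h2
        · rw [C3.2 rfl]; exact R2_opp1 hj hjb h2
    · subst h3; exact C2 h2
  have hsw : ∀ y, Agr (D.m0 x) x y → Fol b (D.sw b (D.m0 x) x) (D.m0 x) y → y ∈ sat O k (D.Z x) :=
    Classical.epsilon_spec (p := fun S => ∀ y, Agr (D.m0 x) x y → Fol b S (D.m0 x) y → y ∈ sat O k (D.Z x)) hwin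
  have hmem : x ∈ sat O k (D.Z x) := by
    refine hsw x (Agr.refl _ _) fun n hn hb => ?_
    have := hx n (by omega) hb
    have hk : k + 1 ≤ n := hm0.1.trans hn
    simp only [tr, trf, show ¬ n < k+1 by omega, if_false, hb, if_true, hex n hk] at this
    rwa [if_neg] at this
    intro h; exact hm0.2 (h _ hm0.1 hn)
  obtain ⟨u, hu, h⟩ := hmem
  exact hex (Nn O k u) (by have := (Nn_spec (k := k) hO (D.sub x hu)).1; omega) ⟨u, hu, le_rfl, h⟩

theorem tr_lip (hO : Opn O) (D D' : TD O k) (b : ℕ) (S T : Strat (XX X k)) (n : ℕ)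
    (h : ∀ m, m ≤ n → S.f m = T.f m) (hD : k + 1 ≤ n → D = D') : (tr hO D b S).f n = (tr hO D' b T).f n := by
  funext x
  show trf D b S n x = trf D' b T n x
  unfold trf
  by_cases hn : n < k+1
  · simp only [hn, if_true, h n le_rfl]
  · obtain rfl := hD (by omega)
    have : ∀ a, pi' O k (run (fun m => m % 2 = b) S (emb x a)) n = pi' O k (run (fun m => m % 2 = b) T (emb x a)) n :=
      fun a => pi_lip hO (n+1) _ _ (run_congr (fun m hm => h m (by omega)) (fun _ _ _ => rfl)) n (by omega)
    simp only [this, hn, if_false]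

theorem tr_fix (hO : Opn O) (D : TD O k) (b : ℕ) (S : Strat (XX X k)) (n : ℕ) (hn : n < k) (x : ∀ n, XX X k n) :
    (tr hO D b S).f n (pi' O k x) = (S.f n x).1 := by
  show trf D b S n _ = _
  unfold trf
  rw [if_pos (by omega)]
  congr 1
  refine S.loc n _ _ fun m hm => Prod.ext ?_ ?_
  · exact pi_low hO x m (by omega)
  · funext h; omega


theorem run_S_agr (b : ℕ) {S T : Strat (XX X k)} {n : ℕ} (h : ∀ m, m < n → S.f m = T.f m) (x : ∀ n, XX X k n) :
    Agr n (run (fun m => m % 2 = b) S x) (run (fun m => m % 2 = b) T x) :=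
  run_congr h fun _ _ _ => rfl

/-- transfer data for player 0 -/
noncomputable def D0 (O : Set (∀ n, X n)) (k : ℕ) (S : Strat (XX X k)) : TD O k where
  Z x := Wd O k (run (fun m => m % 2 = 0) S (emb x (∅, none)))
  Wm x := Wd O k (run (fun m => m % 2 = 0) S (emb x (∅, none)))
  V _ u := (∅, some u)
  loc x y h := by
    have : Wd O k (run (fun m => m % 2 = 0) S (emb x (∅, none))) =
        Wd O k (run (fun m => m % 2 = 0) S (emb y (∅, none))) :=
      Wd_congr (run_congr (fun _ _ => rfl) fun m hm _ => by unfold emb; rw [h m hm])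
    exact ⟨this, this, rfl⟩
  sub x := Wd_sub _

/-- transfer data for player 1 -/
noncomputable def D1 (hO : Opn O) (k : ℕ) (hk : k % 2 = 0) (S : Strat (XX X k)) : TD O k where
  Z x := {u | ∃ W, acc O k (run (fun m => m % 2 = 1) S (emb x (W, none))) = some u}
  Wm x := O \ sat O k {u | ∃ W, acc O k (run (fun m => m % 2 = 1) S (emb x (W, none))) = some u}
  V x u := (Classical.epsilon fun W => acc O k (run (fun m => m % 2 = 1) S (emb x (W, none))) = some u, none)
  loc x y h := by
    have : ∀ W, acc O k (run (fun m => m % 2 = 1) S (emb x (W, none))) =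
        acc O k (run (fun m => m % 2 = 1) S (emb y (W, none))) := fun W =>
      acc_congr (run_emb_agr (n := k+1) 1 S (by omega) h _)
    simp only [this, true_and]
  sub x u hu := by
    obtain ⟨W, hW⟩ := hu
    exact Wd_sub _ (acc_some hO hW).1

theorem D0_congr {S T : Strat (XX X k)} (h : ∀ m, m ≤ k + 1 → S.f m = T.f m) : D0 O k S = D0 O k T := by
  have : ∀ x, Wd O k (run (fun m => m % 2 = 0) S (emb x (∅, none))) =
      Wd O k (run (fun m => m % 2 = 0) T (emb x (∅, none))) := fun x =>
    Wd_congr (run_S_agr 0 (fun m hm => h m (by omega)) _)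
  simp only [D0, this]

theorem D1_congr (hO : Opn O) (hk : k % 2 = 0) {S T : Strat (XX X k)} (h : ∀ m, m ≤ k + 1 → S.f m = T.f m) :
    D1 hO k hk S = D1 hO k hk T := by
  have : ∀ x, acc O k (run (fun m => m % 2 = 1) S x) =
      acc O k (run (fun m => m % 2 = 1) T x) := fun x =>
    acc_congr (run_S_agr 1 (fun m hm => h m (by omega)) _)
  simp only [D1, this]

theorem lift0 (hO : Opn O) (hk : k % 2 = 0) (S : Strat (XX X k)) (x : ∀ n, X n)
    (hx : Fol 0 (tr hO (D0 O k S) 0 S) 0 x) : ∃ x', Fol 0 S 0 x' ∧ pi' O k x' = x := by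
  have low := low_run hO _ 0 S x hx
  have hag : ∀ a, Agr (k+1) (run (fun m => m % 2 = 0) S (emb x a)) (run (fun m => m % 2 = 0) S (emb x (∅, none))) := by
    intro a
    refine run_congr (fun _ _ => rfl) fun m hm hb => Prod.ext rfl ?_
    funext h
    have : m = k := by omega
    subst this; exact absurd hk hb
  have hW : ∀ a, Wd O k (run (fun m => m % 2 = 0) S (emb x a)) = (D0 O k S).Wm x := fun a => Wd_congr (hag a)
  have haux : ∀ a : Aux X, ((run (fun m => m % 2 = 0) S (emb x a) (k+1)).2 (by omega)) = a := fun a => by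
    rw [run_neg (c := fun m => m % 2 = 0) _ _ (by omega)]; rfl
  refine tr_lift hO _ 0 (by omega) S x hx ?_ ?_ ⟨fun _ => rfl, by simp⟩ ?_
  · intro hR
    refine ⟨?_, hW _⟩
    unfold acc
    rw [haux, hW, if_neg (by simp), if_pos ((R2_congr (low _)).2 hR)]
  · intro hR
    by_contra hc
    refine hR ⟨hc, ?_⟩
    rw [← win_congr (low (∅, none)), ← hW (∅, none)]
    exact Wd_legal hO _
  · intro u hu hux
    unfold acc
    rw [haux, if_pos]
    · rfl
    · refine ⟨u, rfl, by rw [hW]; exact hu, ?_⟩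
      have := (Nn_spec (k := k) hO ((D0 O k S).sub x hu)).1
      exact (hux.mono (by omega)).trans (low _).symm

theorem lift1 (hO : Opn O) (hk : k % 2 = 0) (S : Strat (XX X k)) (x : ∀ n, X n)
    (hx : Fol 1 (tr hO (D1 hO k hk S) 1 S) 0 x) : ∃ x', Fol 1 S 0 x' ∧ pi' O k x' = x := by
  have low := low_run hO _ 1 S x hx
  set D := D1 hO k hk S with hD
  have hsub : D.Z x ⊆ O := D.sub x
  have hWm : D.Wm x = O \ sat O k (D.Z x) := rfl
  have hco : O \ sat O k (D.Wm x) = sat O k (D.Z x) := by rw [hWm, cosat_cosat hO hsub]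
  have haux : ∀ a : Aux X, ((run (fun m => m % 2 = 1) S (emb x a) k).2 le_rfl) = a := fun a => by
    rw [run_neg (c := fun m => m % 2 = 1) _ _ (by omega)]; rfl
  have hW : ¬ Win 1 (sat O k (D.Z x)) (k+1) x → Wd O k (run (fun m => m % 2 = 1) S (emb x (D.Wm x, none))) = D.Wm x := by
    intro h
    unfold Wd
    rw [haux, if_pos]
    refine ⟨?_, ?_⟩
    · rw [hWm]; exact Set.sdiff_subset
    · show ¬ Win 1 (O \ sat O k (D.Wm x)) _ _
      rw [hco, win_congr (low _)]; exact h
  have hacc : ¬ Win 1 (sat O k (D.Z x)) (k+1) x → acc O k (run (fun m => m % 2 = 1) S (emb x (D.Wm x, none))) = none := by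
    intro h
    rcases ho : acc O k (run (fun m => m % 2 = 1) S (emb x (D.Wm x, none))) with _ | u
    · rfl
    · exfalso
      have h1 := (acc_some hO ho).1
      rw [hW h, hWm] at h1
      exact h1.2 (sub_sat ⟨_, ho⟩)
  refine tr_lift hO _ 1 (by omega) S x hx ?_ ?_ ⟨by simp, fun _ => hco.symm⟩ ?_
  · intro hR
    have h := hR.2
    rw [hco] at h
    exact ⟨hacc h, hW h⟩
  · intro hR
    by_contra hc
    have := acc_none (hacc hc)
    rw [hW hc, R2_congr (low _)] at this
    exact hR this
  · rintro u ⟨W, hu⟩ -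
    exact Classical.epsilon_spec (p := fun W => acc O k (run (fun m => m % 2 = 1) S (emb x (W, none))) = some u) ⟨W, hu⟩

/-- The covering unraveling an open set, `k` even. -/
noncomputable def openCov (hO : Opn O) (hk : k % 2 = 0) : Cov X (XX X k) k where
  π := pi' O k
  lip := pi_lip hO
  φ b S := if b = 1 then tr hO (D1 hO k hk S) 1 S else tr hO (D0 O k S) 0 S
  φ_lip b S T n h := by
    split_ifs
    · exact tr_lip hO _ _ 1 S T n h fun hn => D1_congr hO hk fun m hm => h m (by omega)
    · exact tr_lip hO _ _ 0 S T n h fun hn => D0_congr fun m hm => h m (by omega)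
  lift b hb S x hx := by
    interval_cases b
    · exact lift0 hO hk S x hx
    · exact lift1 hO hk S x hx
  e n hn := ⟨fun x => x.1, fun x => (x, fun h => by omega), fun x => Prod.ext rfl (by funext h; omega), fun x => rfl⟩
  π_fix n hn x := pi_low hO x n (by omega)
  φ_fix b hb S n hn x := by
    split_ifs
    · exact tr_fix hO _ 1 S n hn x
    · exact tr_fix hO _ 0 S n hn x

theorem open_unravel (hO : Opn O) (k : ℕ) : ∃ (X' : ℕ → Type) (_ : ∀ n, Nonempty (X' n)) (c : Cov X X' k),
    FD (c.π ⁻¹' O) := by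
  by_cases hk : k % 2 = 0
  · exact ⟨_, inferInstance, openCov hO hk, pi_FD hO⟩
  · exact ⟨_, inferInstance, (openCov (k := k+1) hO (by omega)).weaken (by omega), pi_FD hO⟩

end transfer

/-- σ-algebra of Borel sets -/
@[reducible] def bsa (X : ℕ → Type) : MeasurableSpace (∀ n, X n) := MeasurableSpace.generateFrom {A | FD A}

def Unr {X : ℕ → Type} (A : Set (∀ n, X n)) : Prop :=
  ∀ (X' : ℕ → Type) (_ : ∀ n, Nonempty (X' n)) (p : (∀ n, X' n) → (∀ n, X n)), Lip p → ∀ k,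
    ∃ (X'' : ℕ → Type) (_ : ∀ n, Nonempty (X'' n)) (c : Cov X' X'' k), FD (c.π ⁻¹' (p ⁻¹' A))

theorem FD.compl {X : ℕ → Type} {A : Set (∀ n, X n)} (h : FD A) : FD Aᶜ := by
  obtain ⟨n, hn⟩ := h
  exact ⟨n, fun x y h => not_congr (hn x y h)⟩

theorem Unr.iUnion {X : ℕ → Type} {A : ℕ → Set (∀ n, X n)} (h : ∀ i, Unr (A i)) : Unr (⋃ i, A i) := by
  intro X0 hX0 p hp k
  -- chain of stages
  let St : Type 1 := Σ' (Y : ℕ → Type) (_ : ∀ n, Nonempty (Y n)), {q : (∀ n, Y n) → (∀ n, X n) // Lip q}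
  have step : ∀ (i : ℕ) (s : St), ∃ (t : St) (c : Cov s.1 t.1 (k+i+1)), 
      t.2.2.1 = s.2.2.1 ∘ c.π ∧ FD (t.2.2.1 ⁻¹' A i) := by
    rintro i ⟨Y, hY, q, hq⟩
    obtain ⟨Y', hY', c, hc⟩ := h i Y hY q hq (k+i+1)
    exact ⟨⟨Y', hY', q ∘ c.π, fun n x y h => hq n _ _ (c.lip n x y h)⟩, c, rfl, hc⟩
  choose nx c hc1 hc2 using step
  let s : ℕ → St := fun i => Nat.rec ⟨X0, hX0, p, hp⟩ (fun i s => nx i s) i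
  have hs : ∀ i, s (i+1) = nx i (s i) := fun i => rfl
  have : ∀ i n, Nonempty ((s i).1 n) := fun i n => (s i).2.1 n
  obtain ⟨d, q, hq, hq0, hqc⟩ := limit_cov (X := fun i => (s i).1) (k := k) (fun i => c i (s i))
  have hcomp : ∀ i x, (s i).2.2.1 (q i x) = p (d.π x) := by
    intro i x
    induction i with
    | zero => rw [hq0]; rfl
    | succ i ih =>
      rw [← ih, ← hqc i x]
      exact congrFun (hc1 i (s i)) (q (i+1) x)
  have hfd : ∀ i, FD (d.π ⁻¹' (p ⁻¹' A i)) := by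
    intro i
    have := (hc2 i (s i)).preimage (hq (i+1))
    convert this using 1
    ext x
    exact Iff.of_eq (congrArg (· ∈ A i) (hcomp (i+1) x).symm)
  have hO : Opn (d.π ⁻¹' (p ⁻¹' ⋃ i, A i)) := by
    intro x hx
    obtain ⟨i, hi⟩ := Set.mem_iUnion.1 hx
    obtain ⟨n, hn⟩ := hfd i
    exact ⟨n, fun y hy => Set.mem_iUnion.2 ⟨i, (hn x y hy).1 hi⟩⟩
  have : ∀ n, Nonempty ((fun n => (s n).1 n) n) := fun n => (s n).2.1 n
  obtain ⟨X'', h'', c'', hf⟩ := open_unravel hO k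
  exact ⟨X'', h'', d.comp c'', hf⟩

theorem unr_of_meas {X : ℕ → Type} {A : Set (∀ n, X n)} (h : MeasurableSet[bsa X] A) : Unr A := by
  refine MeasurableSpace.generateFrom_induction _ (fun t _ => Unr t) ?_ ?_ ?_ ?_ A h
  · intro t ht _ X' hX' p hp k
    exact ⟨X', hX', Cov.id X' k, FD.preimage hp ht⟩
  · intro X' hX' p hp k
    exact ⟨X', hX', Cov.id X' k, 0, fun _ _ _ => Iff.rfl⟩
  · intro t _ ih X' hX' p hp k
    obtain ⟨Y, hY, c, hc⟩ := ih X' hX' p hp k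
    exact ⟨Y, hY, c, hc.compl⟩
  · exact fun f _ ih => Unr.iUnion ih

/-- **Borel determinacy.** -/
theorem borel_determinacy {X : ℕ → Type} [hX : ∀ n, Nonempty (X n)] {A : Set (∀ n, X n)}
    (h : MeasurableSet[bsa X] A) : Det A := by
  obtain ⟨X', hX', c, hc⟩ := unr_of_meas h X hX (fun x => x) (fun _ _ _ h => h) 0
  exact c.det (det_of_FD hc)

end BD

namespace Scarf
variable {T I : Type} [Fintype T] [Fintype I] (r : I → T → ℕ)

def dom (s : Finset T) (C : Finset I) : Prop := ∀ y, ∃ i ∈ C, ∀ x ∈ s, r i y ≤ r i x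

def room (ρ : Finset T × Finset I) : Prop := dom r ρ.1 ρ.2 ∧ ρ.1.card = ρ.2.card

def adj (d ρ : Finset T × Finset I) : Prop :=
  (∃ x, x ∉ d.1 ∧ ρ = (insert x d.1, d.2)) ∨ (∃ i ∈ d.2, ρ = (d.1, d.2.erase i))

variable {r}

theorem dom.mono {s s' : Finset T} {C C' : Finset I} (h : dom r s C) (hs : s' ⊆ s) (hC : C ⊆ C') :
    dom r s' C' := fun y => by
  obtain ⟨i, hi, h1⟩ := h y
  exact ⟨i, hC hi, fun x hx => h1 x (hs hx)⟩

/-- a door with nonempty first component is in exactly two rooms -/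
theorem two_rooms (hr : ∀ i, Function.Injective (r i)) {τ : Finset T} {D : Finset I} (hd : dom r τ D)
    (hne : τ.Nonempty) (hc : D.card = τ.card + 1) :
    (Finset.univ.filter (fun ρ => room r ρ ∧ adj (τ, D) ρ)).card = 2 := by
  have hmn : ∀ i, ∃ m ∈ τ, ∀ x ∈ τ, r i m ≤ r i x := fun i => Finset.exists_min_image τ (r i) hne
  choose mn mn_mem mn_le using hmn
  have surj : ∀ y ∈ τ, ∃ i ∈ D, mn i = y := by
    intro y hy
    obtain ⟨i, hi, h1⟩ := hd y
    exact ⟨i, hi, hr i (le_antisymm (mn_le i y hy) (h1 _ (mn_mem i)))⟩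
  obtain ⟨a, ha, b, hb, hab, hmab⟩ := Finset.exists_ne_map_eq_of_card_lt_of_maps_to (s := D) (t := τ)
    (f := mn) (by omega) (fun i _ => mn_mem i)
  -- surjectivity after removing a or b
  have surj' : ∀ i, (i = a ∨ i = b) → ∀ y ∈ τ, ∃ j ∈ D.erase i, mn j = y := by
    rintro i hi y hy
    obtain ⟨j, hj, hjy⟩ := surj y hy
    by_cases hji : j = i
    · subst hji
      rcases hi with rfl | rfl
      · exact ⟨b, Finset.mem_erase.2 ⟨hab.symm, hb⟩, by rw [← hmab, hjy]⟩
      · exact ⟨a, Finset.mem_erase.2 ⟨hab, ha⟩, by rw [hmab, hjy]⟩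
    · exact ⟨j, Finset.mem_erase.2 ⟨hji, hj⟩, hjy⟩
  have memD : ∀ i, (i = a ∨ i = b) → i ∈ D := by rintro i (rfl | rfl) <;> assumption
  have inj' : ∀ i, (i = a ∨ i = b) → Set.InjOn mn (D.erase i) := by
    intro i hi
    refine Finset.injOn_of_surjOn_of_card_le mn (fun j _ => mn_mem j) (t := τ) ?_ ?_
    · intro y hy
      obtain ⟨j, hj, h⟩ := surj' i hi y hy
      exact ⟨j, hj, h⟩
    · rw [Finset.card_erase_of_mem (memD i hi)]; omega
  have col : ∀ k ∈ D, ∀ j ∈ D, k ≠ j → mn k = mn j → k = a ∨ k = b := by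
    intro k hk j hj hkj hm
    by_contra hcon
    push Not at hcon
    have hja : j = a := by
      by_contra h
      exact hkj (inj' a (Or.inl rfl) (by simp [hk, hcon.1]) (by simp [hj, h]) hm)
    have hjb : j = b := by
      by_contra h
      exact hkj (inj' b (Or.inr rfl) (by simp [hk, hcon.2]) (by simp [hj, h]) hm)
    exact hab (hja.symm.trans hjb)
  have S : ∀ i x, i ∈ D → x ∉ τ → dom r (insert x τ) D → r i x < r i (mn i) →
      ∀ j ∈ D.erase i, r j (mn j) < r j x := by
    intro i x hi hx hdx hlt j hj
    by_contra hcon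
    push Not at hcon
    obtain ⟨hji, hjD⟩ := Finset.mem_erase.1 hj
    have hsub : τ ⊆ ((D.erase i).erase j).image mn := by
      intro y hy
      obtain ⟨k, hk, h1⟩ := hdx y
      have hkx := h1 x (Finset.mem_insert_self _ _)
      refine Finset.mem_image.2 ⟨k, ?_, ?_⟩
      · refine Finset.mem_erase.2 ⟨?_, Finset.mem_erase.2 ⟨?_, hk⟩⟩
        · rintro rfl
          have := mn_le k y hy
          have : r k y = r k x := by omega
          exact hx (hr k this ▸ hy)
        · rintro rfl
          have := mn_le k y hy
          omega
      · exact hr k (le_antisymm (mn_le k y hy) (h1 _ (Finset.mem_insert_of_mem (mn_mem k))))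
    have h2 := (Finset.card_le_card hsub).trans Finset.card_image_le
    rw [Finset.card_erase_of_mem hj, Finset.card_erase_of_mem hi] at h2
    have : 0 < τ.card := hne.card_pos
    omega
  let piv : I → Finset T × Finset I → Prop := fun i ρ =>
    ρ = (τ, D.erase i) ∨ ∃ x, x ∉ τ ∧ ρ = (insert x τ, D) ∧ r i x < r i (mn i)
  have P : ∀ i, (i = a ∨ i = b) → ∃ ρ, (room r ρ ∧ adj (τ, D) ρ ∧ piv i ρ) ∧
      ∀ ρ', room r ρ' → adj (τ, D) ρ' → piv i ρ' → ρ' = ρ := by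
    intro i hi
    have hiD := memD i hi
    by_cases hM : ∃ y, ∀ j ∈ D.erase i, r j (mn j) < r j y
    · obtain ⟨x, hxM, hxmax⟩ := Finset.exists_max_image
        (Finset.univ.filter (fun y => ∀ j ∈ D.erase i, r j (mn j) < r j y)) (r i)
        (by obtain ⟨y, hy⟩ := hM; exact ⟨y, by simpa using hy⟩)
      have hxM' : ∀ j ∈ D.erase i, r j (mn j) < r j x := (Finset.mem_filter.1 hxM).2
      have hxτ : x ∉ τ := by
        intro hx
        obtain ⟨j, hj, rfl⟩ := surj' i hi x hx
        exact lt_irrefl _ (hxM' j hj)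
      have hxle : r i x < r i (mn i) := by
        obtain ⟨j, hj, h1⟩ := hd x
        have h2 := h1 _ (mn_mem j)
        by_cases hji : j = i
        · subst hji
          refine lt_of_le_of_ne h2 fun h => hxτ ?_
          rw [hr j h]; exact mn_mem j
        · have := hxM' j (Finset.mem_erase.2 ⟨hji, hj⟩); omega
      have hdx : dom r (insert x τ) D := by
        intro y
        by_cases hy : ∃ j ∈ D.erase i, r j y ≤ r j (mn j)
        · obtain ⟨j, hj, h1⟩ := hy
          refine ⟨j, (Finset.mem_erase.1 hj).2, fun z hz => ?_⟩
          rcases Finset.mem_insert.1 hz with rfl | hz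
          · have := hxM' j hj; omega
          · exact h1.trans (mn_le j z hz)
        · push Not at hy
          have := hxmax y (by simpa using hy)
          refine ⟨i, hiD, fun z hz => ?_⟩
          rcases Finset.mem_insert.1 hz with rfl | hz
          · exact this
          · have := mn_le i z hz; omega
      refine ⟨(insert x τ, D), ⟨⟨hdx, ?_⟩, Or.inl ⟨x, hxτ, rfl⟩, Or.inr ⟨x, hxτ, rfl, hxle⟩⟩, ?_⟩
      · rw [Finset.card_insert_of_notMem hxτ, hc]
      · rintro ρ' hρ _ (rfl | ⟨x', hx', rfl, hlt⟩)
        · exfalso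
          obtain ⟨j, hj, h1⟩ := hρ.1 x
          have := h1 _ (mn_mem j)
          have := hxM' j hj; omega
        · have hx'M := S i x' hiD hx' hρ.1 hlt
          have h3 := hxmax x' (by simpa using hx'M)
          obtain ⟨j, hj, h1⟩ := hρ.1 x
          have h4 := h1 x' (Finset.mem_insert_self _ _)
          have h5 := h1 _ (Finset.mem_insert_of_mem (mn_mem j))
          by_cases hji : j = i
          · subst hji
            rw [hr j (le_antisymm h3 h4)]
          · have := hxM' j (Finset.mem_erase.2 ⟨hji, hj⟩); omega
    · push Not at hM
      refine ⟨(τ, D.erase i), ⟨⟨?_, ?_⟩, Or.inr ⟨i, hiD, rfl⟩, Or.inl rfl⟩, ?_⟩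
      · intro y
        obtain ⟨j, hj, h1⟩ := hM y
        exact ⟨j, hj, fun x hx => h1.trans (mn_le j x hx)⟩
      · rw [Finset.card_erase_of_mem hiD]; simp only; omega
      · rintro ρ' hρ _ (rfl | ⟨x', hx', rfl, hlt⟩)
        · rfl
        · exfalso
          obtain ⟨j, hj, h1⟩ := hM x'
          have := S i x' hiD hx' hρ.1 hlt j hj
          omega
  obtain ⟨ρa, ⟨ra, aa, pa⟩, ua⟩ := P a (Or.inl rfl)
  obtain ⟨ρb, ⟨rb, ab, pb⟩, ub⟩ := P b (Or.inr rfl)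
  have hne' : ρa ≠ ρb := by
    rintro rfl
    rcases pa with rfl | ⟨x, hx, rfl, hlt⟩
    · rcases pb with h | ⟨x, hx, h, hlt⟩
      · have : a ∈ D.erase a := by
          rw [show D.erase a = D.erase b from (Prod.ext_iff.1 h).2]; exact Finset.mem_erase.2 ⟨hab, ha⟩
        simp at this
      · have := (Prod.ext_iff.1 h).1
        exact hx (by rw [show τ = insert x τ from this]; exact Finset.mem_insert_self _ _)
    · rcases pb with h | ⟨x', hx', h, hlt'⟩
      · have := (Prod.ext_iff.1 h).1
        exact hx (by rw [← show insert x τ = τ from this]; exact Finset.mem_insert_self _ _)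
      · have h1 : insert x τ = insert x' τ := (Prod.ext_iff.1 h).1
        have hxx : x = x' := by
          have : x ∈ insert x' τ := h1 ▸ Finset.mem_insert_self _ _
          exact (Finset.mem_insert.1 this).resolve_right hx
        subst hxx
        have := S a x ha hx ra.1 hlt b (Finset.mem_erase.2 ⟨hab.symm, hb⟩)
        omega
  have : (Finset.univ.filter (fun ρ => room r ρ ∧ adj (τ, D) ρ)) = {ρa, ρb} := by
    ext ρ
    simp only [Finset.mem_filter, Finset.mem_univ, true_and, Finset.mem_insert, Finset.mem_singleton]
    constructor
    · rintro ⟨hρ, hadj⟩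
      have hp : ∃ k, (k = a ∨ k = b) ∧ piv k ρ := by
        rcases hadj with ⟨x, hx, rfl⟩ | ⟨i, hi, rfl⟩
        · obtain ⟨k, hk, h1⟩ := hρ.1 x
          have h2 := h1 _ (Finset.mem_insert_of_mem (mn_mem k))
          have h3 : r k x < r k (mn k) := lt_of_le_of_ne h2 fun h => hx (by
            show x ∈ τ
            rw [hr k h]; exact mn_mem k)
          refine ⟨k, ?_, Or.inr ⟨x, hx, rfl, h3⟩⟩
          obtain ⟨j, hj, h4⟩ := hρ.1 (mn k)
          have hjk : k ≠ j := by
            rintro rfl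
            have := h4 x (Finset.mem_insert_self _ _); omega
          refine col k hk j hj hjk ?_
          exact hr j (le_antisymm (h4 _ (Finset.mem_insert_of_mem (mn_mem j))) (mn_le j _ (mn_mem k)))
        · refine ⟨i, ?_, Or.inl rfl⟩
          obtain ⟨j, hj, h4⟩ := hρ.1 (mn i)
          obtain ⟨hji, hjD⟩ := Finset.mem_erase.1 hj
          exact col i hi j hjD (Ne.symm hji)
            (hr j (le_antisymm (h4 _ (mn_mem j)) (mn_le j _ (mn_mem i))))
      obtain ⟨k, rfl | rfl, hp⟩ := hp
      · exact Or.inl (ua ρ hρ hadj hp)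
      · exact Or.inr (ub ρ hρ hadj hp)
    · rintro (rfl | rfl)
      · exact ⟨ra, aa⟩
      · exact ⟨rb, ab⟩
  rw [this, Finset.card_pair hne']

theorem one_room [Nonempty T] (hr : ∀ i, Function.Injective (r i)) (i : I) :
    (Finset.univ.filter (fun ρ => room r ρ ∧ adj (∅, {i}) ρ)).card = 1 := by
  obtain ⟨x, _, hx⟩ := Finset.exists_max_image (Finset.univ : Finset T) (r i) Finset.univ_nonempty
  rw [Finset.card_eq_one]
  refine ⟨({x}, {i}), ?_⟩
  ext ρ
  simp only [Finset.mem_filter, Finset.mem_univ, true_and, Finset.mem_singleton]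
  constructor
  · rintro ⟨hρ, ⟨z, _, rfl⟩ | ⟨j, hj, rfl⟩⟩
    · obtain ⟨j, hj, h1⟩ := hρ.1 x
      obtain rfl := Finset.mem_singleton.1 hj
      have := h1 z (by simp)
      have := hx z (by simp)
      have : z = x := hr j (by omega)
      subst this; simp
    · exfalso
      obtain rfl := Finset.mem_singleton.1 hj
      obtain ⟨k, hk, _⟩ := hρ.1 x
      simp at hk
  · rintro rfl
    refine ⟨⟨fun y => ⟨i, by simp, fun z hz => ?_⟩, by simp⟩, Or.inl ⟨x, by simp, by simp⟩⟩
    obtain rfl := Finset.mem_singleton.1 hz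
    exact hx y (by simp)

variable (r) in
def ndoor (c : T → I) (i0 : I) (d : Finset T × Finset I) : Prop :=
  dom r d.1 d.2 ∧ d.2.card = d.1.card + 1 ∧ i0 ∈ d.2 ∧ d.1.image c = d.2.erase i0

/-- a non-colorful room has an even number of nearly colorful doors -/
theorem even_doors (c : T → I) (i0 : I) (ρ : Finset T × Finset I) (hρ : room r ρ) (hcol : ρ.1.image c ≠ ρ.2) :
    Even (Finset.univ.filter (fun d => ndoor r c i0 d ∧ adj d ρ)).card := by
  obtain ⟨σ, C⟩ := ρ
  simp only at hcol
  have hcard : σ.card = C.card := hρ.2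
  -- description of doors
  have desc : ∀ d, (ndoor r c i0 d ∧ adj d (σ, C)) ↔
      ((∃ x ∈ σ, d = (σ.erase x, C) ∧ i0 ∈ C ∧ (σ.erase x).image c = C.erase i0) ∨
       (∃ i, i ∉ C ∧ i0 ∈ C ∧ d = (σ, insert i C) ∧ σ.image c = insert i (C.erase i0))) := by
    intro d
    constructor
    · rintro ⟨⟨h1, h2, h3, h4⟩, ⟨x, hx, h5⟩ | ⟨i, hi, h5⟩⟩
      · left
        obtain ⟨h6, h7⟩ := Prod.ext_iff.1 h5
        simp only at h6 h7
        refine ⟨x, by rw [h6]; simp, ?_, by rw [h7]; exact h3, ?_⟩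
        · rw [h6, Finset.erase_insert hx, h7]
        · rw [h6, Finset.erase_insert hx, h7, h4]
      · right
        obtain ⟨h6, h7⟩ := Prod.ext_iff.1 h5
        simp only at h6 h7
        have hi0 : i ≠ i0 := by
          rintro rfl
          exact hcol (by rw [h6, h4, h7])
        refine ⟨i, by rw [h7]; simp, by rw [h7]; exact Finset.mem_erase.2 ⟨hi0.symm, h3⟩, ?_, ?_⟩
        · rw [h6, h7, Finset.insert_erase hi]
        · rw [h6, h4, h7]
          ext z; simp only [Finset.mem_erase, Finset.mem_insert]
          constructor
          · rintro ⟨h8, h9⟩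
            by_cases hz : z = i
            · exact Or.inl hz
            · exact Or.inr ⟨h8, hz, h9⟩
          · rintro (rfl | ⟨h8, _, h9⟩)
            · exact ⟨hi0, hi⟩
            · exact ⟨h8, h9⟩
    · rintro (⟨x, hx, rfl, h0, h1⟩ | ⟨i, hi, h0, rfl, h1⟩)
      · refine ⟨⟨hρ.1.mono (Finset.erase_subset _ _) le_rfl, ?_, h0, h1⟩, Or.inl ⟨x, by simp, by simp [Finset.insert_erase hx]⟩⟩
        simp only
        rw [Finset.card_erase_of_mem hx]
        have : 0 < σ.card := Finset.card_pos.2 ⟨x, hx⟩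
        omega
      · refine ⟨⟨hρ.1.mono le_rfl (Finset.subset_insert _ _), ?_, Finset.mem_insert_of_mem h0, ?_⟩,
          Or.inr ⟨i, by simp, by simp [Finset.erase_insert hi]⟩⟩
        · simp only
          rw [Finset.card_insert_of_notMem hi]; omega
        · simp only
          rw [h1, Finset.erase_insert_of_ne]
          rintro rfl; exact hi h0
  simp only [desc]
  by_cases hadd : ∃ i, i ∉ C ∧ i0 ∈ C ∧ σ.image c = insert i (C.erase i0)
  · obtain ⟨i, hi, h0, him⟩ := hadd
    have hiC : i ∉ C.erase i0 := fun h => hi (Finset.mem_of_mem_erase h)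
    have hinj : Set.InjOn c σ := by
      rw [← Finset.card_image_iff, him, Finset.card_insert_of_notMem hiC, Finset.card_erase_of_mem h0]
      have : 0 < C.card := Finset.card_pos.2 ⟨i0, h0⟩
      omega
    obtain ⟨x, hx, hxi⟩ := Finset.mem_image.1 (show i ∈ σ.image c by rw [him]; simp)
    have hims : ∀ z ∈ σ, (σ.erase z).image c = (σ.image c).erase (c z) := by
      intro z hz
      ext w
      simp only [Finset.mem_image, Finset.mem_erase]
      constructor
      · rintro ⟨v, ⟨hv, hvσ⟩, rfl⟩
        exact ⟨fun h => hv (hinj hvσ hz h), v, hvσ, rfl⟩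
      · rintro ⟨h1, v, hv, rfl⟩
        exact ⟨v, ⟨fun h => h1 (by rw [h]), hv⟩, rfl⟩
    have : (Finset.univ.filter (fun d : Finset T × Finset I => ((∃ x ∈ σ, d = (σ.erase x, C) ∧ i0 ∈ C ∧ (σ.erase x).image c = C.erase i0) ∨
       (∃ i, i ∉ C ∧ i0 ∈ C ∧ d = (σ, insert i C) ∧ σ.image c = insert i (C.erase i0))))) =
       {(σ.erase x, C), (σ, insert i C)} := by
      ext d
      simp only [Finset.mem_filter, Finset.mem_univ, true_and, Finset.mem_insert, Finset.mem_singleton]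
      constructor
      · rintro (⟨z, hz, rfl, _, h1⟩ | ⟨j, hj, _, rfl, h1⟩)
        · left
          have : c z = i := by
            by_contra hne
            have : i ∈ (σ.erase z).image c := by
              rw [hims z hz, him]; simp [Ne.symm hne]
            rw [h1] at this; exact hiC this
          rw [hinj hz hx (this.trans hxi.symm)]
        · right
          have : i ∈ insert j (C.erase i0) := by rw [← h1, him]; simp
          rw [(Finset.mem_insert.1 this).resolve_right hiC]
      · rintro (rfl | rfl)
        · left
          refine ⟨x, hx, rfl, h0, ?_⟩
          rw [hims x hx, him, hxi, Finset.erase_insert hiC]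
        · right; exact ⟨i, hi, h0, rfl, him⟩
    rw [this, Finset.card_pair]
    · exact even_two
    · intro h
      have := (Prod.ext_iff.1 h).2
      exact hi (by rw [show C = insert i C from this]; simp)
  · by_cases hrem : ∃ x ∈ σ, i0 ∈ C ∧ (σ.erase x).image c = C.erase i0
    · obtain ⟨x, hx, h0, him⟩ := hrem
      have himσ : σ.image c = insert (c x) (C.erase i0) := by
        rw [← him, ← Finset.image_insert, Finset.insert_erase hx]
      have hcx : c x ∈ C.erase i0 := by
        rw [Finset.mem_erase]
        constructor
        · intro h; rw [h, Finset.insert_erase h0] at himσ; exact hcol himσ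
        · by_contra h; exact hadd ⟨c x, h, h0, himσ⟩
      rw [← him] at hcx
      obtain ⟨x', hx', hcc⟩ := Finset.mem_image.1 hcx
      obtain ⟨hxx, hx'σ⟩ := Finset.mem_erase.1 hx'
      have hinj : Set.InjOn c (σ.erase x) := by
        rw [← Finset.card_image_iff, him, Finset.card_erase_of_mem h0, Finset.card_erase_of_mem hx, hcard]
      have : (Finset.univ.filter (fun d : Finset T × Finset I => ((∃ x ∈ σ, d = (σ.erase x, C) ∧ i0 ∈ C ∧ (σ.erase x).image c = C.erase i0) ∨
         (∃ i, i ∉ C ∧ i0 ∈ C ∧ d = (σ, insert i C) ∧ σ.image c = insert i (C.erase i0))))) =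
         {(σ.erase x, C), (σ.erase x', C)} := by
        ext d
        simp only [Finset.mem_filter, Finset.mem_univ, true_and, Finset.mem_insert, Finset.mem_singleton]
        constructor
        · rintro (⟨z, hz, rfl, _, h1⟩ | ⟨j, hj, _, rfl, h1⟩)
          · by_cases hzx : z = x
            · left; rw [hzx]
            by_cases hzx' : z = x'
            · right; rw [hzx']
            exfalso
            have hzx1 : z ∈ σ.erase x := Finset.mem_erase.2 ⟨hzx, hz⟩
            have : c z ∈ (σ.erase z).image c := by
              rw [h1, ← him]; exact Finset.mem_image_of_mem c hzx1
            obtain ⟨w, hw, hwz⟩ := Finset.mem_image.1 this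
            obtain ⟨hw1, hw2⟩ := Finset.mem_erase.1 hw
            by_cases hwx : w = x
            · subst hwx
              exact hzx' (hinj hzx1 hx' (by rw [hcc, hwz]))
            · exact hw1 (hinj (Finset.mem_erase.2 ⟨hwx, hw2⟩) hzx1 hwz)
          · exact absurd ⟨j, hj, h0, h1⟩ hadd
        · rintro (rfl | rfl)
          · exact Or.inl ⟨x, hx, rfl, h0, him⟩
          · refine Or.inl ⟨x', hx'σ, rfl, h0, ?_⟩
            rw [← him]
            ext w
            simp only [Finset.mem_image, Finset.mem_erase]
            constructor
            · rintro ⟨v, ⟨h1, h2⟩, rfl⟩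
              by_cases hv : v = x
              · exact ⟨x', ⟨hxx, hx'σ⟩, by rw [hcc, hv]⟩
              · exact ⟨v, ⟨hv, h2⟩, rfl⟩
            · rintro ⟨v, ⟨h1, h2⟩, rfl⟩
              by_cases hv : v = x'
              · exact ⟨x, ⟨Ne.symm hxx, hx⟩, by rw [← hcc, hv]⟩
              · exact ⟨v, ⟨hv, h2⟩, rfl⟩
      rw [this, Finset.card_pair]
      · exact even_two
      · intro h
        have h1 : σ.erase x = σ.erase x' := (Prod.ext_iff.1 h).1
        have : x' ∈ σ.erase x' := h1 ▸ hx'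
        simp at this
    · rw [Finset.filter_eq_empty_iff.2]
      · simp
      · rintro d - (⟨x, hx, _, h0, h1⟩ | ⟨i, hi, h0, _, h1⟩)
        · exact hrem ⟨x, hx, h0, h1⟩
        · exact hadd ⟨i, hi, h0, h1⟩

/-- Scarf's lemma -/
theorem scarf [Nonempty T] [Nonempty I] (hr : ∀ i, Function.Injective (r i)) (c : T → I) :
    ∃ (σ : Finset T) (C : Finset I), dom r σ C ∧ σ.image c = C := by
  by_contra hcon
  push Not at hcon
  obtain ⟨i0⟩ := ‹Nonempty I›
  have h1 := Finset.sum_card_bipartiteAbove_eq_sum_card_bipartiteBelow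
    (s := Finset.univ.filter (ndoor r c i0)) (t := Finset.univ.filter (room r)) (r := adj)
  have hR : Even (∑ ρ ∈ Finset.univ.filter (room r), (Finset.bipartiteBelow adj (Finset.univ.filter (ndoor r c i0)) ρ).card) := by
    refine Finset.even_sum _ fun ρ hρ => ?_
    have hρ' := (Finset.mem_filter.1 hρ).2
    have := even_doors c i0 ρ hρ' (hcon ρ.1 ρ.2 hρ'.1)
    rwa [Finset.bipartiteBelow, Finset.filter_filter]
  rw [← h1] at hR
  have hmem : (∅, {i0}) ∈ Finset.univ.filter (ndoor r c i0) := by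
    simp [ndoor, dom]
  rw [← Finset.add_sum_erase _ _ hmem] at hR
  have h2 : Even (∑ d ∈ (Finset.univ.filter (ndoor r c i0)).erase (∅, {i0}),
      (Finset.bipartiteAbove adj (Finset.univ.filter (room r)) d).card) := by
    refine Finset.even_sum _ fun d hd => ?_
    obtain ⟨hne, hd'⟩ := Finset.mem_erase.1 hd
    obtain ⟨g1, g2, g3, g4⟩ := (Finset.mem_filter.1 hd').2
    rw [Finset.bipartiteAbove, Finset.filter_filter]
    obtain ⟨τ, D⟩ := d
    rw [two_rooms hr g1 ?_ g2]
    · exact even_two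
    · rw [Finset.nonempty_iff_ne_empty]
      rintro h
      simp only at h g2 g3
      subst h
      refine hne (Prod.ext rfl ?_)
      obtain ⟨j, hj⟩ := Finset.card_eq_one.1 g2
      simp only [hj, Finset.mem_singleton] at g3 ⊢
      rw [g3]
  have h3 : (Finset.bipartiteAbove adj (Finset.univ.filter (room r)) (∅, {i0})).card = 1 := by
    rw [Finset.bipartiteAbove, Finset.filter_filter]; exact one_room hr i0
  rw [h3, Nat.even_add] at hR
  exact absurd (hR.2 h2) (by decide)

end Scarf

namespace Scarf

theorem brouwer_approx {J : Type} [Fintype J] [Nonempty J] (f : (J → ℝ) → (J → ℝ))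
    (hm : ∀ x ∈ stdSimplex ℝ J, f x ∈ stdSimplex ℝ J) (N : ℕ) (hN : 0 < N) :
    ∃ C : Finset J, C.Nonempty ∧ ∃ w : J → (J → ℝ),
      (∀ i ∈ C, w i ∈ stdSimplex ℝ J ∧ w i i ≤ f (w i) i) ∧
      (∀ i ∈ C, ∀ k ∈ C, ∀ j ∈ C, w i j ≤ w k j + Fintype.card J / N) ∧
      (∀ i ∈ C, ∀ j ∉ C, w i j ≤ Fintype.card J / N) := by
  let T := {p : J → Fin (N + 1) // ∑ i, (p i : ℕ) = N}
  have mk : ∀ y : J → ℕ, ∑ i, y i = N → ∃ t : T, ∀ i, ((t.1 i : Fin (N+1)) : ℕ) = y i := by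
    intro y hy
    have : ∀ i, y i < N + 1 := fun i => Nat.lt_succ_of_le
      (hy ▸ Finset.single_le_sum (f := y) (fun _ _ => Nat.zero_le _) (Finset.mem_univ i))
    exact ⟨⟨fun i => ⟨y i, this i⟩, by simpa using hy⟩, fun i => rfl⟩
  have i1 : J := Classical.arbitrary J
  have : Nonempty T := by
    obtain ⟨t, _⟩ := mk (fun i => if i = i1 then N else 0) (by simp)
    exact ⟨t⟩
  let M := Fintype.card T
  let enc := Fintype.equivFin T
  let r : J → T → ℕ := fun i p => (p.1 i : ℕ) * M + (enc p : ℕ)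
  have hmod : ∀ i p, r i p % M = enc p := fun i p => by
    simp only [r]; rw [Nat.mul_add_mod_self_right]; exact Nat.mod_eq_of_lt (enc p).2
  have hr : ∀ i, Function.Injective (r i) := by
    intro i p q h
    have h1 := hmod i p
    rw [h, hmod] at h1
    exact (enc.injective (Fin.ext h1)).symm
  have hmono : ∀ i p q, r i p ≤ r i q → (p.1 i : ℕ) ≤ q.1 i := by
    intro i p q h
    by_contra hc
    push Not at hc
    have h1 : ((q.1 i : ℕ) + 1) * M ≤ (p.1 i : ℕ) * M := Nat.mul_le_mul_right _ hc
    have h2 : (enc q : ℕ) < M := (enc q).2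
    have h3 : ((q.1 i : ℕ) + 1) * M = (q.1 i : ℕ) * M + M := by ring
    simp only [r] at h
    omega
  let pt : T → (J → ℝ) := fun p i => (p.1 i : ℕ) / N
  have hN' : (0 : ℝ) < N := by exact_mod_cast hN
  have hpt : ∀ p, pt p ∈ stdSimplex ℝ J := by
    intro p
    refine ⟨fun i => by positivity, ?_⟩
    simp only [pt]
    rw [← Finset.sum_div, div_eq_one_iff_eq hN'.ne']
    exact_mod_cast p.2
  have hcol : ∀ p : T, ∃ i, pt p i ≤ f (pt p) i := by
    intro p
    by_contra hc
    push Not at hc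
    have h1 := (hm _ (hpt p)).2
    have h2 := (hpt p).2
    have : ∑ i, f (pt p) i < ∑ i, pt p i := Finset.sum_lt_sum_of_nonempty Finset.univ_nonempty
      (fun i _ => hc i)
    linarith
  choose c hc using hcol
  obtain ⟨σ, C, hd, hσ⟩ := scarf (r := r) hr c
  have hCne : C.Nonempty := by
    obtain ⟨i, hi, _⟩ := hd (Classical.arbitrary T)
    exact ⟨i, hi⟩
  have hw : ∀ i ∈ C, ∃ x ∈ σ, c x = i := by
    intro i hi; rw [← hσ] at hi; simpa using hi
  have hσne : σ.Nonempty := by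
    obtain ⟨i, hi⟩ := hCne
    obtain ⟨x, hx, _⟩ := hw i hi
    exact ⟨x, hx⟩
  have hmin : ∀ i, ∃ x ∈ σ, ∀ y ∈ σ, (x.1 i : ℕ) ≤ y.1 i := fun i =>
    Finset.exists_min_image σ (fun x => (x.1 i : ℕ)) hσne
  choose mx hmx hmle using hmin
  let m : J → ℕ := fun i => (mx i).1 i
  have key : N < ∑ i ∈ C, (m i + 1) := by
    by_contra hcon
    push Not at hcon
    obtain ⟨i0, hi0⟩ := hCne
    let y : J → ℕ := fun i => (if i ∈ C then m i + 1 else 0) +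
      (if i = i0 then N - ∑ i ∈ C, (m i + 1) else 0)
    have hy : ∑ i, y i = N := by
      simp only [y, Finset.sum_add_distrib, Finset.sum_ite_mem, Finset.univ_inter,
        Finset.sum_ite_eq', Finset.mem_univ, if_true] at hcon ⊢
      omega
    obtain ⟨t, ht⟩ := mk y hy
    obtain ⟨i, hi, h1⟩ := hd t
    have h2 := hmono i _ _ (h1 (mx i) (hmx i))
    rw [ht] at h2
    simp only [y, hi, if_true] at h2
    have : m i = (mx i).1 i := rfl
    omega
  have hcard : C.card ≤ Fintype.card J := Finset.card_le_univ C
  rw [Finset.sum_add_distrib, Finset.sum_const, smul_eq_mul, mul_one] at key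
  have hA : ∀ x ∈ σ, ∀ j ∈ C, (x.1 j : ℕ) ≤ m j + Fintype.card J := by
    intro x hx j hj
    have h1 : ∑ i ∈ C, (x.1 i : ℕ) ≤ N := by
      calc _ ≤ ∑ i, (x.1 i : ℕ) := Finset.sum_le_sum_of_subset (Finset.subset_univ _)
        _ = N := x.2
    have h2 : ∑ i ∈ C.erase j, m i ≤ ∑ i ∈ C.erase j, (x.1 i : ℕ) :=
      Finset.sum_le_sum fun i _ => hmle i x hx
    rw [← Finset.add_sum_erase _ _ hj] at h1 key
    omega
  have hB : ∀ x ∈ σ, ∀ j ∉ C, (x.1 j : ℕ) ≤ Fintype.card J := by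
    intro x hx j hj
    have h1 : ∑ i ∈ insert j C, (x.1 i : ℕ) ≤ N := by
      calc _ ≤ ∑ i, (x.1 i : ℕ) := Finset.sum_le_sum_of_subset (Finset.subset_univ _)
        _ = N := x.2
    have h2 : ∑ i ∈ C, m i ≤ ∑ i ∈ C, (x.1 i : ℕ) :=
      Finset.sum_le_sum fun i _ => hmle i x hx
    rw [Finset.sum_insert hj] at h1
    omega
  have hex : ∀ i, ∃ x : T, i ∈ C → x ∈ σ ∧ c x = i := by
    intro i
    by_cases hi : i ∈ C
    · obtain ⟨x, h⟩ := hw i hi; exact ⟨x, fun _ => h⟩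
    · exact ⟨Classical.arbitrary T, fun h => absurd h hi⟩
  choose x hx using hex
  refine ⟨C, hCne, fun i => pt (x i), ?_, ?_, ?_⟩
  · intro i hi
    refine ⟨hpt _, ?_⟩
    have := hc (x i)
    rwa [(hx i hi).2] at this
  · intro i hi k hk j hj
    have h1 := hA _ (hx i hi).1 j hj
    have h2 := hmle j _ (hx k hk).1
    simp only [pt]
    rw [← add_div]
    apply div_le_div_of_nonneg_right _ hN'.le
    have : ((x i).1 j : ℕ) ≤ ((x k).1 j : ℕ) + Fintype.card J := h1.trans (Nat.add_le_add_right h2 _)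
    exact_mod_cast this
  · intro i hi j hj
    simp only [pt]
    apply div_le_div_of_nonneg_right _ hN'.le
    exact_mod_cast hB _ (hx i hi).1 j hj

open Filter Topology in
theorem brouwer {J : Type} [Fintype J] [Nonempty J] (f : (J → ℝ) → (J → ℝ))
    (hc : ContinuousOn f (stdSimplex ℝ J))
    (hm : ∀ x ∈ stdSimplex ℝ J, f x ∈ stdSimplex ℝ J) : ∃ x ∈ stdSimplex ℝ J, f x = x := by
  have H := fun n : ℕ => brouwer_approx f hm (n + 1) (Nat.succ_pos n)
  choose C hC w h1 h2 h3 using H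
  obtain ⟨C0, hC0⟩ := Finite.exists_infinite_fiber C
  have hfreq : ∃ᶠ n in atTop, C n = C0 :=
    Nat.frequently_atTop_iff_infinite.2 (Set.infinite_coe_iff.1 hC0)
  obtain ⟨φ, hφ, hφC⟩ := extraction_of_frequently_atTop hfreq
  obtain ⟨i0, hi0⟩ : C0.Nonempty := hφC 0 ▸ hC (φ 0)
  obtain ⟨x, hx, ψ, hψ, hlim⟩ := (isCompact_stdSimplex ℝ J).tendsto_subseq
    (x := fun n => w (φ n) i0) (fun n => (h1 (φ n) i0 (by rw [hφC]; exact hi0)).1)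
  have hlim' := tendsto_pi_nhds.1 hlim
  have hsm : Tendsto (fun n => (Fintype.card J : ℝ) / ((φ (ψ n) + 1 : ℕ) : ℝ)) atTop (𝓝 0) := by
    refine Tendsto.div_atTop tendsto_const_nhds ?_
    refine tendsto_natCast_atTop_atTop.comp ?_
    exact (tendsto_add_atTop_nat 1).comp ((hφ.comp hψ).tendsto_atTop)
  have hxC : ∀ j ∉ C0, x j = 0 := by
    intro j hj
    refine le_antisymm ?_ (hx.1 j)
    refine le_of_tendsto_of_tendsto (hlim' j) hsm (Eventually.of_forall fun n => ?_)
    exact h3 (φ (ψ n)) i0 (by rw [hφC]; exact hi0) j (by rw [hφC]; exact hj)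
  have hall : ∀ i ∈ C0, Tendsto (fun n => w (φ (ψ n)) i) atTop (𝓝 x) := by
    intro i hi
    refine tendsto_pi_nhds.2 fun j => ?_
    have hi' : ∀ n, i ∈ C (φ (ψ n)) := fun n => by rw [hφC]; exact hi
    have hi0' : ∀ n, i0 ∈ C (φ (ψ n)) := fun n => by rw [hφC]; exact hi0
    by_cases hj : j ∈ C0
    · have hj' : ∀ n, j ∈ C (φ (ψ n)) := fun n => by rw [hφC]; exact hj
      have t1 := (hlim' j).sub hsm
      have t2 := (hlim' j).add hsm
      rw [sub_zero] at t1
      rw [add_zero] at t2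
      refine tendsto_of_tendsto_of_tendsto_of_le_of_le t1 t2 (fun n => ?_) (fun n => ?_)
      · have := h2 _ i0 (hi0' n) i (hi' n) j (hj' n)
        simp only [Function.comp]
        linarith
      · exact h2 _ i (hi' n) i0 (hi0' n) j (hj' n)
    · rw [hxC j hj]
      refine tendsto_of_tendsto_of_tendsto_of_le_of_le tendsto_const_nhds hsm (fun n => ?_) (fun n => ?_)
      · exact (h1 _ i (hi' n)).1.1 j
      · exact h3 _ i (hi' n) j (by rw [hφC]; exact hj)
  have hle : ∀ i, x i ≤ f x i := by
    intro i
    by_cases hi : i ∈ C0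
    · have hi' : ∀ n, i ∈ C (φ (ψ n)) := fun n => by rw [hφC]; exact hi
      have ht : Tendsto (fun n => f (w (φ (ψ n)) i)) atTop (𝓝 (f x)) := by
        refine (hc x hx).tendsto.comp ?_
        exact tendsto_nhdsWithin_iff.2 ⟨hall i hi, Eventually.of_forall fun n => (h1 _ i (hi' n)).1⟩
      exact le_of_tendsto_of_tendsto (tendsto_pi_nhds.1 (hall i hi) i) (tendsto_pi_nhds.1 ht i)
        (Eventually.of_forall fun n => (h1 _ i (hi' n)).2)
    · rw [hxC i hi]; exact (hm x hx).1 i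
  refine ⟨x, hx, ?_⟩
  have := (Finset.sum_eq_sum_iff_of_le (s := Finset.univ) (fun i _ => hle i)).1
    (hx.2.trans (hm x hx).2.symm)
  exact funext fun i => (this i (Finset.mem_univ i)).symm

end Scarf

namespace Nash
variable {I : Type} {A : I → Type} [Fintype I] [∀ i, Fintype (A i)]

/-- expectation of g under a real product vector -/
noncomputable def ev (x : ∀ i, A i → ℝ) (g : (∀ i, A i) → ℝ) : ℝ := ∑ a, (∏ i, x i (a i)) * g a

noncomputable def del (i : I) (b : A i) : A i → ℝ := fun a => if a = b then 1 else 0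

theorem ev_update (x : ∀ i, A i → ℝ) (i : I) (y : A i → ℝ) (g : (∀ i, A i) → ℝ) :
    ev (Function.update x i y) g = ∑ a, y (a i) * (∏ j ∈ Finset.univ.erase i, x j (a j)) * g a := by
  unfold ev
  refine Finset.sum_congr rfl fun a _ => ?_
  rw [← Finset.mul_prod_erase _ _ (Finset.mem_univ i), Function.update_self]
  congr 2
  exact Finset.prod_congr rfl fun j hj => by rw [Function.update_of_ne (Finset.ne_of_mem_erase hj)]

theorem ev_lin (x : ∀ i, A i → ℝ) (i : I) (y : A i → ℝ) (g : (∀ i, A i) → ℝ) :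
    ev (Function.update x i y) g = ∑ b, y b * ev (Function.update x i (del i b)) g := by
  simp only [ev_update, Finset.mul_sum]
  rw [Finset.sum_comm]
  refine Finset.sum_congr rfl fun a _ => ?_
  rw [Finset.sum_eq_single (a i)]
  · simp [del]; ring
  · intro b _ hb
    simp [del, hb.symm]
  · simp

theorem ev_continuous (g : (∀ i, A i) → ℝ) : Continuous fun x : ∀ i, A i → ℝ => ev x g := by
  unfold ev; fun_prop

theorem nash_real [Nonempty I] [∀ i, Nonempty (A i)] (g : I → (∀ i, A i) → ℝ) :
    ∃ x : ∀ i, A i → ℝ, (∀ i, x i ∈ stdSimplex ℝ (A i)) ∧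
      ∀ i, ∀ b, ev (Function.update x i (del i b)) (g i) ≤ ev x (g i) := by
  let J := Σ i, A i
  have : Nonempty J := ⟨⟨Classical.arbitrary I, Classical.arbitrary _⟩⟩
  let n : ℝ := Fintype.card I
  have hn : 0 < n := by simp only [n]; exact_mod_cast Fintype.card_pos
  let s : (J → ℝ) → I → ℝ := fun y i => ∑ a, n * y ⟨i, a⟩
  let r : (J → ℝ) → ∀ i, A i → ℝ := fun y i a =>
    (n * y ⟨i, a⟩ + max 0 (1 - s y i) / Fintype.card (A i)) / max 1 (s y i)
  have hm : ∀ i, (0:ℝ) < Fintype.card (A i) := fun i => by exact_mod_cast Fintype.card_pos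
  have hmax : ∀ t : ℝ, 0 < max 1 t := fun t => lt_max_of_lt_left one_pos
  have hrs : ∀ y ∈ stdSimplex ℝ J, ∀ i, r y i ∈ stdSimplex ℝ (A i) := by
    intro y hy i
    refine ⟨fun a => ?_, ?_⟩
    · have := hy.1 ⟨i, a⟩
      have := hmax (s y i)
      have := hm i
      have : 0 ≤ max 0 (1 - s y i) := le_max_left _ _
      positivity
    · simp only [r]
      rw [← Finset.sum_div, div_eq_one_iff_eq (hmax _).ne', Finset.sum_add_distrib, Finset.sum_const,
        nsmul_eq_mul, Finset.card_univ, mul_div_cancel₀ _ (hm i).ne']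
      change s y i + _ = _
      rcases le_total 1 (s y i) with h | h
      · rw [max_eq_left (by linarith), max_eq_right h, add_zero]
      · rw [max_eq_right (by linarith), max_eq_left h]; ring
  have hscont : ∀ i, Continuous fun y => s y i := fun i => by simp only [s]; fun_prop
  have hrcont : Continuous r := by
    refine continuous_pi fun i => continuous_pi fun a => ?_
    simp only [r]
    refine Continuous.div ?_ ?_ (fun y => (hmax _).ne')
    · have := hscont i
      fun_prop
    · exact continuous_const.max (hscont i)
  let u : (∀ i, A i → ℝ) → ∀ i, A i → ℝ := fun x i b =>
    max 0 (ev (Function.update x i (del i b)) (g i) - ev x (g i))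
  have hu0 : ∀ x i b, 0 ≤ u x i b := fun x i b => le_max_left _ _
  have hucont : ∀ i b, Continuous fun x => u x i b := by
    intro i b
    refine continuous_const.max ?_
    refine Continuous.sub ?_ (ev_continuous _)
    exact (ev_continuous _).comp (continuous_id.update i continuous_const)
  have hden : ∀ x i, 0 < 1 + ∑ b, u x i b := fun x i => by
    have := Finset.sum_nonneg (s := Finset.univ) (fun b _ => hu0 x i b); linarith
  let Φ : (∀ i, A i → ℝ) → ∀ i, A i → ℝ := fun x i a => (x i a + u x i a) / (1 + ∑ b, u x i b)
  have hΦ : ∀ x, (∀ i, x i ∈ stdSimplex ℝ (A i)) → ∀ i, Φ x i ∈ stdSimplex ℝ (A i) := by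
    intro x hx i
    refine ⟨fun a => div_nonneg (add_nonneg ((hx i).1 a) (hu0 _ _ _)) (hden x i).le, ?_⟩
    simp only [Φ]
    rw [← Finset.sum_div, div_eq_one_iff_eq (hden x i).ne', Finset.sum_add_distrib, (hx i).2]
  have hΦc : ∀ i a, Continuous fun x => Φ x i a := by
    intro i a
    refine Continuous.div ?_ ?_ (fun x => (hden x i).ne')
    · have := hucont i a; fun_prop
    · exact continuous_const.add (continuous_finsetSum _ fun b _ => hucont i b)
  obtain ⟨y, hy, hfix⟩ := Scarf.brouwer (J := J) (fun y j => Φ (r y) j.1 j.2 / n)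
    (by
      refine Continuous.continuousOn ?_
      refine continuous_pi fun j => ?_
      exact ((hΦc j.1 j.2).comp hrcont).div_const _)
    (by
      intro y hy
      have h := hΦ _ (hrs y hy)
      refine ⟨fun j => div_nonneg ((h j.1).1 j.2) hn.le, ?_⟩
      rw [← Finset.sum_div, Fintype.sum_sigma]
      simp only [(h _).2, Finset.sum_const, nsmul_eq_mul, mul_one, Finset.card_univ]
      exact div_self hn.ne')
  have hfix' : ∀ i a, n * y ⟨i, a⟩ = Φ (r y) i a := by
    intro i a
    have := congrFun hfix ⟨i, a⟩
    rw [← this]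
    exact mul_div_cancel₀ _ hn.ne'
  have hs : ∀ i, s y i = 1 := by
    intro i
    simp only [s, hfix']
    exact (hΦ _ (hrs y hy) i).2
  have hx : ∀ i a, r y i a = Φ (r y) i a := by
    intro i a
    rw [← hfix']
    simp only [r, hs]
    simp
  refine ⟨r y, hrs y hy, fun i => ?_⟩
  set x := r y with hxdef
  have hxs : x i ∈ stdSimplex ℝ (A i) := hrs y hy i
  have h1 : ∀ a, x i a * ∑ b, u x i b = u x i a := by
    intro a
    have h := hx i a
    simp only [Φ] at h
    rw [eq_div_iff (hden x i).ne'] at h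
    linarith
  have h2 : ev x (g i) = ∑ b, x i b * ev (Function.update x i (del i b)) (g i) := by
    rw [← ev_lin, Function.update_eq_self]
  have h3 : ∃ a, 0 < x i a ∧ ev (Function.update x i (del i a)) (g i) ≤ ev x (g i) := by
    by_contra hcon
    push Not at hcon
    have h4 : ∀ a, 0 ≤ x i a * (ev (Function.update x i (del i a)) (g i) - ev x (g i)) := by
      intro a
      rcases (hxs.1 a).eq_or_lt with h | h
      · rw [← h, zero_mul]
      · exact mul_nonneg h.le (sub_nonneg.2 (hcon a h).le)
    have h5 : ∑ a, x i a * (ev (Function.update x i (del i a)) (g i) - ev x (g i)) = 0 := by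
      simp only [mul_sub, Finset.sum_sub_distrib, ← Finset.sum_mul]
      rw [← h2, hxs.2]; ring
    have h6 := (Finset.sum_eq_zero_iff_of_nonneg (fun a _ => h4 a)).1 h5
    have h7 : ∀ a, x i a = 0 := by
      intro a
      by_contra hne
      have hpos : 0 < x i a := lt_of_le_of_ne (hxs.1 a) (Ne.symm hne)
      rcases mul_eq_zero.1 (h6 a (Finset.mem_univ a)) with h | h
      · exact hne h
      · linarith [hcon a hpos]
    have := hxs.2
    simp [h7] at this
  obtain ⟨a, ha, ha'⟩ := h3
  have h4 : u x i a = 0 := max_eq_left (by linarith)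
  have h5 : ∑ b, u x i b = 0 := by
    have := h1 a
    rw [h4] at this
    exact (mul_eq_zero.1 this).resolve_left ha.ne'
  intro b
  have h6 := (Finset.sum_eq_zero_iff_of_nonneg (fun a _ => hu0 x i a)).1 h5 b (Finset.mem_univ b)
  have : ev (Function.update x i (del i b)) (g i) - ev x (g i) ≤ u x i b := le_max_right _ _
  linarith

theorem nash [Nonempty I] [∀ i, Nonempty (A i)] (g : I → (∀ i, A i) → ℝ) :
    ∃ x : ∀ i, PMF (A i), ∀ i, ∀ y : PMF (A i),
      ∑ a, (∏ j, (Function.update x i y j (a j)).toReal) * g i a ≤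
      ∑ a, (∏ j, (x j (a j)).toReal) * g i a := by
  obtain ⟨x, hx, h⟩ := nash_real g
  have hs : ∀ i, ∑ a, ENNReal.ofReal (x i a) = 1 := fun i => by
    rw [← ENNReal.ofReal_sum_of_nonneg (fun a _ => (hx i).1 a), (hx i).2, ENNReal.ofReal_one]
  refine ⟨fun i => PMF.ofFintype (fun a => ENNReal.ofReal (x i a)) (hs i), fun i y => ?_⟩
  have hy : ∑ b, (y b).toReal = 1 := by
    rw [← ENNReal.toReal_sum (fun b _ => y.apply_ne_top b), ← tsum_fintype (L := .unconditional _), y.tsum_coe]; rfl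
  have e1 : ∀ j a, ((PMF.ofFintype (fun a => ENNReal.ofReal (x j a)) (hs j)) a).toReal = x j a := by
    intro j a
    rw [PMF.ofFintype_apply, ENNReal.toReal_ofReal ((hx j).1 a)]
  have e2 : (∑ a, (∏ j, (Function.update (fun i => PMF.ofFintype (fun a => ENNReal.ofReal (x i a)) (hs i)) i y j
      (a j)).toReal) * g i a) = ev (Function.update x i fun b => (y b).toReal) (g i) := by
    unfold ev
    refine Finset.sum_congr rfl fun a _ => ?_
    congr 1
    refine Finset.prod_congr rfl fun j _ => ?_
    by_cases hj : j = i
    · subst hj; simp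
    · simp only [Function.update_of_ne hj, e1]
  rw [e2, ev_lin]
  simp only [e1]
  change _ ≤ ev x (g i)
  calc _ ≤ ∑ b, (y b).toReal * ev x (g i) :=
        Finset.sum_le_sum fun b _ => mul_le_mul_of_nonneg_left (h i b) ENNReal.toReal_nonneg
    _ = ev x (g i) := by rw [← Finset.sum_mul, hy, one_mul]

end Nash

namespace StochGame
variable {G : StochGame}

/-- one stage of play: an action profile and the next state -/
abbrev Zt (G : StochGame) := G.ActionProfile × G.S

/-- first `n` stages of a run -/
def rt (r : G.Run) (n : ℕ) : List (Zt G) := (List.range n).map r.2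

/-- the `n` stages of a run following the history `h` -/
def pre (h : G.History) (r : G.Run) (n : ℕ) : List (Zt G) :=
  (List.range n).map (fun k => r.2 (h.2.length + k))

@[simp] theorem rt_length (r : G.Run) (n : ℕ) : (rt r n).length = n := by simp [rt]
@[simp] theorem pre_length (h : G.History) (r : G.Run) (n : ℕ) : (pre h r n).length = n := by simp [pre]
@[simp] theorem pre_zero (h : G.History) (r : G.Run) : pre h r 0 = [] := rfl

theorem rt_add (h : G.History) (r : G.Run) (n : ℕ) : rt r (h.2.length + n) = rt r h.2.length ++ pre h r n := by
  simp [rt, pre, List.range_add, List.map_map, Function.comp_def]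

theorem pre_succ (h : G.History) (r : G.Run) (n : ℕ) :
    pre h r (n + 1) = pre h r n ++ [r.2 (h.2.length + n)] := by
  simp [pre, List.range_succ]

@[simp] theorem catH_nil (h : G.History) : catH h [] = h := by simp [catH]
theorem catH_catH (h : G.History) (l l' : List (Zt G)) : catH (catH h l) l' = catH h (l ++ l') := by
  simp [catH]
theorem catH_cons (h : G.History) (z : Zt G) (l' : List (Zt G)) : catH (catH h [z]) l' = catH h (z :: l') := by
  simp [catH]
theorem catH_inj {h : G.History} {l l' : List (Zt G)} (e : catH h l = catH h l') : l = l' := by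
  have := (Prod.ext_iff.1 e).2
  simpa [catH] using this

theorem pre_succ' (h : G.History) (z : Zt G) (r : G.Run) (n : ℕ) :
    pre h r (n + 1) = r.2 h.2.length :: pre (catH h [z]) r n := by
  simp only [pre, List.range_succ_eq_map, catH, Function.comp_def, List.map_cons, List.map_map,
    List.length_append, List.length_singleton, add_zero]
  congr 1
  refine List.map_congr_left fun k _ => ?_
  exact congrArg r.2 (by omega)

theorem mem_cyl {h : G.History} {r : G.Run} : r ∈ cyl h ↔ r.1 = h.1 ∧ rt r h.2.length = h.2 := by
  unfold cyl rt
  refine and_congr_right fun _ => ?_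
  constructor
  · intro H
    refine List.ext_get (by simp) fun k h1 h2 => ?_
    simpa using H k h2
  · intro H k hk
    have := congrArg (fun l => l[k]?) H
    simp [hk] at this
    simpa using this

theorem mem_cyl_catH {h : G.History} {l : List (Zt G)} {r : G.Run} :
    r ∈ cyl (catH h l) ↔ r ∈ cyl h ∧ pre h r l.length = l := by
  rw [mem_cyl, mem_cyl]
  simp only [catH, List.length_append, and_assoc]
  refine and_congr_right fun _ => ?_
  rw [rt_add]
  constructor
  · intro H
    exact List.append_inj H (by simp)
  · rintro ⟨h1, h2⟩; rw [h1, h2]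

theorem mem_cyl_pre {h : G.History} {r : G.Run} (hr : r ∈ cyl h) (n : ℕ) : r ∈ cyl (catH h (pre h r n)) :=
  mem_cyl_catH.2 ⟨hr, by simp⟩

theorem cyl_catH_subset (h : G.History) (l : List (Zt G)) : cyl (catH h l) ⊆ cyl h :=
  fun _ hr => (mem_cyl_catH.1 hr).1

theorem pre_take (h : G.History) (r : G.Run) {n m : ℕ} (hnm : n ≤ m) : (pre h r m).take n = pre h r n := by
  simp [pre, ← List.map_take, List.take_range, min_eq_left hnm]

theorem rt_take (r : G.Run) {n m : ℕ} (hnm : n ≤ m) : (rt r m).take n = rt r n := by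
  simp [rt, ← List.map_take, List.take_range, min_eq_left hnm]

/-- two cylinders are disjoint or nested -/
theorem cyl_tri (h h' : G.History) : cyl h ∩ cyl h' = ∅ ∨ (∃ l, h' = catH h l) ∨ (∃ l, h = catH h' l) := by
  by_cases he : cyl h ∩ cyl h' = ∅
  · exact Or.inl he
  right
  obtain ⟨r, hr, hr'⟩ := Set.nonempty_iff_ne_empty.2 he
  rw [mem_cyl] at hr hr'
  have key : ∀ k k' : G.History, (r.1 = k.1 ∧ rt r k.2.length = k.2) → (r.1 = k'.1 ∧ rt r k'.2.length = k'.2) →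
      k.2.length ≤ k'.2.length → ∃ l, k' = catH k l := by
    intro k k' h1 h2 hle
    refine ⟨k'.2.drop k.2.length, Prod.ext (h2.1.symm.trans h1.1) ?_⟩
    simp only [catH]
    conv_lhs => rw [← List.take_append_drop k.2.length k'.2]
    congr 1
    rw [← h2.2, rt_take _ hle, h1.2]
  rcases le_total h.2.length h'.2.length with hle | hle
  · exact Or.inl (key h h' hr hr' hle)
  · exact Or.inr (key h' h hr' hr hle)

instance : MeasurableSingletonClass G.S := ⟨fun _ => trivial⟩
instance : MeasurableSingletonClass G.ActionProfile := ⟨fun _ => trivial⟩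
instance : Countable G.ActionProfile := inferInstance
instance : Countable (Zt G) := inferInstance
instance : Countable G.History := inferInstance

theorem measurable_of_Zt {β : Type*} [MeasurableSpace β] (f : Zt G → β) : Measurable f := measurable_of_countable f

theorem measurableSet_cyl (h : G.History) : MeasurableSet (cyl h) := by
  have : cyl h = {r : G.Run | r.1 = h.1} ∩ ⋂ k : ℕ, ⋂ hk : k < h.2.length, {r | r.2 k = h.2.get ⟨k, hk⟩} := by
    ext r; simp [cyl]
  rw [this]
  refine MeasurableSet.inter ?_ (MeasurableSet.iInter fun k => MeasurableSet.iInter fun hk => ?_)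
  · exact measurable_fst (measurableSet_singleton h.1)
  · have hm : Measurable fun r : G.Run => r.2 k := (measurable_pi_apply k).comp measurable_snd
    exact hm (measurableSet_singleton (h.2.get ⟨k, hk⟩))

/-- a set of runs that is determined by a finite prefix is measurable -/
theorem measurable_pre (h : G.History) (n : ℕ) : @Measurable _ _ _ ⊤ (fun r : G.Run => pre h r n) := by
  let : MeasurableSpace (List (Zt G)) := ⊤
  refine measurable_to_countable' fun l => ?_
  by_cases hl : l.length = n
  · have : (fun r : G.Run => pre h r n) ⁻¹' {l} =
        ⋂ k : Fin n, {r | r.2 (h.2.length + k) = l.get ⟨k, by rw [hl]; exact k.2⟩} := by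
      ext r
      simp only [Set.mem_preimage, Set.mem_singleton_iff, Set.mem_iInter, Set.mem_ofPred_eq]
      constructor
      · rintro rfl k; simp [pre]
      · intro H
        refine List.ext_get (by simp [hl]) fun k h1 h2 => ?_
        have := H ⟨k, by simpa using h1⟩
        simpa [pre] using this
    rw [this]
    refine MeasurableSet.iInter fun k => ?_
    exact ((measurable_pi_apply _).comp measurable_snd) (measurableSet_singleton _)
  · have : (fun r : G.Run => pre h r n) ⁻¹' {l} = ∅ := by
      ext r
      simp only [Set.mem_preimage, Set.mem_singleton_iff, Set.mem_empty_iff_false, iff_false]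
      rintro rfl
      simp at hl
    rw [this]; exact MeasurableSet.empty

theorem measurable_pre_fun {β : Type*} [MeasurableSpace β] (h : G.History) (n : ℕ) (V : List (Zt G) → β) :
    Measurable fun r : G.Run => V (pre h r n) :=
  (measurable_from_top (f := V)).comp (measurable_pre h n)

theorem generate_cyl : (inferInstance : MeasurableSpace G.Run) =
    MeasurableSpace.generateFrom (insert ∅ (Set.range (cyl (G := G)))) := by
  apply le_antisymm
  · set m := MeasurableSpace.generateFrom (insert ∅ (Set.range (cyl (G := G)))) with hm
    have hc : ∀ h : G.History, MeasurableSet[m] (cyl h) := fun h =>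
      MeasurableSpace.measurableSet_generateFrom (Or.inr ⟨h, rfl⟩)
    have h1 : @Measurable _ _ m _ (fun r : G.Run => r.1) := by
      refine @measurable_to_countable' _ _ _ _ m _ fun s => ?_
      convert hc (s, []) using 1
      ext r; simp [cyl]
    have h2 : ∀ k, @Measurable _ _ m _ (fun r : G.Run => r.2 k) := by
      intro k
      refine @measurable_to_countable' _ _ _ _ m _ fun z => ?_
      have : (fun r : G.Run => r.2 k) ⁻¹' {z} =
          ⋃ h : {h : G.History // h.2.length = k}, cyl (catH h.1 [z]) := by
        ext r
        simp only [Set.mem_preimage, Set.mem_singleton_iff, Set.mem_iUnion]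
        constructor
        · intro hr
          refine ⟨⟨(r.1, rt r k), by simp⟩, mem_cyl_catH.2 ⟨mem_cyl.2 ⟨rfl, by simp⟩, ?_⟩⟩
          simp [pre, hr]
        · rintro ⟨⟨h, hk⟩, hr⟩
          have := (mem_cyl_catH.1 hr).2
          simpa [pre, hk] using this
      rw [this]
      exact MeasurableSet.iUnion fun h => hc _
    have h3 : @Measurable _ _ m _ (fun r : G.Run => r.2) := @measurable_pi_lambda _ _ _ m _ _ h2
    have h4 : @Measurable _ _ m Prod.instMeasurableSpace (fun r : G.Run => (r.1, r.2)) := h1.prodMk h3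
    intro s hs
    exact h4 hs
  · refine MeasurableSpace.generateFrom_le ?_
    rintro t (rfl | ⟨h, rfl⟩)
    · exact MeasurableSet.empty
    · exact measurableSet_cyl h

theorem measure_unique (h : G.History) (μ ν : Measure G.Run) [IsFiniteMeasure μ]
    (h1 : μ (cyl h)ᶜ = 0) (h2 : ν (cyl h)ᶜ = 0)
    (H : ∀ l, μ (cyl (catH h l)) = ν (cyl (catH h l))) : μ = ν := by
  have full : ∀ (ρ : Measure G.Run), ρ (cyl h)ᶜ = 0 → ∀ t, cyl h ⊆ t → ρ t = ρ (cyl h) := by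
    intro ρ hρ t ht
    refine le_antisymm ?_ (measure_mono ht)
    calc ρ t ≤ ρ (cyl h ∪ (cyl h)ᶜ) := measure_mono (by simp)
      _ ≤ ρ (cyl h) + ρ (cyl h)ᶜ := measure_union_le _ _
      _ = ρ (cyl h) := by rw [hρ, add_zero]
  have h0 := H []
  rw [catH_nil] at h0
  refine ext_of_generate_finite _ generate_cyl ?_ ?_ ?_
  · rintro s hs t ht hst
    rcases hs with rfl | ⟨a, rfl⟩
    · simp at hst
    rcases ht with rfl | ⟨b, rfl⟩
    · simp at hst
    rcases cyl_tri a b with h | ⟨l, rfl⟩ | ⟨l, rfl⟩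
    · rw [h]; exact Or.inl rfl
    · rw [Set.inter_eq_right.2 (cyl_catH_subset a l)]; exact Or.inr ⟨_, rfl⟩
    · rw [Set.inter_eq_left.2 (cyl_catH_subset b l)]; exact Or.inr ⟨_, rfl⟩
  · rintro s (rfl | ⟨a, rfl⟩)
    · simp
    rcases cyl_tri a h with h' | ⟨l, rfl⟩ | ⟨l, rfl⟩
    · have hsub : cyl a ⊆ (cyl h)ᶜ := Set.disjoint_iff_inter_eq_empty.2 h' |>.subset_compl_right
      rw [measure_mono_null hsub h1, measure_mono_null hsub h2]
    · rw [full μ h1 _ (cyl_catH_subset a l), full ν h2 _ (cyl_catH_subset a l), h0]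
    · exact H l
  · rw [full μ h1 _ (Set.subset_univ _), full ν h2 _ (Set.subset_univ _), h0]

/-- probability of the stage `z` -/
noncomputable def qz (x : ∀ i, PMF (G.A i)) (s : G.S) (z : Zt G) : ℝ≥0∞ :=
  (∏ i, x i (z.1 i)) * G.trans s z.1 z.2

theorem tsum_prod_pmf (x : ∀ i, PMF (G.A i)) : ∑ a : G.ActionProfile, ∏ i, x i (a i) = 1 := by
  have h := Finset.prod_univ_sum (fun i => (Finset.univ : Finset (G.A i))) (fun i b => x i b)
  rw [Fintype.piFinset_univ] at h
  rw [← h]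
  refine Finset.prod_eq_one fun i _ => ?_
  rw [← tsum_fintype (L := .unconditional _), (x i).tsum_coe]

theorem tsum_qz (x : ∀ i, PMF (G.A i)) (s : G.S) : ∑' z, qz x s z = 1 := by
  unfold qz
  rw [ENNReal.tsum_prod (f := fun a t => (∏ i, x i (a i)) * G.trans s a t)]
  simp only [ ENNReal.tsum_mul_left, PMF.tsum_coe, mul_one]
  rw [tsum_fintype, tsum_prod_pmf]

theorem qz_ne_top (x : ∀ i, PMF (G.A i)) (s : G.S) (z : Zt G) : qz x s z ≠ ∞ := by
  have := ENNReal.le_tsum (f := qz x s) z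
  rw [tsum_qz] at this
  exact ne_top_of_le_ne_top ENNReal.one_ne_top this

noncomputable def oe (x : ∀ i, PMF (G.A i)) (s : G.S) (φ : Zt G → ℝ) : ℝ :=
  ∑' z, (qz x s z).toReal * φ z

theorem summable_qz (x : ∀ i, PMF (G.A i)) (s : G.S) : Summable fun z => (qz x s z).toReal :=
  ENNReal.summable_toReal (by rw [tsum_qz]; exact ENNReal.one_ne_top)

theorem summable_oe (x : ∀ i, PMF (G.A i)) (s : G.S) {φ : Zt G → ℝ} {C : ℝ} (hφ : ∀ z, |φ z| ≤ C) :
    Summable fun z => (qz x s z).toReal * φ z := by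
  refine Summable.of_norm_bounded ((summable_qz x s).mul_right C) fun z => ?_
  rw [norm_mul, Real.norm_of_nonneg ENNReal.toReal_nonneg]
  exact mul_le_mul_of_nonneg_left (hφ z) ENNReal.toReal_nonneg

theorem oe_const (x : ∀ i, PMF (G.A i)) (s : G.S) (c : ℝ) : oe x s (fun _ => c) = c := by
  unfold oe
  rw [tsum_mul_right, ← ENNReal.tsum_toReal_eq (fun z => qz_ne_top x s z), tsum_qz]; simp

theorem oe_mono' (x : ∀ i, PMF (G.A i)) (s : G.S) {φ ψ : Zt G → ℝ} {C C' : ℝ} (hφ : ∀ z, |φ z| ≤ C)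
    (hψ : ∀ z, |ψ z| ≤ C') (h : ∀ z, qz x s z ≠ 0 → φ z ≤ ψ z) : oe x s φ ≤ oe x s ψ := by
  refine Summable.tsum_le_tsum (fun z => ?_) (summable_oe x s hφ) (summable_oe x s hψ)
  by_cases hz : qz x s z = 0
  · simp [hz]
  · exact mul_le_mul_of_nonneg_left (h z hz) ENNReal.toReal_nonneg

theorem oe_mono (x : ∀ i, PMF (G.A i)) (s : G.S) {φ ψ : Zt G → ℝ} {C C' : ℝ} (hφ : ∀ z, |φ z| ≤ C)
    (hψ : ∀ z, |ψ z| ≤ C') (h : ∀ z, φ z ≤ ψ z) : oe x s φ ≤ oe x s ψ :=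
  oe_mono' x s hφ hψ fun z _ => h z

theorem oe_add (x : ∀ i, PMF (G.A i)) (s : G.S) {φ ψ : Zt G → ℝ} {C C' : ℝ} (hφ : ∀ z, |φ z| ≤ C)
    (hψ : ∀ z, |ψ z| ≤ C') : oe x s (fun z => φ z + ψ z) = oe x s φ + oe x s ψ := by
  unfold oe
  rw [← (summable_oe x s hφ).tsum_add (summable_oe x s hψ)]
  simp only [mul_add]

theorem oe_smul (x : ∀ i, PMF (G.A i)) (s : G.S) (c : ℝ) (φ : Zt G → ℝ) :
    oe x s (fun z => c * φ z) = c * oe x s φ := by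
  unfold oe
  rw [← tsum_mul_left]
  exact tsum_congr fun z => by ring

theorem oe_add_const (x : ∀ i, PMF (G.A i)) (s : G.S) {φ : Zt G → ℝ} {C : ℝ} (hφ : ∀ z, |φ z| ≤ C) (c : ℝ) :
    oe x s (fun z => φ z + c) = oe x s φ + c := by
  rw [oe_add x s hφ (fun _ => le_refl |c|), oe_const]

theorem oe_le (x : ∀ i, PMF (G.A i)) (s : G.S) {φ : Zt G → ℝ} {C c : ℝ} (hφ : ∀ z, |φ z| ≤ C)
    (h : ∀ z, φ z ≤ c) : oe x s φ ≤ c := by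
  rw [← oe_const x s c]; exact oe_mono x s hφ (fun _ => le_refl |c|) h

theorem le_oe (x : ∀ i, PMF (G.A i)) (s : G.S) {φ : Zt G → ℝ} {C c : ℝ} (hφ : ∀ z, |φ z| ≤ C)
    (h : ∀ z, c ≤ φ z) : c ≤ oe x s φ := by
  rw [← oe_const x s c]; exact oe_mono x s (fun _ => le_refl |c|) hφ h

theorem abs_oe_le (x : ∀ i, PMF (G.A i)) (s : G.S) {φ : Zt G → ℝ} {C : ℝ} (hφ : ∀ z, |φ z| ≤ C) :
    |oe x s φ| ≤ C :=
  abs_le.2 ⟨le_oe x s hφ fun z => (abs_le.1 (hφ z)).1, oe_le x s hφ fun z => (abs_le.1 (hφ z)).2⟩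

/-- finite-sum form -/
theorem oe_eq (x : ∀ i, PMF (G.A i)) (s : G.S) {φ : Zt G → ℝ} {C : ℝ} (hφ : ∀ z, |φ z| ≤ C) :
    oe x s φ = ∑ a, (∏ i, (x i (a i)).toReal) * ∑' t, (G.trans s a t).toReal * φ (a, t) := by
  unfold oe
  rw [(summable_oe x s hφ).tsum_prod, tsum_fintype]
  refine Finset.sum_congr rfl fun a _ => ?_
  rw [← tsum_mul_left]
  refine tsum_congr fun t => ?_
  simp only [qz, ENNReal.toReal_mul, ENNReal.toReal_prod, mul_assoc]

variable {P : G.History → G.Profile → Measure G.Run}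

theorem contProb_cons (σ : G.Profile) (h : G.History) (z : Zt G) (l : List (Zt G)) :
    contProb σ h (z :: l) = qz (fun i => σ i h) (lastState h) z * contProb σ (catH h [z]) l := by
  obtain ⟨a, s⟩ := z
  rfl

theorem contProb_append (σ : G.Profile) (h : G.History) (l l' : List (Zt G)) :
    contProb σ h (l ++ l') = contProb σ h l * contProb σ (catH h l) l' := by
  induction l generalizing h with
  | nil => simp [contProb]
  | cons z l ih => rw [List.cons_append, contProb_cons, contProb_cons, ih, catH_cons, mul_assoc]

theorem P_cyl (hP : IsInducedFamily G P) (h : G.History) (σ : G.Profile) : P h σ (cyl h) = 1 := by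
  have := hP.2 h σ []
  rwa [catH_nil] at this

theorem P_cyl_compl (hP : IsInducedFamily G P) (h : G.History) (σ : G.Profile) : P h σ (cyl h)ᶜ = 0 := by
  have := hP.1 h σ
  rw [measure_compl (measurableSet_cyl h) (measure_ne_top _ _), P_cyl hP, measure_univ, tsub_self]

theorem ae_cyl (hP : IsInducedFamily G P) (h : G.History) (σ : G.Profile) : ∀ᵐ r ∂(P h σ), r ∈ cyl h := P_cyl_compl hP h σ

theorem P_decomp (hP : IsInducedFamily G P) (h : G.History) (σ : G.Profile) :
    P h σ = Measure.sum fun z => qz (fun i => σ i h) (lastState h) z • P (catH h [z]) σ := by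
  have := hP.1
  refine measure_unique h _ _ (P_cyl_compl hP h σ) ?_ fun l => ?_
  · rw [Measure.sum_apply _ (measurableSet_cyl h).compl]
    refine ENNReal.tsum_eq_zero.2 fun z => ?_
    rw [Measure.smul_apply, measure_mono_null (Set.compl_subset_compl.2 (cyl_catH_subset h [z]))
      (P_cyl_compl hP _ _), smul_zero]
  · rw [Measure.sum_apply _ (measurableSet_cyl _), hP.2]
    cases l with
    | nil =>
      rw [catH_nil]
      have : ∀ z, P (catH h [z]) σ (cyl h) = 1 := fun z =>
        le_antisymm prob_le_one ((P_cyl hP (catH h [z]) σ).symm.le.trans (measure_mono (cyl_catH_subset h [z])))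
      simp only [Measure.smul_apply, this, smul_eq_mul, mul_one]
      rw [tsum_qz]; rfl
    | cons z0 l =>
      rw [tsum_eq_single z0]
      · rw [Measure.smul_apply, ← catH_cons h z0 l, hP.2, contProb_cons, smul_eq_mul]
      · intro z hz
        have : cyl (catH h (z0 :: l)) ⊆ (cyl (catH h [z]))ᶜ := by
          intro r hr hr'
          rw [← catH_cons] at hr
          have h1 := (mem_cyl_catH.1 (cyl_catH_subset _ _ hr)).2
          have h2 := (mem_cyl_catH.1 hr').2
          simp only [List.length_singleton] at h1 h2
          rw [h1] at h2
          simp at h2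
          exact hz h2.symm
        rw [Measure.smul_apply, measure_mono_null this (P_cyl_compl hP _ _), smul_zero]

theorem integral_step (hP : IsInducedFamily G P) (h : G.History) (σ : G.Profile) {F : G.Run → ℝ} (hF : Measurable F) {C : ℝ}
    (hC : ∀ r, |F r| ≤ C) :
    ∫ r, F r ∂(P h σ) = oe (fun i => σ i h) (lastState h) (fun z => ∫ r, F r ∂(P (catH h [z]) σ)) := by
  have := hP.1
  have hintg : Integrable F (P h σ) := Integrable.of_bound hF.aestronglyMeasurable C (Filter.Eventually.of_forall hC)
  unfold oe
  conv_lhs => rw [P_decomp hP h σ]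
  rw [P_decomp hP h σ] at hintg
  rw [integral_sum_measure hintg]
  refine tsum_congr fun z => ?_
  rw [integral_smul_measure, smul_eq_mul]

theorem abs_integral_le (hP : IsInducedFamily G P) (h : G.History) (σ : G.Profile) {F : G.Run → ℝ} {C : ℝ} (hC : ∀ r, |F r| ≤ C) :
    |∫ r, F r ∂(P h σ)| ≤ C := by
  have := hP.1
  have := norm_integral_le_of_norm_le_const (μ := P h σ) (f := F) (Filter.Eventually.of_forall hC)
  simpa using this

theorem integrable_bdd (hP : IsInducedFamily G P) (h : G.History) (σ : G.Profile) {F : G.Run → ℝ} (hF : Measurable F) {C : ℝ}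
    (hC : ∀ r, |F r| ≤ C) : Integrable F (P h σ) := by
  have := hP.1
  exact Integrable.of_bound hF.aestronglyMeasurable C (Filter.Eventually.of_forall hC)

end StochGame

namespace StochGame
variable {G : StochGame} {P : G.History → G.Profile → Measure G.Run}

/-- no prefix of the list (including itself) satisfies `B` -/
def NP (B : List (Zt G) → Prop) (l : List (Zt G)) : Prop := ∀ l', l' <+: l → ¬ B l'

theorem NP_nil {B : List (Zt G) → Prop} : NP B [] ↔ ¬ B [] := by simp [NP]

theorem NP_cons {B : List (Zt G) → Prop} {z : Zt G} {l : List (Zt G)} :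
    NP B (z :: l) ↔ ¬ B [] ∧ NP (fun l => B (z :: l)) l := by
  unfold NP
  constructor
  · intro H
    exact ⟨H [] (List.nil_prefix), fun l' hl' => H _ (List.cons_prefix_cons.2 ⟨rfl, hl'⟩)⟩
  · rintro ⟨h1, h2⟩ l' hl'
    rcases List.prefix_cons_iff.1 hl' with rfl | ⟨t, rfl, ht⟩
    · exact h1
    · exact h2 t ht

theorem pre_isPfx (h : G.History) (r : G.Run) {n m : ℕ} (hnm : n ≤ m) : pre h r n <+: pre h r m := by
  rw [← pre_take h r hnm]; exact List.take_prefix _ _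

theorem prefix_pre {h : G.History} {r : G.Run} {n : ℕ} {l : List (Zt G)} (hl : l <+: pre h r n) :
    l = pre h r l.length := by
  have h1 := List.prefix_iff_eq_take.1 hl
  have h2 := hl.length_le
  rw [pre_length] at h2
  rwa [pre_take h r h2] at h1

theorem pre_cons_of_mem {h : G.History} {z : Zt G} {r : G.Run} (hr : r ∈ cyl (catH h [z])) (n : ℕ) :
    pre h r (n + 1) = z :: pre (catH h [z]) r n := by
  rw [pre_succ' h z]
  have := (mem_cyl_catH.1 hr).2
  simp [pre] at this
  rw [this]

theorem abs_ite_le {p : Prop} [Decidable p] {a b C C' : ℝ} (ha : |a| ≤ C) (hb : |b| ≤ C') :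
    |if p then a - b else 0| ≤ C + C' := by
  have := abs_nonneg a
  have := abs_nonneg b
  split_ifs
  · exact (abs_sub _ _).trans (by linarith)
  · rw [abs_zero]; linarith

theorem meas_ite (h : G.History) (n : ℕ) (B : List (Zt G) → Prop) (V : List (Zt G) → ℝ) {F : G.Run → ℝ}
    (hF : Measurable F) : Measurable fun r => if NP B (pre h r n) then F r - V (pre h r n) else 0 := by
  refine Measurable.ite ?_ (hF.sub (measurable_pre_fun h n V)) measurable_const
  exact measurable_pre h n (t := {l | NP B l}) trivial

theorem optStopping_fin (hP : IsInducedFamily G P) (σ : G.Profile) {F : G.Run → ℝ} (hF : Measurable F) {C C' : ℝ}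
    (hC : ∀ r, |F r| ≤ C) (n : ℕ) : ∀ (h : G.History) (V : List (Zt G) → ℝ) (B : List (Zt G) → Prop),
    (∀ l, |V l| ≤ C') →
    (∀ l, NP B l → oe (fun i => σ i (catH h l)) (lastState (catH h l)) (fun z => V (l ++ [z])) ≤ V l) →
    (∀ e, B e → (∀ l', l' <+: e → l' ≠ e → ¬ B l') → contProb σ h e ≠ 0 →
      ∫ r, F r ∂(P (catH h e) σ) ≤ V e) →
    ∫ r, F r ∂(P h σ) ≤ V [] + ∫ r, (if NP B (pre h r n) then F r - V (pre h r n) else 0) ∂(P h σ) := by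
  have := hP.1
  induction n with
  | zero =>
    intro h V B hV hs hE
    by_cases hB : B []
    · have h1 := hE [] hB (by simp) (by simp [contProb])
      rw [catH_nil] at h1
      simpa [NP_nil, hB] using h1
    · simp only [pre_zero, NP_nil, hB, not_false_eq_true, if_true]
      rw [integral_sub (integrable_bdd hP h σ hF hC) (integrable_const _)]
      simp
  | succ n ih =>
    intro h V B hV hs hE
    by_cases hB : B []
    · have h1 := hE [] hB (by simp) (by simp [contProb])
      rw [catH_nil] at h1
      have h2 : ∀ r : G.Run, ¬ NP B (pre h r (n+1)) := fun r hr => hr [] (List.nil_prefix) hB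
      simpa [h2] using h1
    · rw [integral_step hP h σ hF hC, integral_step hP h σ (meas_ite h (n+1) B V hF)
        (fun r => abs_ite_le (hC r) (hV _))]
      have e1 : ∀ z, ∫ r, (if NP B (pre h r (n+1)) then F r - V (pre h r (n+1)) else 0) ∂(P (catH h [z]) σ)
          = ∫ r, (if NP (fun l => B (z :: l)) (pre (catH h [z]) r n) then
              F r - V (z :: pre (catH h [z]) r n) else 0) ∂(P (catH h [z]) σ) := by
        intro z
        refine integral_congr_ae ?_
        filter_upwards [ae_cyl hP (catH h [z]) σ] with r hr
        simp only [pre_cons_of_mem hr, NP_cons, hB, not_false_eq_true, true_and]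
      simp only [e1]
      have h0 := hs [] (NP_nil.2 hB)
      simp only [catH_nil, List.nil_append] at h0
      have hb1 : ∀ z, |∫ r, F r ∂(P (catH h [z]) σ)| ≤ C := fun z => abs_integral_le hP _ _ hC
      have hb2 : ∀ z, |∫ r, (if NP (fun l => B (z :: l)) (pre (catH h [z]) r n) then
              F r - V (z :: pre (catH h [z]) r n) else 0) ∂(P (catH h [z]) σ)| ≤ C + C' := fun z =>
        abs_integral_le hP _ _ fun r => abs_ite_le (hC r) (hV _)
      have hb3 : ∀ z : Zt G, |V [z]| ≤ C' := fun z => hV _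
      refine le_trans ?_ (add_le_add_left h0 _)
      rw [← oe_add _ _ hb3 hb2]
      refine oe_mono' _ _ hb1 (C' := C' + (C + C')) (fun z => (abs_add_le _ _).trans (add_le_add (hb3 z) (hb2 z))) ?_
      intro z hz
      refine ih (catH h [z]) (fun l => V (z :: l)) (fun l => B (z :: l)) (fun l => hV _) ?_ ?_
      · intro l hl
        have := hs (z :: l) (NP_cons.2 ⟨hB, hl⟩)
        rwa [← catH_cons] at this
      · intro e he hmin hne
        have := hE (z :: e) he ?_ ?_
        · rwa [← catH_cons] at this
        · intro l' hl' hl''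
          rcases List.prefix_cons_iff.1 hl' with rfl | ⟨t, rfl, ht⟩
          · exact hB
          · exact hmin t ht (fun h => hl'' (by rw [h]))
        · rw [contProb_cons]; exact mul_ne_zero hz hne

open Filter Topology in
/-- The stopping lemma: a bounded supermartingale `V` until `B` dominating the conditional expectation of
`F` at `B` and dominating `F` asymptotically if `B` is never reached. -/
theorem optStopping (hP : IsInducedFamily G P) (σ : G.Profile) {F : G.Run → ℝ} (hF : Measurable F) {C C' : ℝ}
    (hC : ∀ r, |F r| ≤ C) (h : G.History) (V : List (Zt G) → ℝ) (B : List (Zt G) → Prop)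
    (hV : ∀ l, |V l| ≤ C')
    (hs : ∀ l, NP B l → oe (fun i => σ i (catH h l)) (lastState (catH h l)) (fun z => V (l ++ [z])) ≤ V l)
    (hE : ∀ e, B e → (∀ l', l' <+: e → l' ≠ e → ¬ B l') → contProb σ h e ≠ 0 →
      ∫ r, F r ∂(P (catH h e) σ) ≤ V e)
    (hL : ∀ r ∈ cyl h, (∀ n, ¬ B (pre h r n)) → ∀ η > 0, ∀ᶠ n in atTop, F r ≤ V (pre h r n) + η) :
    ∫ r, F r ∂(P h σ) ≤ V [] := by
  have := hP.1
  let Y : ℕ → G.Run → ℝ := fun n r => if NP B (pre h r n) then F r - V (pre h r n) else 0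
  have hY : ∀ n r, |Y n r| ≤ C + C' := fun n r => abs_ite_le (hC r) (hV _)
  have hYm : ∀ n, Measurable (Y n) := fun n => meas_ite h n B V hF
  have key : ∀ n, ∫ r, F r ∂(P h σ) - V [] ≤ ∫ r, max (Y n r) 0 ∂(P h σ) := by
    intro n
    have h1 := optStopping_fin hP σ hF hC n h V B hV hs hE
    have h2 : ∫ r, Y n r ∂(P h σ) ≤ ∫ r, max (Y n r) 0 ∂(P h σ) := by
      refine integral_mono (integrable_bdd hP h σ (hYm n) (hY n)) ?_ fun r => le_max_left _ _
      refine integrable_bdd hP h σ ((hYm n).max measurable_const) (C := C + C') fun r => ?_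
      rw [abs_of_nonneg (le_max_right _ _)]
      exact max_le ((le_abs_self _).trans (hY n r)) ((abs_nonneg _).trans (hY n r))
    simp only [Y] at h2 ⊢
    linarith
  have lim : Tendsto (fun n => ∫ r, max (Y n r) 0 ∂(P h σ)) atTop (𝓝 (∫ _, (0:ℝ) ∂(P h σ))) := by
    refine tendsto_integral_of_dominated_convergence (fun _ => C + C')
      (fun n => ((hYm n).max measurable_const).aestronglyMeasurable) (integrable_const _) ?_ ?_
    · refine fun n => Eventually.of_forall fun r => ?_
      rw [Real.norm_eq_abs, abs_of_nonneg (le_max_right _ _)]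
      exact max_le ((le_abs_self _).trans (hY n r)) ((abs_nonneg _).trans (hY n r))
    · filter_upwards [ae_cyl hP h σ] with r hr
      by_cases hB : ∃ k, B (pre h r k)
      · obtain ⟨k, hk⟩ := hB
        refine tendsto_const_nhds.congr' ?_
        filter_upwards [eventually_ge_atTop k] with n hn
        have : ¬ NP B (pre h r n) := fun H => H _ (pre_isPfx h r hn) hk
        simp [Y, this]
      · push Not at hB
        rw [Metric.tendsto_atTop]
        intro η hη
        obtain ⟨N, hN⟩ := eventually_atTop.1 (hL r hr hB (η / 2) (by positivity))
        refine ⟨N, fun n hn => ?_⟩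
        have hNP : NP B (pre h r n) := fun l' hl' => by rw [prefix_pre hl']; exact hB _
        have h1 := hN n hn
        simp only [Y, hNP, if_true]
        rw [Real.dist_eq, sub_zero, abs_of_nonneg (le_max_right _ _)]
        refine max_lt (by linarith) hη
  rw [integral_zero] at lim
  have := ge_of_tendsto' lim key
  linarith

/-- finite horizon: expectation of the level `n+1` function -/
theorem integral_pre_succ (hP : IsInducedFamily G P) (σ : G.Profile) {C : ℝ} (n : ℕ) :
    ∀ (h : G.History) (V : List (Zt G) → ℝ), (∀ l, |V l| ≤ C) →
    ∫ r, V (pre h r (n + 1)) ∂(P h σ) =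
      ∫ r, oe (fun i => σ i (catH h (pre h r n))) (lastState (catH h (pre h r n)))
        (fun z => V (pre h r n ++ [z])) ∂(P h σ) := by
  have := hP.1
  induction n with
  | zero =>
    intro h V hV
    rw [integral_step hP h σ (measurable_pre_fun h _ V) (fun r => hV _)]
    simp only [pre_zero, catH_nil, List.nil_append, integral_const, probReal_univ, one_smul]
    congr 1
    funext z
    have : ∫ r, V (pre h r (0 + 1)) ∂(P (catH h [z]) σ) = ∫ r, V [z] ∂(P (catH h [z]) σ) := by
      refine integral_congr_ae ?_
      filter_upwards [ae_cyl hP (catH h [z]) σ] with r hr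
      rw [pre_cons_of_mem hr, pre_zero]
    rw [this]; simp
  | succ n ih =>
    intro h V hV
    rw [integral_step hP h σ (measurable_pre_fun h _ V) (fun r => hV _),
      integral_step hP h σ (measurable_pre_fun h _ fun l => oe (fun i => σ i (catH h l)) (lastState (catH h l))
        (fun z => V (l ++ [z]))) (fun r => abs_oe_le _ _ fun z => hV _)]
    congr 1
    funext z
    have h1 := ih (catH h [z]) (fun l => V (z :: l)) (fun l => hV _)
    have e1 : ∫ r, V (pre h r (n + 1 + 1)) ∂(P (catH h [z]) σ) =
        ∫ r, V (z :: pre (catH h [z]) r (n+1)) ∂(P (catH h [z]) σ) := by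
      refine integral_congr_ae ?_
      filter_upwards [ae_cyl hP (catH h [z]) σ] with r hr
      rw [pre_cons_of_mem hr]
    rw [e1, h1]
    refine integral_congr_ae ?_
    filter_upwards [ae_cyl hP (catH h [z]) σ] with r hr
    simp only [pre_cons_of_mem hr, catH_cons, List.cons_append]

theorem ae_contProb (hP : IsInducedFamily G P) (σ : G.Profile) (h : G.History) :
    ∀ᵐ r ∂(P h σ), ∀ n, contProb σ h (pre h r n) ≠ 0 := by
  have h1 : ∀ᵐ r ∂(P h σ), ∀ l, contProb σ h l = 0 → r ∉ cyl (catH h l) := by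
    rw [ae_all_iff]
    intro l
    by_cases hl : contProb σ h l = 0
    · have h2 : P h σ (cyl (catH h l)) = 0 := by rw [hP.2, hl]
      filter_upwards [measure_eq_zero_iff_ae_notMem.1 h2] with r hr _
      exact hr
    · exact Filter.Eventually.of_forall fun r h => absurd h hl
  filter_upwards [h1, ae_cyl hP h σ] with r hr hc n h0
  exact hr _ h0 (mem_cyl_pre hc n)

theorem lastState_snoc (h : G.History) (z : Zt G) : lastState (catH h [z]) = z.2 := by
  simp [lastState, catH]

theorem validFrom_append (s : G.S) (l : List (Zt G)) (z : Zt G) :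
    ValidFrom G s (l ++ [z]) ↔ ValidFrom G s l ∧ G.trans (lastState (s, l)) z.1 z.2 ≠ 0 := by
  induction l generalizing s with
  | nil => obtain ⟨a, t⟩ := z; simp [ValidFrom, lastState]
  | cons w l ih =>
    obtain ⟨a, t⟩ := w
    have : lastState (G := G) (s, (a, t) :: l) = lastState (t, l) := by
      cases l with
      | nil => simp [lastState]
      | cons b l => simp [lastState, List.getLast?_cons_cons]
                    cases h : (b :: l).getLast? with
                    | none => simp at h
                    | some v => simp [List.getLast?_cons] at h ⊢
    simp only [List.cons_append, ValidFrom, ih, this, and_assoc]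

theorem valid_of_contProb (σ : G.Profile) (l : List (Zt G)) : ∀ (h : G.History), Valid h → contProb σ h l ≠ 0 →
    Valid (catH h l) := by
  induction l with
  | nil => intro h hv _; rwa [catH_nil]
  | cons z l ih =>
    intro h hv hc
    rw [contProb_cons] at hc
    rw [← catH_cons]
    refine ih _ ?_ (right_ne_zero_of_mul hc)
    unfold Valid catH
    rw [validFrom_append]
    exact ⟨hv, right_ne_zero_of_mul (left_ne_zero_of_mul hc)⟩

end StochGame

namespace StochGame
open Filter
variable {G : StochGame}

noncomputable instance nonemptyZt : Nonempty (Zt G) := inferInstance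

/-- legal one-step payoffs for player `i`, guaranteeing `v` -/
def Leg (i : G.I) (C : ℝ) (s : G.S) (v : ℝ) (u : Zt G → ℝ) : Prop :=
  (∀ z, |u z| ≤ C + 1) ∧ ∀ x : ∀ j, PMF (G.A j), ∃ y : PMF (G.A i), v ≤ oe (Function.update x i y) s u

def Cert (i : G.I) (C : ℝ) (h : G.History) (X : List (Zt G) → ℝ) : Prop :=
  (∀ l, |X l| ≤ C + 1) ∧
  (∀ l, Leg i C (lastState (catH h l)) (X l) (fun z => X (l ++ [z]))) ∧
  ∀ r ∈ cyl h, ∀ k : ℕ, ∃ᶠ n in atTop, X (pre h r n) ≤ G.payoff i r + 1 / ((k : ℝ) + 1)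

def WinsI (i : G.I) (C : ℝ) (h : G.History) (v : ℝ) : Prop := ∃ X, Cert i C h X ∧ X [] = v

/-! ### the auxiliary perfect information game -/

abbrev Mv (G : StochGame) := (Zt G → ℝ) × Zt G

noncomputable def xv (v : ℝ) (p : ℕ → Mv G) : ℕ → ℝ
  | 0 => v
  | k + 1 => (p (2 * k)).1 (p (2 * k + 1)).2

def lst (p : ℕ → Mv G) (k : ℕ) : List (Zt G) := (List.range k).map fun j => (p (2 * j + 1)).2

noncomputable def rn (h : G.History) (p : ℕ → Mv G) : G.Run :=
  (h.1, fun n => if hn : n < h.2.length then h.2[n] else (p (2 * (n - h.2.length) + 1)).2)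

theorem lst_succ (p : ℕ → Mv G) (k : ℕ) : lst p (k + 1) = lst p k ++ [(p (2 * k + 1)).2] := by
  simp [lst, List.range_succ]

theorem lst_congr {p q : ℕ → Mv G} {k n : ℕ} (H : BD.Agr (X := fun _ => Mv G) n p q) (hk : 2 * k ≤ n) :
    lst p k = lst q k := by
  refine List.map_congr_left fun j hj => ?_
  rw [List.mem_range] at hj
  rw [H (2 * j + 1) (by omega)]

theorem xv_congr {v : ℝ} {p q : ℕ → Mv G} {k n : ℕ} (H : BD.Agr (X := fun _ => Mv G) n p q) (hk : 2 * k ≤ n) :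
    xv v p k = xv v q k := by
  cases k with
  | zero => rfl
  | succ k => simp only [xv]; rw [H (2 * k) (by omega), H (2 * k + 1) (by omega)]

theorem rn_cyl (h : G.History) (p : ℕ → Mv G) : rn h p ∈ cyl h := by
  refine ⟨rfl, fun k hk => ?_⟩
  simp [rn, hk]

theorem pre_rn (h : G.History) (p : ℕ → Mv G) (n : ℕ) : pre h (rn h p) n = lst p n := by
  refine List.map_congr_left fun j hj => ?_
  simp [rn]

theorem rn_eq {h : G.History} {p : ℕ → Mv G} {r : G.Run} (hr : r ∈ cyl h)
    (H : ∀ j, r.2 (h.2.length + j) = (p (2 * j + 1)).2) : rn h p = r := by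
  refine Prod.ext hr.1.symm (funext fun n => ?_)
  simp only [rn]
  split_ifs with hn
  · rw [hr.2 n hn]; rfl
  · rw [← H, show h.2.length + (n - h.2.length) = n by omega]

def LegAt (i : G.I) (C : ℝ) (h : G.History) (v : ℝ) (p : ℕ → Mv G) (k : ℕ) : Prop :=
  Leg i C (lastState (catH h (lst p k))) (xv v p k) (p (2 * k)).1

theorem LegAt_congr {i : G.I} {C : ℝ} {h : G.History} {v : ℝ} {p q : ℕ → Mv G} {k n : ℕ}
    (H : BD.Agr (X := fun _ => Mv G) n p q) (hk : 2 * k < n) :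
    LegAt i C h v p k ↔ LegAt i C h v q k := by
  unfold LegAt
  rw [lst_congr H hk.le, xv_congr H hk.le, H _ hk]

def WSet (i : G.I) (C : ℝ) (h : G.History) (v : ℝ) : Set (ℕ → Mv G) :=
  {p | (∀ k, LegAt i C h v p k) ∧
    ∀ k : ℕ, ∃ᶠ n in atTop, xv v p n ≤ G.payoff i (rn h p) + 1 / ((k : ℝ) + 1)}

theorem meas_of_FD {β : Type*} [MeasurableSpace β] (f : (ℕ → Mv G) → β) (n : ℕ)
    (hf : ∀ x y, BD.Agr (X := fun _ => Mv G) n x y → f x = f y) :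
    Measurable[BD.bsa fun _ => Mv G] f := by
  intro s _
  refine MeasurableSpace.measurableSet_generateFrom ⟨n, fun x y hxy => ?_⟩
  simp [hf x y hxy]

theorem meas_WSet {i : G.I} (hf : Measurable (G.payoff i)) (C : ℝ) (h : G.History) (v : ℝ) :
    MeasurableSet[BD.bsa fun _ => Mv G] (WSet i C h v) := by
  let : MeasurableSpace (ℕ → Mv G) := BD.bsa fun _ => Mv G
  have hrn : Measurable (rn (G := G) h) := by
    refine Measurable.prodMk measurable_const (measurable_pi_lambda _ fun n => ?_)
    refine meas_of_FD _ (2 * (n - h.2.length) + 2) fun x y hxy => ?_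
    rw [hxy _ (by omega)]
  have hx : ∀ n, Measurable fun p : ℕ → Mv G => xv v p n := fun n =>
    meas_of_FD _ (2 * n) fun x y hxy => xv_congr hxy le_rfl
  have : WSet i C h v = (⋂ k, {p | LegAt i C h v p k}) ∩ ⋂ k : ℕ, ⋂ N : ℕ, ⋃ n : ℕ, ⋃ _ : N ≤ n,
      {p | xv v p n ≤ G.payoff i (rn h p) + 1 / ((k : ℝ) + 1)} := by
    ext p
    simp [WSet, frequently_atTop]
  rw [this]
  refine MeasurableSet.inter (MeasurableSet.iInter fun k => ?_) (MeasurableSet.iInter fun k =>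
    MeasurableSet.iInter fun N => MeasurableSet.iUnion fun n => MeasurableSet.iUnion fun _ => ?_)
  · exact MeasurableSpace.measurableSet_generateFrom ⟨2 * k + 1, fun x y hxy => LegAt_congr hxy (by omega)⟩
  · exact measurableSet_le (hx n) ((hf.comp hrn).add_const _)

/-- player I wins: certificate -/
theorem wins_of_strat {i : G.I} {C : ℝ} {h : G.History} {v : ℝ} (hv : |v| ≤ C + 1)
    (S : BD.Strat fun _ => Mv G) (hS : ∀ x, BD.Fol 0 S 0 x → x ∈ WSet i C h v) : WinsI i C h v := by
  let pl : (ℕ → Zt G) → ℕ → Mv G := fun w =>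
    BD.run (X := fun _ => Mv G) (fun m => m % 2 = 0) S (fun n => (fun _ => 0, w (n / 2)))
  have hpl : ∀ w, pl w ∈ WSet i C h v := fun w => hS _ fun m _ hm =>
    BD.run_pos (c := fun m => m % 2 = 0) S _ hm
  have hz : ∀ w j, (pl w (2 * j + 1)).2 = w j := fun w j => by
    have : pl w (2 * j + 1) = _ := BD.run_neg (c := fun m => m % 2 = 0) S _ (by omega)
    rw [this]
    simp only
    congr 1
    omega
  have hag : ∀ w w' k, (∀ j < k, w j = w' j) → BD.Agr (X := fun _ => Mv G) (2 * k + 1) (pl w) (pl w') := by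
    intro w w' k H
    refine BD.run_congr (fun _ _ => rfl) fun m hm hc => ?_
    rw [H _ (by omega)]
  let wl : List (Zt G) → ℕ → Zt G := fun l j => l.getD j (Classical.arbitrary _)
  have hlst : ∀ l : List (Zt G), lst (pl (wl l)) l.length = l := by
    intro l
    refine List.ext_getElem (by simp [lst]) fun j h1 h2 => ?_
    simp only [lst, List.getElem_map, List.getElem_range, hz, wl]
    simp [h2]
  let X : List (Zt G) → ℝ := fun l => xv v (pl (wl l)) l.length
  have hX : ∀ (w : ℕ → Zt G) (l : List (Zt G)), (∀ j < l.length, w j = wl l j) → X l = xv v (pl w) l.length := by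
    intro w l H
    exact (xv_congr (hag w _ _ H) (by omega)).symm
  have hsn : ∀ l z, X (l ++ [z]) = (pl (wl l) (2 * l.length)).1 z := by
    intro l z
    have h1 : ∀ j < l.length, wl l j = wl (l ++ [z]) j := by
      intro j hj
      simp [wl, hj, List.getElem?_append_left]
    have h2 : wl (l ++ [z]) l.length = z := by simp [wl]
    simp only [X, List.length_append, List.length_singleton, xv]
    rw [hz, h2, hag _ _ _ h1 (2 * l.length) (by omega)]
  have hleg : ∀ l, Leg i C (lastState (catH h l)) (X l) (fun z => X (l ++ [z])) := by
    intro l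
    have := (hpl (wl l)).1 l.length
    unfold LegAt at this
    rw [hlst] at this
    simp only [hsn]
    exact this
  refine ⟨X, ⟨?_, hleg, ?_⟩, rfl⟩
  · intro l
    rcases List.eq_nil_or_concat l with rfl | ⟨l, z, rfl⟩
    · exact hv
    · rw [List.concat_eq_append]; exact (hleg l).1 z
  · intro r hr k
    let w : ℕ → Zt G := fun j => r.2 (h.2.length + j)
    have h1 : rn h (pl w) = r := rn_eq hr fun j => (hz w j).symm
    have h2 := (hpl w).2 k
    rw [h1] at h2
    refine h2.mono fun n hn => ?_
    rw [hX w]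
    · rwa [pre_length]
    · intro j hj
      rw [pre_length] at hj
      simp [w, wl, pre, hj]

end StochGame

namespace StochGame
open Filter
variable {G : StochGame} {P : G.History → G.Profile → Measure G.Run}

/-- a legal position of the auxiliary game consistent with `T` -/
def Pos (i : G.I) (C : ℝ) (h : G.History) (v : ℝ) (T : BD.Strat fun _ => Mv G) (k : ℕ) (p : ℕ → Mv G) : Prop :=
  (∀ m, m < 2 * k → m % 2 = 1 → p m = T.f m p) ∧ ∀ j, j < k → LegAt i C h v p j

theorem Pos.le {i : G.I} {C : ℝ} {h : G.History} {v : ℝ} {T : BD.Strat fun _ => Mv G}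
    {k : ℕ} {p : ℕ → Mv G} (hp : Pos i C h v T k p) (hv : |v| ≤ C + 1) (hC : ∀ r, |G.payoff i r| ≤ C)
    (hT : ∀ x, BD.Fol 1 T 0 x → x ∉ WSet i C h v) : |xv v p k| ≤ C + 1 ∧ - C ≤ xv v p k := by
  have hb : |xv v p k| ≤ C + 1 := by
    cases k with
    | zero => exact hv
    | succ k => exact (hp.2 k (by omega)).1 _
  refine ⟨hb, ?_⟩
  by_contra hlt
  push Not at hlt
  set c := xv v p k with hc
  let q : ℕ → Mv G := BD.run (X := fun _ => Mv G) (fun m => m % 2 = 1) T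
    (fun m => if m < 2 * k then p m else (fun _ => c, (p m).2))
  have hq : BD.Agr (X := fun _ => Mv G) (2 * k) q p := by
    refine BD.run_unique (fun m hm h1 => hp.1 m hm h1) fun m hm _ => ?_
    rw [if_pos hm]
  have hqf : BD.Fol 1 T 0 q := fun m _ hm => BD.run_pos (c := fun m => m % 2 = 1) T _ hm
  have hq1 : ∀ j, k ≤ j → (q (2 * j)).1 = fun _ => c := by
    intro j hj
    have : q (2 * j) = _ := BD.run_neg (c := fun m => m % 2 = 1) T _ (by omega)
    rw [this, if_neg (by omega)]
  have hq2 : ∀ j, k ≤ j → xv v q j = c := by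
    intro j hj
    rcases hj.eq_or_lt with rfl | hj
    · rw [xv_congr hq le_rfl]
    · obtain ⟨j, rfl⟩ : ∃ j', j = j' + 1 := ⟨j - 1, by omega⟩
      simp only [xv]; rw [hq1 j (by omega)]
  refine hT q hqf ⟨fun j => ?_, fun n => Filter.Eventually.frequently ?_⟩
  · rcases lt_or_ge j k with hj | hj
    · exact (LegAt_congr hq (by omega)).2 (hp.2 j hj)
    · unfold LegAt
      rw [hq1 j hj, hq2 j hj]
      exact ⟨fun _ => hb, fun x => ⟨x i, by rw [oe_const]⟩⟩
  · filter_upwards [eventually_ge_atTop k] with m hm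
    rw [hq2 m hm]
    have := (abs_le.1 (hC (rn h q))).1
    have : (0:ℝ) ≤ 1 / ((n:ℝ) + 1) := by positivity
    linarith

/-- extend a position by the move `u` and the answer of `T` -/
noncomputable def nxt (T : BD.Strat fun _ => Mv G) (k : ℕ) (p : ℕ → Mv G) (u : Zt G → ℝ) : ℕ → Mv G :=
  Function.update (Function.update p (2 * k) (u, (p (2 * k)).2)) (2 * k + 1)
    (T.f (2 * k + 1) (Function.update p (2 * k) (u, (p (2 * k)).2)))

theorem nxt_agr (T : BD.Strat fun _ => Mv G) (k : ℕ) (p : ℕ → Mv G) (u : Zt G → ℝ) :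
    BD.Agr (X := fun _ => Mv G) (2 * k) p (nxt T k p u) := by
  intro m hm
  unfold nxt
  rw [Function.update_of_ne (by omega), Function.update_of_ne (by omega)]

theorem nxt_fst (T : BD.Strat fun _ => Mv G) (k : ℕ) (p : ℕ → Mv G) (u : Zt G → ℝ) :
    (nxt T k p u (2 * k)).1 = u := by
  unfold nxt
  rw [Function.update_of_ne (by omega), Function.update_self]

noncomputable def ans (T : BD.Strat fun _ => Mv G) (k : ℕ) (p : ℕ → Mv G) (u : Zt G → ℝ) : Zt G :=
  (nxt T k p u (2 * k + 1)).2

theorem xv_nxt (v : ℝ) (T : BD.Strat fun _ => Mv G) (k : ℕ) (p : ℕ → Mv G) (u : Zt G → ℝ) :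
    xv v (nxt T k p u) (k + 1) = u (ans T k p u) := by
  simp only [xv, nxt_fst, ans]

theorem Pos.nxt {i : G.I} {C : ℝ} {h : G.History} {v : ℝ} {T : BD.Strat fun _ => Mv G}
    {k : ℕ} {p : ℕ → Mv G} (hp : Pos i C h v T k p) {u : Zt G → ℝ}
    (hu : Leg i C (lastState (catH h (lst p k))) (xv v p k) u) : Pos i C h v T (k + 1) (nxt T k p u) := by
  have ha := nxt_agr T k p u
  constructor
  · intro m hm h1
    rcases lt_or_ge m (2 * k) with h2 | h2
    · rw [← ha m h2, hp.1 m h2 h1]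
      exact T.loc _ _ _ (ha.mono h2.le)
    · obtain rfl : m = 2 * k + 1 := by omega
      conv_lhs => rw [StochGame.nxt, Function.update_self]
      refine T.loc _ _ _ ?_
      exact BD.Agr.upd_self (X := fun _ => Mv G) _ _ _
  · intro j hj
    rcases lt_or_ge j k with h2 | h2
    · exact (LegAt_congr ha (by omega)).1 (hp.2 j h2)
    · obtain rfl : j = k := by omega
      unfold LegAt
      rw [nxt_fst, ← lst_congr ha le_rfl, ← xv_congr ha le_rfl]
      exact hu

/-- admissible moves of player I leading to the answer `z` -/
def Gd (i : G.I) (C : ℝ) (h : G.History) (v : ℝ) (T : BD.Strat fun _ => Mv G) (k : ℕ) (p : ℕ → Mv G)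
    (z : Zt G) (u : Zt G → ℝ) : Prop :=
  Leg i C (lastState (catH h (lst p k))) (xv v p k) u ∧ ans T k p u = z

noncomputable def psi (i : G.I) (C : ℝ) (h : G.History) (v : ℝ) (T : BD.Strat fun _ => Mv G) (k : ℕ)
    (p : ℕ → Mv G) (z : Zt G) : ℝ := sInf ({c | ∃ u, Gd i C h v T k p z u ∧ u z = c} ∪ {C + 1})

section
variable {i : G.I} {C : ℝ} {h : G.History} {v : ℝ} {T : BD.Strat fun _ => Mv G}
    {k : ℕ} {p : ℕ → Mv G}

theorem psi_bdd (hp : Pos i C h v T k p) (hv : |v| ≤ C + 1) (hC0 : 0 ≤ C) (hC : ∀ r, |G.payoff i r| ≤ C)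
    (hT : ∀ x, BD.Fol 1 T 0 x → x ∉ WSet i C h v) (z : Zt G) :
    ∀ c ∈ ({c | ∃ u, Gd i C h v T k p z u ∧ u z = c} ∪ {C + 1} : Set ℝ), - C ≤ c := by
  rintro c (⟨u, hu, rfl⟩ | rfl)
  · have := ((hp.nxt hu.1).le hv hC hT).2
    rwa [xv_nxt, hu.2] at this
  · linarith

theorem psi_le (hp : Pos i C h v T k p) (hv : |v| ≤ C + 1) (hC0 : 0 ≤ C) (hC : ∀ r, |G.payoff i r| ≤ C)
    (hT : ∀ x, BD.Fol 1 T 0 x → x ∉ WSet i C h v) (z : Zt G) :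
    - C ≤ psi i C h v T k p z ∧ psi i C h v T k p z ≤ C + 1 ∧
    ∀ u, Gd i C h v T k p z u → psi i C h v T k p z ≤ u z := by
  have hb := psi_bdd hp hv hC0 hC hT z
  refine ⟨le_csInf ⟨C + 1, Or.inr rfl⟩ hb, csInf_le ⟨_, hb⟩ (Or.inr rfl), fun u hu => csInf_le ⟨_, hb⟩ (Or.inl ⟨u, hu, rfl⟩)⟩

theorem psi_near (z : Zt G) {η : ℝ} (hη : 0 < η)
    (hn : ¬ ∃ u, Gd i C h v T k p z u ∧ u z ≤ psi i C h v T k p z + η) : C + 1 ≤ psi i C h v T k p z := by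
  obtain ⟨c, hc, hlt⟩ := exists_lt_of_csInf_lt (s := ({c | ∃ u, Gd i C h v T k p z u ∧ u z = c} ∪ {C + 1} : Set ℝ))
    ⟨C + 1, Or.inr rfl⟩ (lt_add_of_pos_right (psi i C h v T k p z) hη)
  by_contra hlt2
  push Not at hlt2
  rcases hc with ⟨u, hu, rfl⟩ | hc
  · exact hn ⟨u, hu, hlt.le⟩
  · obtain rfl : c = C + 1 := hc
    obtain ⟨c, hc, hlt3⟩ := exists_lt_of_csInf_lt (s := ({c | ∃ u, Gd i C h v T k p z u ∧ u z = c} ∪ {C + 1} : Set ℝ))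
      ⟨C + 1, Or.inr rfl⟩ hlt2
    rcases hc with ⟨u, hu, rfl⟩ | hc
    · exact hn ⟨u, hu, by linarith⟩
    · exact absurd hc (ne_of_lt hlt3)

theorem psi_strat (hp : Pos i C h v T k p) (hv : |v| ≤ C + 1) (hC0 : 0 ≤ C) (hC : ∀ r, |G.payoff i r| ≤ C)
    (hT : ∀ x, BD.Fol 1 T 0 x → x ∉ WSet i C h v) {η : ℝ} (hη : 0 < η) :
    ∃ x : ∀ j, PMF (G.A j), ∀ y : PMF (G.A i),
      oe (Function.update x i y) (lastState (catH h (lst p k))) (psi i C h v T k p) ≤ xv v p k + η := by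
  by_contra hn
  push Not at hn
  have hb : ∀ z, |psi i C h v T k p z| ≤ C + 1 := fun z => by
    have := psi_le hp hv hC0 hC hT z
    exact abs_le.2 ⟨by linarith [this.1], this.2.1⟩
  set η' := min η 1 with hη'
  have h0 : 0 < η' := lt_min hη one_pos
  let u : Zt G → ℝ := fun z => psi i C h v T k p z + (-η')
  have hu : Leg i C (lastState (catH h (lst p k))) (xv v p k) u := by
    constructor
    · intro z
      have := psi_le hp hv hC0 hC hT z
      have : η' ≤ 1 := min_le_right _ _
      exact abs_le.2 ⟨by simp only [u]; linarith [this], by simp only [u]; linarith⟩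
    · intro x
      obtain ⟨y, hy⟩ := hn x
      refine ⟨y, ?_⟩
      rw [oe_add_const _ _ hb]
      have : η' ≤ η := min_le_left _ _
      linarith
  have := (psi_le hp hv hC0 hC hT (ans T k p u)).2.2 u ⟨hu, rfl⟩
  simp only [u] at this
  linarith
end

/-- state of the simulation after the continuation `l` -/
noncomputable def stp (i : G.I) (C : ℝ) (h : G.History) (v : ℝ) (T : BD.Strat fun _ => Mv G) (η : ℝ) :
    Option (ℕ × (ℕ → Mv G)) → Zt G → Option (ℕ × (ℕ → Mv G))
  | none, _ => none
  | some (k, p), z =>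
    if H : ∃ u, Gd i C h v T k p z u ∧ u z ≤ psi i C h v T k p z + η / 2 ^ (k + 2) then
      some (k + 1, nxt T k p H.choose) else none

theorem punish (hP : IsInducedFamily G P) {i : G.I} (hf : Measurable (G.payoff i)) {C : ℝ} (hC0 : 0 ≤ C)
    (hC : ∀ r, |G.payoff i r| ≤ C) (h : G.History) {v : ℝ} (hv : |v| ≤ C + 1) (hw : ¬ WinsI i C h v)
    {η : ℝ} (hη : 0 < η) :
    ∃ σ : G.Profile, ∀ τ : G.Strategy i, ∫ r, G.payoff i r ∂(P h (Function.update σ i τ)) ≤ v + η := by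
  rcases BD.borel_determinacy (meas_WSet hf C h v) with ⟨S, hS⟩ | ⟨T, hT⟩
  · exact absurd (wins_of_strat hv S hS) hw
  let p0 : ℕ → Mv G := fun _ => (fun _ => 0, Classical.arbitrary _)
  let st : List (Zt G) → Option (ℕ × (ℕ → Mv G)) := fun l => l.foldl (stp i C h v T η) (some (0, p0))
  have st_snoc : ∀ l z, st (l ++ [z]) = stp i C h v T η (st l) z := fun l z => by
    simp only [st, List.foldl_append, List.foldl_cons, List.foldl_nil]
  have inv : ∀ l k p, st l = some (k, p) → k = l.length ∧ Pos i C h v T k p ∧ lst p k = l := by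
    intro l
    induction l using List.reverseRecOn with
    | nil =>
      intro k p e
      obtain ⟨rfl, rfl⟩ : 0 = k ∧ p0 = p := by simpa [st] using e
      exact ⟨rfl, ⟨fun m hm => by omega, fun m hm => by omega⟩, rfl⟩
    | append_singleton l z ih =>
      intro k p e
      rw [st_snoc] at e
      cases hl : st l with
      | none => rw [hl] at e; simp [stp] at e
      | some q =>
        obtain ⟨k', p'⟩ := q
        rw [hl] at e
        simp only [stp] at e
        split_ifs at e with H
        obtain ⟨rfl, rfl⟩ : k' + 1 = k ∧ nxt T k' p' H.choose = p := by simpa using e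
        obtain ⟨h1, h2, h3⟩ := ih _ _ hl
        have hu := H.choose_spec
        refine ⟨by simp [h1], h2.nxt hu.1.1, ?_⟩
        rw [lst_succ, ← lst_congr (nxt_agr T k' p' H.choose) le_rfl, h3]
        congr 2
        exact hu.1.2
  -- the punishing profile
  have hx : ∀ l, ∃ x : ∀ j, PMF (G.A j), ∀ k p, st l = some (k, p) → ∀ y : PMF (G.A i),
      oe (Function.update x i y) (lastState (catH h l)) (psi i C h v T k p) ≤ xv v p k + η / 2 ^ (k + 2) := by
    intro l
    cases hl : st l with
    | none => exact ⟨fun j => PMF.pure (Classical.arbitrary _), by simp⟩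
    | some q =>
      obtain ⟨k, p⟩ := q
      obtain ⟨h1, h2, h3⟩ := inv _ _ _ hl
      obtain ⟨x, hx⟩ := psi_strat h2 hv hC0 hC hT (η := η / 2 ^ (k + 2)) (by positivity)
      refine ⟨x, fun k' p' e => ?_⟩
      obtain ⟨rfl, rfl⟩ : k = k' ∧ p = p' := by simpa using e
      rw [h3] at hx
      exact hx
  choose x hx using hx
  let σ : G.Profile := fun j g => if H : ∃ l, g = catH h l then x H.choose j else PMF.pure (Classical.arbitrary _)
  have hσ : ∀ l j, σ j (catH h l) = x l j := by
    intro l j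
    have H : ∃ l', catH h l = catH h l' := ⟨l, rfl⟩
    simp only [σ]
    rw [dif_pos H, ← catH_inj H.choose_spec]
  refine ⟨σ, fun τ => ?_⟩
  let val : Option (ℕ × (ℕ → Mv G)) → ℝ := fun o => o.elim (C + 1) (fun q => xv v q.2 q.1)
  have hval : ∀ l, |val (st l)| ≤ C + 1 := by
    intro l
    cases hl : st l with
    | none => exact abs_le.2 ⟨by simp [val]; linarith, by simp [val]⟩
    | some q =>
      obtain ⟨k, p⟩ := q
      exact ((inv _ _ _ hl).2.1.le hv hC hT).1
  let V : List (Zt G) → ℝ := fun l => val (st l) + η / 2 ^ l.length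
  have hp2 : ∀ n : ℕ, 0 < η / 2 ^ n ∧ η / 2 ^ n ≤ η := fun n =>
    ⟨by positivity, div_le_self hη.le (one_le_pow₀ (by norm_num))⟩
  have hV : ∀ l, |V l| ≤ C + 1 + η := fun l => by
    have h1 := abs_le.1 (hval l)
    have h2 := hp2 l.length
    exact abs_le.2 ⟨by simp only [V]; linarith, by simp only [V]; linarith⟩
  have main := optStopping hP (Function.update σ i τ) hf hC h V (fun _ => False) hV ?_ (fun _ h => h.elim) ?_
  · have : V [] = v + η := by simp [V, st, val, xv]
    rwa [this] at main
  · intro l _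
    have hup : (fun j => Function.update σ i τ j (catH h l)) = Function.update (x l) i (τ (catH h l)) := by
      funext j
      by_cases hj : j = i
      · subst hj; simp
      · simp [hj, hσ]
    rw [hup]
    cases hl : st l with
    | none =>
      refine oe_le _ _ (fun z => hV _) fun z => ?_
      simp only [V, st_snoc, hl, stp]
      simp only [val, Option.elim_none, List.length_append, List.length_singleton, pow_succ]
      have := hp2 l.length
      rw [← div_div]
      linarith
    | some q =>
      obtain ⟨k, p⟩ := q
      obtain ⟨h1, h2, h3⟩ := inv _ _ _ hl
      have h4 := hx l k p hl (τ (catH h l))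
      have hb : ∀ z, |psi i C h v T k p z| ≤ C + 1 := fun z => by
        have := psi_le h2 hv hC0 hC hT z
        exact abs_le.2 ⟨by linarith [this.1], this.2.1⟩
      have h5 : oe (Function.update (x l) i (τ (catH h l))) (lastState (catH h l)) (fun z => V (l ++ [z])) ≤
          oe (Function.update (x l) i (τ (catH h l))) (lastState (catH h l)) (fun z => psi i C h v T k p z +
            (η / 2 ^ (k + 2) + η / 2 ^ (k + 1))) := by
        refine oe_mono (C' := C + 1 + |η / 2 ^ (k + 2) + η / 2 ^ (k + 1)|) _ _ (fun z => hV _) (fun z => (abs_add_le _ _).trans (by linarith [hb z])) fun z => ?_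
        simp only [V, st_snoc, hl, stp, List.length_append, List.length_singleton, ← h1]
        split_ifs with H
        · have hu := H.choose_spec
          simp only [val, Option.elim_some, xv_nxt]
          rw [hu.1.2]
          linarith [hu.2]
        · have := psi_near z (hp2 (k + 2)).1 H
          have := hp2 (k + 2)
          simp only [val, Option.elim_none]
          linarith
      refine h5.trans ?_
      rw [oe_add_const _ _ hb]
      simp only [V, hl, val, Option.elim_some, ← h1]
      have e1 : η / 2 ^ k = η / 2 ^ (k + 2) + η / 2 ^ (k + 2) + η / 2 ^ (k + 1) := by
        field_simp; ring
      linarith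
  · intro r hr _ η' hη'
    suffices H : ∀ᶠ n in atTop, G.payoff i r ≤ val (st (pre h r n)) by
      filter_upwards [H] with n hn
      have := hp2 (pre h r n).length
      simp only [V]
      linarith
    have hsucc : ∀ n, st (pre h r (n + 1)) = stp i C h v T η (st (pre h r n)) (r.2 (h.2.length + n)) := fun n => by
      rw [pre_succ, st_snoc]
    by_cases hN : ∃ N, st (pre h r N) = none
    · obtain ⟨N, hN⟩ := hN
      filter_upwards [eventually_ge_atTop N] with n hn
      have : st (pre h r n) = none := by
        induction n, hn using Nat.le_induction with
        | base => exact hN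
        | succ n _ ih => rw [hsucc, ih]; rfl
      rw [this]
      have := (abs_le.1 (hC r)).2
      simp only [val, Option.elim_none]
      linarith
    · have hN' : ∀ n, ∃ p, st (pre h r n) = some (n, p) := by
        intro n
        cases hl : st (pre h r n) with
        | none => exact absurd ⟨n, hl⟩ hN
        | some q =>
          obtain ⟨k, p⟩ := q
          have := (inv _ _ _ hl).1
          rw [pre_length] at this
          subst this
          exact ⟨p, rfl⟩
      choose p hp using hN'
      have hag : ∀ n, BD.Agr (X := fun _ => Mv G) (2 * n) (p n) (p (n + 1)) := by
        intro n
        have h1 := hsucc n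
        rw [hp n, hp (n + 1)] at h1
        simp only [stp] at h1
        split_ifs at h1 with H
        have : p (n + 1) = nxt T n (p n) H.choose := by simpa using h1
        rw [this]
        exact nxt_agr _ _ _ _
      have hag2 : ∀ n m, n ≤ m → BD.Agr (X := fun _ => Mv G) (2 * n) (p n) (p m) := by
        intro n m hnm
        induction m, hnm using Nat.le_induction with
        | base => exact BD.Agr.refl _ _
        | succ m hm ih => exact ih.trans ((hag m).mono (by omega))
      let q : ℕ → Mv G := fun m => p (m + 1) m
      have hq : ∀ n, BD.Agr (X := fun _ => Mv G) (2 * n) (p n) q := by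
        intro n m hm
        rcases le_total n (m + 1) with h1 | h1
        · exact hag2 _ _ h1 m hm
        · exact (hag2 _ _ h1 m (by omega)).symm
      have hqf : BD.Fol 1 T 0 q := by
        intro m _ hm
        have h1 := (inv _ _ _ (hp (m + 1))).2.1.1 m (by omega) hm
        have h2 := T.loc _ _ _ ((hq (m + 1)).mono (show m ≤ 2 * (m + 1) by omega))
        exact h1.trans h2
      have hql : ∀ k, LegAt i C h v q k := fun k =>
        (LegAt_congr (hq (k + 1)) (by omega)).1 ((inv _ _ _ (hp (k + 1))).2.1.2 k (by omega))
      have hqr : rn h q = r := by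
        refine rn_eq hr fun j => ?_
        have h1 := (inv _ _ _ (hp (j + 1))).2.2
        rw [lst_congr (hq (j + 1)) le_rfl, lst_succ, pre_succ] at h1
        have := (List.append_inj' h1 rfl).2
        simpa using this.symm
      have hq3 := hT q hqf
      have hq4 : ¬ ∀ k : ℕ, ∃ᶠ n in atTop, xv v q n ≤ G.payoff i (rn h q) + 1 / ((k : ℝ) + 1) :=
        fun hh => hq3 ⟨hql, hh⟩
      push Not at hq4
      obtain ⟨k, hk⟩ := hq4
      rw [hqr] at hk
      filter_upwards [hk] with n hn
      rw [hp n]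
      simp only [val, Option.elim_some]
      rw [xv_congr (hq n) le_rfl]
      have : (0:ℝ) ≤ 1 / ((k:ℝ) + 1) := by positivity
      linarith

end StochGame

namespace StochGame
open Filter
variable {G : StochGame} {P : G.History → G.Profile → Measure G.Run}

/-- the value of the auxiliary game -/
noncomputable def Dv (i : G.I) (C : ℝ) (h : G.History) : ℝ := sSup {v | WinsI i C h v}

section
variable {i : G.I} {C : ℝ}

theorem winsI_neg (hC0 : 0 ≤ C) (hC : ∀ r, |G.payoff i r| ≤ C) (h : G.History) : WinsI i C h (-C) := by
  have hb : |(-C)| ≤ C + 1 := by rw [abs_neg, abs_of_nonneg hC0]; linarith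
  refine ⟨fun _ => -C, ⟨fun _ => hb, fun l => ⟨fun _ => hb, fun x => ⟨x i, by rw [oe_const]⟩⟩, fun r _ k =>
    Eventually.frequently (Eventually.of_forall fun n => ?_)⟩, rfl⟩
  have := (abs_le.1 (hC r)).1
  have : (0:ℝ) ≤ 1 / ((k:ℝ) + 1) := by positivity
  linarith

theorem winsI_abs {h : G.History} {v : ℝ} (H : WinsI i C h v) : |v| ≤ C + 1 := by
  obtain ⟨X, hX, rfl⟩ := H
  exact hX.1 []

theorem Dv_bddAbove (h : G.History) : BddAbove {v | WinsI i C h v} :=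
  ⟨C + 1, fun _ hv => (abs_le.1 (winsI_abs hv)).2⟩

theorem le_Dv {h : G.History} {v : ℝ} (H : WinsI i C h v) : v ≤ Dv i C h := le_csSup (Dv_bddAbove h) H

theorem Dv_le (hC0 : 0 ≤ C) (hC : ∀ r, |G.payoff i r| ≤ C) (h : G.History) : Dv i C h ≤ C + 1 :=
  csSup_le ⟨_, winsI_neg hC0 hC h⟩ fun _ hv => (abs_le.1 (winsI_abs hv)).2

theorem neg_le_Dv (hC0 : 0 ≤ C) (hC : ∀ r, |G.payoff i r| ≤ C) (h : G.History) : -C ≤ Dv i C h :=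
  le_Dv (winsI_neg hC0 hC h)

theorem exists_near_Dv (hC0 : 0 ≤ C) (hC : ∀ r, |G.payoff i r| ≤ C) (h : G.History) {θ : ℝ} (hθ : 0 < θ) :
    ∃ X, Cert i C h X ∧ Dv i C h - θ ≤ X [] := by
  obtain ⟨v, ⟨X, hX, rfl⟩, hv⟩ := exists_lt_of_lt_csSup (s := {v | WinsI i C h v}) ⟨_, winsI_neg hC0 hC h⟩
    (sub_lt_self (Dv i C h) hθ)
  exact ⟨X, hX, hv.le⟩

theorem Cert.le_Dv {h : G.History} {X : List (Zt G) → ℝ} (hX : Cert i C h X) (l : List (Zt G)) :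
    X l ≤ Dv i C (catH h l) := by
  refine StochGame.le_Dv ⟨fun l' => X (l ++ l'), ⟨fun _ => hX.1 _, fun l' => ?_, fun r hr k => ?_⟩, by simp⟩
  · rw [catH_catH]
    simpa [List.append_assoc] using hX.2.1 (l ++ l')
  · have hr' := mem_cyl_catH.1 hr
    have h1 := hX.2.2 r hr'.1 k
    rw [frequently_atTop] at h1 ⊢
    intro N
    obtain ⟨n, hn, h2⟩ := h1 (l.length + N)
    obtain ⟨m, rfl⟩ : ∃ m, n = l.length + m := ⟨n - l.length, by omega⟩
    refine ⟨m, by omega, ?_⟩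
    have : pre h r (l.length + m) = l ++ pre (catH h l) r m := by
      conv_rhs => rw [← hr'.2]
      simp [pre, List.range_add, catH, Function.comp_def, add_assoc]
    rwa [this] at h2

theorem punish_Dv (hP : IsInducedFamily G P) (hf : Measurable (G.payoff i)) (hC0 : 0 ≤ C)
    (hC : ∀ r, |G.payoff i r| ≤ C) (h : G.History) {η : ℝ} (hη : 0 < η) :
    ∃ σ : G.Profile, ∀ τ : G.Strategy i, ∫ r, G.payoff i r ∂(P h (Function.update σ i τ)) ≤ Dv i C h + η := by
  by_cases hc : Dv i C h + η / 2 ≤ C + 1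
  · have h1 : |Dv i C h + η / 2| ≤ C + 1 := abs_le.2 ⟨by linarith [neg_le_Dv hC0 hC h], hc⟩
    obtain ⟨σ, hσ⟩ := punish hP hf hC0 hC h h1 (fun hw => by have := StochGame.le_Dv hw; linarith) (half_pos hη)
    exact ⟨σ, fun τ => (hσ τ).trans (by linarith)⟩
  · refine ⟨fun _ _ => PMF.pure (Classical.arbitrary _), fun τ => ?_⟩
    have := (abs_le.1 (abs_integral_le hP h (Function.update (fun _ _ => PMF.pure (Classical.arbitrary _)) i τ) hC)).2
    linarith
end

/-! ### generalities -/

theorem exists_snocRec {Z α : Type*} (a : α) (step : List Z → Z → α → α) :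
    ∃ R : List Z → α, R [] = a ∧ ∀ l z, R (l ++ [z]) = step l z (R l) := by
  let F : List Z → List Z × α := fun l => l.foldl (fun q z => (q.1 ++ [z], step q.1 z q.2)) ([], a)
  have hF : ∀ l z, F (l ++ [z]) = ((F l).1 ++ [z], step (F l).1 z (F l).2) := fun l z => by
    simp [F, List.foldl_append]
  have h1 : ∀ l, (F l).1 = l := by
    intro l
    induction l using List.reverseRecOn with
    | nil => rfl
    | append_singleton l z ih => rw [hF, ih]
  exact ⟨fun l => (F l).2, rfl, fun l z => by simp only [hF, h1]⟩

theorem contProb_congr {σ τ : G.Profile} {h : G.History} (H : ∀ l i, σ i (catH h l) = τ i (catH h l))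
    (l : List (Zt G)) : contProb σ h l = contProb τ h l := by
  induction l generalizing h with
  | nil => rfl
  | cons z l ih =>
    rw [contProb_cons, contProb_cons, ih (fun l i => by rw [catH_cons]; exact H _ _)]
    have : (fun i => σ i h) = fun i => τ i h := funext fun i => by simpa using H [] i
    rw [this]

theorem P_congr (hP : IsInducedFamily G P) {σ τ : G.Profile} {h : G.History}
    (H : ∀ l i, σ i (catH h l) = τ i (catH h l)) : P h σ = P h τ := by
  have := hP.1
  refine measure_unique h _ _ (P_cyl_compl hP _ _) (P_cyl_compl hP _ _) fun l => ?_
  rw [hP.2, hP.2, contProb_congr H]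

/-! ### one step blame -/

noncomputable def Ex (x : ∀ i, PMF (G.A i)) (ψ : G.ActionProfile → ℝ) : ℝ :=
  ∑ a, (∏ i, (x i (a i)).toReal) * ψ a

noncomputable def avg (x : ∀ i, PMF (G.A i)) (k : G.I) (ψ : G.ActionProfile → ℝ) (a : G.ActionProfile) : ℝ :=
  ∑ c, (x k c).toReal * ψ (Function.update a k c)

theorem sum_pmf {α : Type*} [Fintype α] (p : PMF α) : ∑ c, (p c).toReal = 1 := by
  rw [← ENNReal.toReal_sum (fun a _ => PMF.apply_ne_top p a), ← tsum_fintype (L := .unconditional _), p.tsum_coe]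
  rfl

theorem Ex_one (x : ∀ i, PMF (G.A i)) : Ex x (fun _ => 1) = 1 := by
  have h := tsum_prod_pmf x
  have h2 := congrArg ENNReal.toReal h
  rw [ENNReal.toReal_sum (fun a _ => ENNReal.prod_ne_top fun i _ => PMF.apply_ne_top _ _)] at h2
  simpa [Ex, ENNReal.toReal_prod] using h2

theorem Ex_const (x : ∀ i, PMF (G.A i)) (c : ℝ) : Ex x (fun _ => c) = c := by
  have h := Ex_one x
  unfold Ex at *
  rw [← Finset.sum_mul]
  simp only [mul_one] at h
  rw [h, one_mul]

theorem Ex_avg {x x' : ∀ i, PMF (G.A i)} {k : G.I} (hk : x' k = x k) (ψ : G.ActionProfile → ℝ) :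
    Ex x' (avg x k ψ) = Ex x' ψ := by
  unfold Ex avg
  have e1 : ∀ a : G.ActionProfile, ∏ i, (x' i (a i)).toReal =
      (x' k (a k)).toReal * ∏ i ∈ Finset.univ.erase k, (x' i (a i)).toReal := fun a =>
    (Finset.mul_prod_erase _ _ (Finset.mem_univ k)).symm
  have e2 : ∀ (a : G.ActionProfile) c, ∏ i ∈ Finset.univ.erase k, (x' i (Function.update a k c i)).toReal =
      ∏ i ∈ Finset.univ.erase k, (x' i (a i)).toReal := fun a c =>
    Finset.prod_congr rfl fun i hi => by rw [Function.update_of_ne (Finset.ne_of_mem_erase hi)]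
  let e : (G.ActionProfile × G.A k) ≃ (G.ActionProfile × G.A k) :=
    Function.Involutive.toPerm (fun q => (Function.update q.1 k q.2, q.1 k)) fun q => by
      obtain ⟨a, c⟩ := q
      simp
  simp only [Finset.mul_sum]
  rw [← Fintype.sum_prod_type', ← Equiv.sum_comp e]
  have : ∀ q : G.ActionProfile × G.A k, (∏ i, (x' i ((e q).1 i)).toReal) *
      ((x k (e q).2).toReal * ψ (Function.update (e q).1 k (e q).2)) =
      (x' k q.2).toReal * ((∏ i, (x' i (q.1 i)).toReal) * ψ q.1) := by
    rintro ⟨a, c⟩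
    have : e (a, c) = (Function.update a k c, a k) := rfl
    rw [this]
    simp only
    rw [e1, e1, e2, hk]
    simp only [Function.update_self, Function.update_idem, Function.update_eq_self]
    ring
  simp only [this]
  rw [Fintype.sum_prod_type_right]
  simp only [← Finset.mul_sum]
  rw [← Finset.sum_mul, sum_pmf, one_mul]

theorem indep_const {m : G.ActionProfile → ℝ} (H : ∀ k a c, m (Function.update a k c) = m a) (a b : G.ActionProfile) :
    m b = m a := by
  have : ∀ s : Finset G.I, m (s.piecewise b a) = m a := by
    intro s
    induction s using Finset.induction_on with
    | empty => simp
    | insert k s hk ih =>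
      rw [← ih, ← H k (s.piecewise b a) (b k)]
      congr 1
      exact Finset.piecewise_insert _ _ _ _
  simpa using this Finset.univ

theorem avg_bounds (x : ∀ i, PMF (G.A i)) (k : G.I) {ψ : G.ActionProfile → ℝ} {δ K : ℝ}
    (hψ : ∀ a, δ ≤ ψ a ∧ ψ a ≤ K) (a : G.ActionProfile) : δ ≤ avg x k ψ a ∧ avg x k ψ a ≤ K := by
  unfold avg
  have h1 := sum_pmf (x k)
  constructor
  · calc δ = ∑ c, (x k c).toReal * δ := by rw [← Finset.sum_mul, h1, one_mul]
      _ ≤ _ := Finset.sum_le_sum fun c _ => mul_le_mul_of_nonneg_left (hψ _).1 ENNReal.toReal_nonneg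
  · calc _ ≤ ∑ c, (x k c).toReal * K :=
          Finset.sum_le_sum fun c _ => mul_le_mul_of_nonneg_left (hψ _).2 ENNReal.toReal_nonneg
      _ = K := by rw [← Finset.sum_mul, h1, one_mul]

theorem blame_profile (x : ∀ i, PMF (G.A i)) {Φ : G.ActionProfile → ℝ} {δ K : ℝ} (hδ : 0 < δ)
    (hΦ : ∀ a, δ ≤ Φ a ∧ Φ a ≤ K) (s : Finset G.I) :
    ∃ (m : G.ActionProfile → ℝ) (ρ : G.I → G.ActionProfile → ℝ),
      (∀ a, δ ≤ m a ∧ m a ≤ K) ∧ (∀ a, Φ a = m a * ∏ j ∈ s, ρ j a) ∧ (∀ j ∈ s, ∀ a, 0 ≤ ρ j a ∧ ρ j a ≤ K / δ) ∧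
      (∀ k ∈ s, ∀ a c, m (Function.update a k c) = m a) ∧ Ex x m = Ex x Φ ∧
      ∀ j ∈ s, ∀ x' : ∀ i, PMF (G.A i), x' j = x j → Ex x' (ρ j) = 1 := by
  induction s using Finset.induction_on with
  | empty => exact ⟨Φ, fun _ _ => 1, hΦ, by simp, by simp, by simp, rfl, by simp⟩
  | insert k s hk ih =>
    obtain ⟨m, ρ, h1, h2, h3, h4, h5, h6⟩ := ih
    have hb := avg_bounds x k h1
    have hm0 : ∀ a, avg x k m a ≠ 0 := fun a => (hδ.trans_le (hb a).1).ne'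
    have hki : ∀ a c, avg x k m (Function.update a k c) = avg x k m a := fun a c => by
      simp [avg]
    have hj : ∀ j ∈ s, j ≠ k := fun j hj e => hk (e ▸ hj)
    refine ⟨avg x k m, Function.update ρ k (fun a => m a / avg x k m a), hb, ?_, ?_, ?_, ?_, ?_⟩
    · intro a
      rw [Finset.prod_insert hk, Function.update_self, ← mul_assoc, mul_div_cancel₀ _ (hm0 a), h2 a]
      congr 1
      exact Finset.prod_congr rfl fun j hj' => by rw [Function.update_of_ne (hj j hj')]
    · intro j hjs a
      rcases Finset.mem_insert.1 hjs with rfl | hjs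
      · rw [Function.update_self]
        refine ⟨div_nonneg (hδ.le.trans (h1 a).1) (hδ.le.trans (hb a).1), ?_⟩
        exact div_le_div₀ ((hδ.le.trans (h1 a).1).trans (h1 a).2) (h1 a).2 hδ (hb a).1
      · rw [Function.update_of_ne (hj j hjs)]; exact h3 j hjs a
    · intro j hjs a c
      rcases Finset.mem_insert.1 hjs with rfl | hjs
      · exact hki a c
      · unfold avg
        refine Finset.sum_congr rfl fun b _ => ?_
        rw [Function.update_comm (hj j hjs), h4 j hjs]
    · rw [Ex_avg rfl, h5]
    · intro j hjs x' hx'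
      rcases Finset.mem_insert.1 hjs with rfl | hjs
      · rw [Function.update_self, ← Ex_avg hx', ← Ex_one x']
        congr 1
        funext a
        have : avg x j (fun a => m a / avg x j m a) a = avg x j m a / avg x j m a := by
          have e0 : ∀ f, avg x j f a = ∑ c, (x j c).toReal * f (Function.update a j c) := fun _ => rfl
          rw [e0]
          simp only [hki]
          rw [div_eq_mul_inv, e0 m, Finset.sum_mul]
          exact Finset.sum_congr rfl fun c _ => by rw [← e0 m, div_eq_mul_inv]; ring
        rw [this, div_self (hm0 a)]
      · rw [Function.update_of_ne (hj j hjs)]; exact h6 j hjs x' hx'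

theorem sum_trans (s : G.S) (a : G.ActionProfile) : HasSum (fun t => (G.trans s a t).toReal) 1 := by
  have h := (G.trans s a).tsum_coe
  have := ENNReal.hasSum_toReal (f := fun t => G.trans s a t) (by rw [h]; simp)
  rwa [← ENNReal.tsum_toReal_eq (fun t => PMF.apply_ne_top _ _), h] at this

theorem blame_step (x : ∀ i, PMF (G.A i)) (s : G.S) {φ : Zt G → ℝ} {δ K : ℝ} (hδ : 0 < δ)
    (hφ : ∀ z, δ ≤ φ z ∧ φ z ≤ K) :
    ∃ ρ : Option G.I → Zt G → ℝ, (∀ j z, 0 ≤ ρ j z ∧ ρ j z ≤ K / δ) ∧ (∀ z, φ z = oe x s φ * ∏ j, ρ j z) ∧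
      ∀ (i : G.I) (j : Option G.I), j ≠ some i → ∀ y : PMF (G.A i), oe (Function.update x i y) s (ρ j) = 1 := by
  have habs : ∀ z, |φ z| ≤ K := fun z => abs_le.2 ⟨by linarith [(hφ z).1, (hφ z).2], (hφ z).2⟩
  let Φ : G.ActionProfile → ℝ := fun a => ∑' t, (G.trans s a t).toReal * φ (a, t)
  have hsum : ∀ a, Summable fun t => (G.trans s a t).toReal * φ (a, t) := fun a => by
    refine Summable.of_norm_bounded ((sum_trans s a).summable.mul_right K) fun t => ?_
    rw [norm_mul, Real.norm_of_nonneg ENNReal.toReal_nonneg]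
    exact mul_le_mul_of_nonneg_left (habs _) ENNReal.toReal_nonneg
  have hΦ : ∀ a, δ ≤ Φ a ∧ Φ a ≤ K := by
    intro a
    have hc : ∀ c : ℝ, ∑' t, (G.trans s a t).toReal * c = c := fun c => by
      rw [tsum_mul_right, (sum_trans s a).tsum_eq, one_mul]
    constructor
    · rw [← hc δ]
      exact Summable.tsum_le_tsum (fun t => mul_le_mul_of_nonneg_left (hφ _).1 ENNReal.toReal_nonneg)
        ((sum_trans s a).summable.mul_right _) (hsum a)
    · conv_rhs => rw [← hc K]
      exact Summable.tsum_le_tsum (fun t => mul_le_mul_of_nonneg_left (hφ _).2 ENNReal.toReal_nonneg)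
        (hsum a) ((sum_trans s a).summable.mul_right _)
  have hoe : oe x s φ = Ex x Φ := oe_eq x s habs
  obtain ⟨m, ρ, h1, h2, h3, h4, h5, h6⟩ := blame_profile x hδ hΦ Finset.univ
  have hmc : ∀ a, m a = oe x s φ := by
    intro a
    rw [hoe, ← h5]
    have : m = fun _ => m a := funext fun b => indep_const (fun k a c => h4 k (Finset.mem_univ _) a c) a b
    rw [this, Ex_const]
  have hK : 0 ≤ K / δ := by
    have := hφ (Classical.arbitrary _)
    exact div_nonneg (by linarith) hδ.le
  have hbd : ∀ j z, 0 ≤ (Option.elim j (φ z / Φ z.1) (fun i => ρ i z.1)) ∧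
      (Option.elim j (φ z / Φ z.1) (fun i => ρ i z.1)) ≤ K / δ := by
    intro j z
    cases j with
    | none => exact ⟨div_nonneg (hδ.le.trans (hφ z).1) (hδ.le.trans (hΦ _).1),
        div_le_div₀ ((hδ.le.trans (hφ z).1).trans (hφ z).2) (hφ z).2 hδ (hΦ _).1⟩
    | some j => exact h3 j (Finset.mem_univ _) z.1
  refine ⟨fun j z => Option.elim j (φ z / Φ z.1) (fun i => ρ i z.1), hbd, ?_, ?_⟩
  · intro z
    rw [Fintype.prod_option]
    simp only [Option.elim_none, Option.elim_some]
    rw [← hmc z.1, mul_left_comm, ← h2 z.1, div_mul_cancel₀ _ (hδ.trans_le (hΦ z.1).1).ne']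
  · intro i j hj y
    have hab : ∀ z, |Option.elim j (φ z / Φ z.1) (fun i => ρ i z.1)| ≤ K / δ := fun z => by
      rw [abs_of_nonneg (hbd j z).1]; exact (hbd j z).2
    rw [oe_eq _ _ hab]
    cases j with
    | none =>
      simp only [Option.elim_none]
      have : ∀ a, ∑' t, (G.trans s a t).toReal * (φ (a, t) / Φ a) = 1 := by
        intro a
        have e : ∀ t, (G.trans s a t).toReal * (φ (a, t) / Φ a) = (G.trans s a t).toReal * φ (a, t) * (Φ a)⁻¹ :=
          fun t => by rw [div_eq_mul_inv]; ring
        simp only [e]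
        rw [tsum_mul_right]
        exact mul_inv_cancel₀ (hδ.trans_le (hΦ a).1).ne'
      simp only [this]
      exact Ex_one _
    | some j =>
      simp only [Option.elim_some]
      have : ∀ a, ∑' t, (G.trans s a t).toReal * ρ j a = ρ j a := fun a => by
        rw [tsum_mul_right, (sum_trans s a).tsum_eq, one_mul]
      simp only [this]
      refine h6 j (Finset.mem_univ _) _ ?_
      rw [Function.update_of_ne]
      exact fun e => hj (by rw [e])

end StochGame

namespace StochGame
open Filter
variable {G : StochGame} {P : G.History → G.Profile → Measure G.Run}

theorem oe_sum (x : ∀ i, PMF (G.A i)) (s : G.S) {ι : Type*} (t : Finset ι) (f : ι → Zt G → ℝ) {C : ℝ}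
    (hf : ∀ j z, |f j z| ≤ C) : oe x s (fun z => ∑ j ∈ t, f j z) = ∑ j ∈ t, oe x s (f j) := by
  induction t using Finset.induction_on with
  | empty => simp [oe_const]
  | insert j t hj ih =>
    simp only [Finset.sum_insert hj]
    rw [oe_add x s (hf j) (C' := ∑ _j ∈ t, C), ih]
    intro z
    exact (Finset.abs_sum_le_sum_abs _ _).trans (Finset.sum_le_sum fun k _ => hf k z)

theorem integral_real_step (hP : IsInducedFamily G P) (h : G.History) (σ : G.Profile) {U : Set G.Run}
    (hU : MeasurableSet U) : (P h σ).real U = oe (fun i => σ i h) (lastState h)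
      (fun z => (P (catH h [z]) σ).real U) := by
  have h1 := integral_step hP h σ (F := U.indicator 1) (measurable_one.indicator hU) (C := 1) (fun r => by
    by_cases hr : r ∈ U <;> simp [hr])
  simpa only [integral_indicator_one hU] using h1

/-- minimal elements of `B` -/
def MinB (B : List (Zt G) → Prop) (e : List (Zt G)) : Prop := B e ∧ ∀ l', l' <+: e → l' ≠ e → ¬ B l'

theorem MinB.unique {B : List (Zt G) → Prop} {e e' l l' : List (Zt G)} (he : MinB B e) (he' : MinB B e')
    (h : e ++ l = e' ++ l') : e = e' := by
  have h1 : e <+: e ++ l := List.prefix_append _ _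
  have h2 : e' <+: e ++ l := h ▸ List.prefix_append _ _
  rcases List.prefix_or_prefix_of_prefix h1 h2 with h3 | h3
  · by_contra hne; exact he'.2 e h3 hne he.1
  · by_contra hne; exact he.2 e' h3 (Ne.symm hne) he'.1

theorem solve_at (hP : IsInducedFamily G P) (hfm : ∀ i, Measurable (G.payoff i)) {C : ℝ} (hC0 : 0 ≤ C)
    (hC : ∀ i r, |G.payoff i r| ≤ C) {κ δ t C2 : ℝ} (hκ : 0 < κ) (hδ : 0 < δ) (ht : 1 ≤ t)
    (hδt : 2 * δ * t ^ (Fintype.card (Option G.I)) < 1) (h1 : G.History) (σ : G.Profile) {U : Set G.Run}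
    (hU : MeasurableSet U) (hUo : ∀ r ∈ U, r ∈ cyl h1 → ∃ n, cyl (catH h1 (pre h1 r n)) ⊆ U)
    (hPU : (P h1 σ).real U ≤ δ) (W : G.I → List (Zt G) → ℝ) (d c : G.I → ℝ)
    (hWb : ∀ i l, |W i l| ≤ C2)
    (hWs : ∀ i l, NP (fun l => cyl (catH h1 l) ⊆ U) l → ∀ y : PMF (G.A i),
      oe (Function.update (fun j => σ j (catH h1 l)) i y) (lastState (catH h1 l)) (fun z => W i (l ++ [z])) ≤ W i l)
    (hWd : ∀ i l, NP (fun l => cyl (catH h1 l) ⊆ U) l → d i - κ ≤ W i l)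
    (hW0 : ∀ i, W i [] ≤ d i + κ)
    (hWD : ∀ i e, MinB (fun l => cyl (catH h1 l) ⊆ U) e → Dv i C (catH h1 e) ≤ W i e + 3 * κ)
    (hcf : ∀ i, ∀ r ∈ cyl h1, r ∉ U → c i ≤ G.payoff i r ∧ G.payoff i r ≤ c i + κ)
    (hdc : ∀ i, d i ≤ c i + κ) (hcb : ∀ i, |c i| ≤ C + 1) :
    ∃ σhat : G.Profile, ∀ (i : G.I) (τ : G.Strategy i),
      ∫ r, G.payoff i r ∂(P h1 (Function.update σhat i τ)) ≤ ∫ r, G.payoff i r ∂(P h1 σhat) +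
        (6 * κ + (C + C2) * (Fintype.card (Option G.I) / t) + (2 * C + 1) * δ) := by
  have := hP.1
  set B : List (Zt G) → Prop := fun l => cyl (catH h1 l) ⊆ U with hB
  have hC2 : 0 ≤ C2 := (abs_nonneg _).trans (hWb (Classical.arbitrary _) [])
  have ht0 : 0 < t := by linarith
  let M : List (Zt G) → ℝ := fun l => (P (catH h1 l) σ).real U + δ
  have hMb : ∀ l, δ ≤ M l ∧ M l ≤ 1 + δ := fun l => by
    have h2 : 0 ≤ (P (catH h1 l) σ).real U := measureReal_nonneg
    have h3 : (P (catH h1 l) σ).real U ≤ 1 := measureReal_le_one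
    exact ⟨by simp only [M]; linarith, by simp only [M]; linarith⟩
  have hMm : ∀ l, oe (fun j => σ j (catH h1 l)) (lastState (catH h1 l)) (fun z => M (l ++ [z])) = M l := by
    intro l
    simp only [M]
    have hb : ∀ z : Zt G, |(P (catH h1 (l ++ [z])) σ).real U| ≤ 1 := by
      intro z
      rw [abs_of_nonneg measureReal_nonneg]; exact measureReal_le_one
    rw [oe_add_const _ _ hb, integral_real_step hP (catH h1 l) σ hU]
    simp only [catH_catH]
  have hMB : ∀ e, B e → M e = 1 + δ := by
    intro e he
    have : P (catH h1 e) σ U = 1 := le_antisymm prob_le_one (by rw [← P_cyl hP (catH h1 e) σ]; exact measure_mono he)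
    simp [M, Measure.real, this]
  have hM0 : M [] ≤ 2 * δ := by simp only [M, catH_nil]; linarith
  -- wealth processes
  choose ρ hρb hρp hρe using fun l => blame_step (fun j => σ j (catH h1 l)) (lastState (catH h1 l))
    (φ := fun z => M (l ++ [z])) hδ (fun z => hMb (l ++ [z]))
  obtain ⟨R, hR0, hRs⟩ := exists_snocRec (fun _ : Option G.I => (1 : ℝ)) (fun l z R j => R j * ρ l j z)
  have hRnn : ∀ l j, 0 ≤ R l j := by
    intro l
    induction l using List.reverseRecOn with
    | nil => intro j; rw [hR0]; exact zero_le_one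
    | append_singleton l z ih => intro j; rw [hRs]; exact mul_nonneg (ih j) (hρb l j z).1
  have hRM : ∀ l, M [] * ∏ j, R l j = M l := by
    intro l
    induction l using List.reverseRecOn with
    | nil => rw [hR0]; simp
    | append_singleton l z ih =>
      rw [hRs, Finset.prod_mul_distrib, ← mul_assoc, ih, hρp l z, hMm]
  have hbl : ∀ e, ∃ j, B e → t ≤ R e j := by
    intro e
    by_contra hn
    push Not at hn
    have he : B e := (hn none).1
    have h2 : ∏ j, R e j ≤ t ^ (Fintype.card (Option G.I)) := by
      calc ∏ j, R e j ≤ ∏ _j : Option G.I, t := Finset.prod_le_prod (fun j _ => hRnn e j) (fun j _ => (hn j).2.le)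
        _ = _ := by simp
    have h3 := hRM e
    rw [hMB e he] at h3
    have h4 : M [] * ∏ j, R e j ≤ 2 * δ * t ^ (Fintype.card (Option G.I)) :=
      mul_le_mul hM0 h2 (Finset.prod_nonneg fun j _ => hRnn e j) (by linarith)
    linarith
  choose b hb using hbl
  have hpi : ∀ e, ∃ π : G.Profile, ∀ i, b e = some i → ∀ τ : G.Strategy i,
      ∫ r, G.payoff i r ∂(P (catH h1 e) (Function.update π i τ)) ≤ Dv i C (catH h1 e) + κ := by
    intro e
    cases hbe : b e with
    | none => exact ⟨σ, by simp⟩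
    | some j =>
      obtain ⟨π, hπ⟩ := punish_Dv hP (hfm j) hC0 (hC j) (catH h1 e) hκ
      refine ⟨π, fun i hi => ?_⟩
      obtain rfl : j = i := by simpa using hi
      exact hπ
  choose π hπ using hpi
  let σhat : G.Profile := fun j g => if H : ∃ e l', g = catH h1 (e ++ l') ∧ MinB B e then π H.choose j g else σ j g
  have hs1 : ∀ l j, NP B l → σhat j (catH h1 l) = σ j (catH h1 l) := by
    intro l j hl
    simp only [σhat]
    rw [dif_neg]
    rintro ⟨e, l', h2, h3⟩
    rw [catH_inj h2] at hl
    exact hl e (List.prefix_append _ _) h3.1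
  have hs2 : ∀ e l j, MinB B e → σhat j (catH h1 (e ++ l)) = π e j (catH h1 (e ++ l)) := by
    intro e l j he
    have H : ∃ e' l', catH h1 (e ++ l) = catH h1 (e' ++ l') ∧ MinB B e' := ⟨e, l, rfl, he⟩
    simp only [σhat]
    rw [dif_pos H]
    obtain ⟨l', h2, h3⟩ := H.choose_spec
    have e' : H.choose = e := (he.unique h3 (catH_inj h2)).symm
    exact congrArg (fun e0 => π e0 j (catH h1 (e ++ l))) e'
  have hnU : ∀ r ∈ cyl h1, (∀ n, ¬ B (pre h1 r n)) → r ∉ U := by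
    intro r hr hn hrU
    obtain ⟨n, hn'⟩ := hUo r hrU hr
    exact hn n hn'
  have hNP : ∀ r : G.Run, (∀ n, ¬ B (pre h1 r n)) → ∀ n, NP B (pre h1 r n) := by
    intro r hn n l' hl'
    rw [prefix_pre hl']
    exact hn _
  refine ⟨σhat, fun i τ => ?_⟩
  -- deviation payoff
  have hdev : ∫ r, G.payoff i r ∂(P h1 (Function.update σhat i τ)) ≤
      c i + 6 * κ + (C + C2) * (Fintype.card (Option G.I) / t) := by
    let K : ℝ := c i - d i + 5 * κ
    have hK : 4 * κ ≤ K := by have := hdc i; simp only [K]; linarith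
    let mn : Option G.I → List (Zt G) → ℝ := fun j l => min 1 (R l j / t)
    have hmn : ∀ j l, 0 ≤ mn j l ∧ mn j l ≤ 1 := fun j l =>
      ⟨le_min zero_le_one (div_nonneg (hRnn l j) ht0.le), min_le_left _ _⟩
    have hmna : ∀ j l, |mn j l| ≤ 1 := fun j l => by rw [abs_of_nonneg (hmn j l).1]; exact (hmn j l).2
    let E : Finset (Option G.I) := Finset.univ.erase (some i)
    let Sm : List (Zt G) → ℝ := fun l => ∑ j ∈ E, mn j l
    have hSm : ∀ l, 0 ≤ Sm l ∧ |Sm l| ≤ E.card := fun l =>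
      ⟨Finset.sum_nonneg fun j _ => (hmn j l).1, (Finset.abs_sum_le_sum_abs _ _).trans
        ((Finset.sum_le_sum fun j _ => hmna j l).trans (by simp))⟩
    let V : List (Zt G) → ℝ := fun l => (W i l + K) + (C + C2) * Sm l
    have hWK : ∀ l, |W i l + K| ≤ C2 + |K| := fun l => (abs_add_le _ _).trans (by linarith [hWb i l])
    have hSmC : ∀ l, |(C + C2) * Sm l| ≤ (C + C2) * E.card := fun l => by
      rw [abs_mul, abs_of_nonneg (by linarith : 0 ≤ C + C2)]
      exact mul_le_mul_of_nonneg_left (hSm l).2 (by linarith)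
    have main := optStopping hP (Function.update σhat i τ) (hfm i) (hC i) h1 V B
      (C' := (C2 + |K|) + (C + C2) * E.card) (fun l => (abs_add_le _ _).trans (add_le_add (hWK l) (hSmC l))) ?_ ?_ ?_
    · refine main.trans ?_
      have h2 : Sm [] ≤ Fintype.card (Option G.I) / t := by
        calc Sm [] ≤ ∑ j ∈ E, 1 / t := Finset.sum_le_sum fun j _ => by
              simp only [mn, hR0]; exact min_le_right _ _
          _ ≤ ∑ j : Option G.I, 1 / t := Finset.sum_le_sum_of_subset_of_nonneg (Finset.erase_subset _ _)
              (fun _ _ _ => by positivity)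
          _ = _ := by simp [div_eq_mul_inv]
      have h3 := mul_le_mul_of_nonneg_left h2 (by linarith : 0 ≤ C + C2)
      have h4 := hW0 i
      simp only [V, K]
      linarith
    · intro l hl
      have hup : (fun j => Function.update σhat i τ j (catH h1 l)) =
          Function.update (fun j => σ j (catH h1 l)) i (τ (catH h1 l)) := by
        funext j
        by_cases hj : j = i
        · subst hj; simp
        · simp [hj, hs1 l j hl]
      rw [hup]
      set x := Function.update (fun j => σ j (catH h1 l)) i (τ (catH h1 l)) with hx
      simp only [V]
      rw [oe_add _ _ (fun z => hWK _) (fun z => hSmC _), oe_add_const _ _ (fun z => hWb i _), oe_smul]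
      have h2 := hWs i l hl (τ (catH h1 l))
      have h3 : oe x (lastState (catH h1 l)) (fun z => Sm (l ++ [z])) ≤ Sm l := by
        simp only [Sm]
        rw [oe_sum _ _ _ _ (fun j z => hmna j (l ++ [z]))]
        refine Finset.sum_le_sum fun j hj => ?_
        have hj' : j ≠ some i := Finset.ne_of_mem_erase hj
        refine le_min (oe_le _ _ (fun z => hmna j _) fun z => (hmn j _).2) ?_
        calc oe x (lastState (catH h1 l)) (fun z => mn j (l ++ [z]))
            ≤ oe x (lastState (catH h1 l)) (fun z => R l j / t * ρ l j z) := by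
              refine oe_mono (C' := R l j / t * ((1 + δ) / δ)) _ _ (fun z => hmna j _) (fun z => ?_) fun z => ?_
              · rw [abs_mul, abs_of_nonneg (div_nonneg (hRnn l j) ht0.le), abs_of_nonneg (hρb l j z).1]
                exact mul_le_mul_of_nonneg_left (hρb l j z).2 (div_nonneg (hRnn l j) ht0.le)
              · refine (min_le_right _ _).trans (le_of_eq ?_)
                rw [hRs]; ring
          _ = R l j / t := by rw [oe_smul, hρe l i j hj', mul_one]
      have h4 := mul_le_mul_of_nonneg_left h3 (by linarith : 0 ≤ C + C2)
      linarith
    · intro e he hmin _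
      have heB : MinB B e := ⟨he, hmin⟩
      have hPe : P (catH h1 e) (Function.update σhat i τ) = P (catH h1 e) (Function.update (π e) i τ) := by
        refine P_congr hP fun l j => ?_
        by_cases hj : j = i
        · subst hj; simp
        · simp only [Function.update_of_ne hj, catH_catH]
          exact hs2 e l j heB
      have h0 := mul_nonneg (by linarith : 0 ≤ C + C2) (hSm e).1
      by_cases hbi : b e = some i
      · rw [hPe]
        have h2 := hπ e i hbi τ
        have h3 := hWD i e heB
        simp only [V]
        linarith
      · have h2 := (abs_le.1 (abs_integral_le hP (catH h1 e) (Function.update σhat i τ) (hC i))).2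
        have h3 : 1 ≤ Sm e := by
          have h4 : mn (b e) e ≤ Sm e := Finset.single_le_sum (f := fun j => mn j e) (fun j _ => (hmn j e).1)
            (Finset.mem_erase.2 ⟨hbi, Finset.mem_univ _⟩)
          refine le_trans (le_min le_rfl ?_) h4
          rw [le_div_iff₀ ht0, one_mul]
          exact hb e he
        have h4 := mul_le_mul_of_nonneg_left h3 (by linarith : 0 ≤ C + C2)
        have h5 := (abs_le.1 (hWb i e)).1
        simp only [V]
        linarith
    · intro r hr hn η hη
      refine Eventually.of_forall fun n => ?_
      have h2 := (hcf i r hr (hnU r hr hn)).2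
      have h3 := hWd i _ (hNP r hn n)
      have h0 := mul_nonneg (by linarith : 0 ≤ C + C2) (hSm (pre h1 r n)).1
      simp only [V, K]
      linarith
  -- equilibrium payoff
  have heq : c i - (2 * C + 1) * δ ≤ ∫ r, G.payoff i r ∂(P h1 σhat) := by
    let V : List (Zt G) → ℝ := fun l => (2 * C + 1) * M l + (-c i - (2 * C + 1) * δ)
    have hMa : ∀ l, |(2 * C + 1) * M l| ≤ (2 * C + 1) * (1 + δ) := fun l => by
      rw [abs_of_nonneg (mul_nonneg (by linarith) (hδ.le.trans (hMb l).1))]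
      exact mul_le_mul_of_nonneg_left (hMb l).2 (by linarith)
    have main := optStopping hP σhat (hfm i).neg (C := C) (fun r => by simpa using hC i r) h1 V B
      (C' := (2 * C + 1) * (1 + δ) + |(-c i - (2 * C + 1) * δ)|)
      (fun l => (abs_add_le _ _).trans (by linarith [hMa l])) ?_ ?_ ?_
    · simp only [Pi.neg_apply] at main
      rw [integral_neg] at main
      have h2 : (2 * C + 1) * M [] ≤ (2 * C + 1) * (2 * δ) := mul_le_mul_of_nonneg_left hM0 (by linarith)
      simp only [V] at main
      linarith
    · intro l hl
      have hup : (fun j => σhat j (catH h1 l)) = fun j => σ j (catH h1 l) := funext fun j => hs1 l j hl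
      rw [hup]
      simp only [V]
      rw [oe_add_const _ _ (fun z => hMa _), oe_smul, hMm]
    · intro e he _ _
      have h2 := (abs_le.1 (abs_integral_le hP (catH h1 e) σhat (hC i))).1
      have h3 := (abs_le.1 (hcb i)).2
      simp only [V, Pi.neg_apply]
      rw [hMB e he, integral_neg]
      linarith
    · intro r hr hn η hη
      refine Eventually.of_forall fun n => ?_
      have h2 := (hcf i r hr (hnU r hr hn)).1
      have h3 := mul_le_mul_of_nonneg_left (hMb (pre h1 r n)).1 (by linarith : 0 ≤ 2 * C + 1)
      simp only [V, Pi.neg_apply]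
      linarith
  linarith

end StochGame

namespace StochGame
open Filter
variable {G : StochGame} {P : G.History → G.Profile → Measure G.Run}

/-! ### open approximations and density points -/

theorem open_nhd_aux (μ : Measure G.Run) [IsFiniteMeasure μ] {Q : Set G.Run} (hQ : MeasurableSet Q) {η : ℝ≥0∞} (hη : η ≠ 0) :
    ∃ U, Q ⊆ U ∧ MeasurableSet U ∧ μ U ≤ μ Q + η ∧
      ∀ r ∈ U, ∃ m, ∀ r' : G.Run, r'.1 = r.1 → (∀ k < m, r'.2 k = r.2 k) → r' ∈ U := by
  letI : TopologicalSpace G.S := ⊥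
  letI : TopologicalSpace (∀ i, G.A i) := ⊥
  haveI : DiscreteTopology G.S := ⟨rfl⟩
  haveI : DiscreteTopology (∀ i, G.A i) := ⟨rfl⟩
  haveI : BorelSpace G.S := ⟨by rw [borel_eq_top_of_discrete]; rfl⟩
  haveI : BorelSpace (∀ i, G.A i) := ⟨by rw [borel_eq_top_of_discrete]; rfl⟩
  obtain ⟨U, h1, h2, h3⟩ := Q.exists_isOpen_le_add μ hη
  refine ⟨U, h1, h2.measurableSet, h3, fun r hr => ?_⟩
  obtain ⟨u, v, hu, hv, hru, hrv, huv⟩ := isOpen_prod_iff.1 h2 r.1 r.2 hr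
  obtain ⟨I, w, hw, hIw⟩ := isOpen_pi_iff.1 hv r.2 hrv
  refine ⟨I.sup id + 1, fun r' h4 h5 => huv ⟨by rw [h4]; exact hru, hIw fun k hk => ?_⟩⟩
  rw [h5 k (Nat.lt_succ_of_le (Finset.le_sup (f := id) hk))]
  exact (hw k hk).2

theorem open_nhd (μ : Measure G.Run) [IsFiniteMeasure μ] {Q : Set G.Run} (hQ : MeasurableSet Q) {η : ℝ≥0∞} (hη : η ≠ 0) :
    ∃ U, Q ⊆ U ∧ MeasurableSet U ∧ μ U ≤ μ Q + η ∧
      ∀ h, ∀ r ∈ U, r ∈ cyl h → ∀ N, ∃ n, N ≤ n ∧ cyl (catH h (pre h r n)) ⊆ U := by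
  obtain ⟨U, h1, h2, h3, h4⟩ := open_nhd_aux μ hQ hη
  refine ⟨U, h1, h2, h3, fun h r hr hrh N => ?_⟩
  obtain ⟨m, hm⟩ := h4 r hr
  refine ⟨max N m, le_max_left _ _, fun r' hr' => ?_⟩
  have hc := mem_cyl_pre hrh (max N m)
  refine hm r' (hr'.1.trans hc.1.symm) fun k hk => ?_
  have hk' : k < (catH h (pre h r (max N m))).2.length := by
    have := le_max_right N m
    simp only [catH, List.length_append, pre_length]; omega
  exact (hr'.2 k hk').trans (hc.2 k hk').symm

theorem density (hP : IsInducedFamily G P) (σ : G.Profile) (h : G.History) {Q : Set G.Run} (hQ : MeasurableSet Q)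
    (hpos : P h σ Q ≠ 0) {δ : ℝ} (hδ : 0 < δ) (hδ1 : δ < 1) (N : ℕ) :
    ∃ l, contProb σ h l ≠ 0 ∧ N ≤ l.length ∧ (P (catH h l) σ).real Qᶜ < δ := by
  have := hP.1
  by_contra hn
  push Not at hn
  have hp : 0 < (P h σ).real Q := ENNReal.toReal_pos hpos (measure_ne_top _ _)
  have hη : 0 < δ * (P h σ).real Q := mul_pos hδ hp
  obtain ⟨U, hQU, hU, hUP, hUo⟩ := open_nhd (P h σ) hQ (η := ENNReal.ofReal (δ * (P h σ).real Q))
    (by simpa using hη)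
  have hUP' : (P h σ).real U ≤ (P h σ).real Q + δ * (P h σ).real Q := by
    have := ENNReal.toReal_mono (by simp) hUP
    rwa [ENNReal.toReal_add (measure_ne_top _ _) (by simp), ENNReal.toReal_ofReal hη.le] at this
  let F : G.Run → ℝ := fun r => Q.indicator 1 r - (1 - δ) * U.indicator 1 r
  have hmQ : Measurable (Q.indicator (1 : G.Run → ℝ)) := measurable_one.indicator hQ
  have hmU : Measurable (U.indicator (1 : G.Run → ℝ)) := measurable_one.indicator hU
  have hF : Measurable F := hmQ.sub (hmU.const_mul _)
  have hbd : ∀ (S : Set G.Run) r, |S.indicator (1 : G.Run → ℝ) r| ≤ 1 := fun S r => by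
    by_cases hr : r ∈ S <;> simp [hr]
  have hFC : ∀ r, |F r| ≤ 2 := fun r => by
    have h1 := abs_le.1 (hbd Q r)
    have h2 : |(1 - δ) * U.indicator (1 : G.Run → ℝ) r| ≤ 1 := by
      rw [abs_mul, abs_of_nonneg (by linarith : 0 ≤ 1 - δ)]
      nlinarith [hbd U r, abs_nonneg (U.indicator (1 : G.Run → ℝ) r)]
    exact (abs_sub _ _).trans (by linarith [hbd Q r])
  have hintg : ∀ g, ∫ r, F r ∂(P g σ) = (P g σ).real Q - (1 - δ) * (P g σ).real U := by
    intro g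
    simp only [F]
    rw [integral_sub (integrable_bdd hP g σ hmQ (hbd Q)) ((integrable_bdd hP g σ hmU (hbd U)).const_mul _),
      integral_const_mul, integral_indicator_one hQ, integral_indicator_one hU]
  have main := optStopping hP σ hF hFC h (fun _ => 0) (fun l => N ≤ l.length ∧ cyl (catH h l) ⊆ U) (C' := 0) (by simp)
    (by intro l _; rw [oe_const]) ?_ ?_
  · rw [hintg] at main
    nlinarith
  · rintro e ⟨he1, he2⟩ _ he3
    rw [hintg]
    have h1 := hn e he3 he1
    have h2 : P (catH h e) σ U = 1 := le_antisymm prob_le_one (by rw [← P_cyl hP (catH h e) σ]; exact measure_mono he2)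
    have h3 : (P (catH h e) σ).real U = 1 := by simp [Measure.real, h2]
    rw [probReal_compl_eq_one_sub hQ] at h1
    rw [h3]; linarith
  · intro r hr hB η hη
    have hrU : r ∉ U := by
      intro hrU
      obtain ⟨n, hn1, hn2⟩ := hUo h r hrU hr N
      exact hB n ⟨by simpa using hn1, hn2⟩
    have hrQ : r ∉ Q := fun hq => hrU (hQU hq)
    refine Eventually.of_forall fun n => ?_
    simp [F, hrU, hrQ, hη.le]

/-! ### bounded submartingales -/

theorem submart (hP : IsInducedFamily G P) (σ : G.Profile) (h : G.History) (Y : List (Zt G) → ℝ) {K : ℝ}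
    (hK : ∀ l, |Y l| ≤ K)
    (hY : ∀ l, Y l ≤ oe (fun i => σ i (catH h l)) (lastState (catH h l)) (fun z => Y (l ++ [z]))) :
    ∀ᵐ r ∂(P h σ), ∃ c, Tendsto (fun n => Y (pre h r n)) atTop (nhds c) := by
  have := hP.1
  have hle : ∀ n, MeasurableSpace.comap (fun r : G.Run => pre h r n) ⊤ ≤ (inferInstance : MeasurableSpace G.Run) :=
    fun n => (measurable_pre h n).comap_le
  let ℱ : Filtration ℕ (inferInstance : MeasurableSpace G.Run) :=
    { seq := fun n => MeasurableSpace.comap (fun r : G.Run => pre h r n) ⊤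
      mono' := by
        rintro n m hnm s ⟨T, _, rfl⟩
        refine ⟨{l | l.take n ∈ T}, trivial, ?_⟩
        ext r
        simp [pre_take h r hnm]
      le' := hle }
  have hsub : Submartingale (fun n r => Y (pre h r n)) ℱ (P h σ) := by
    refine submartingale_of_setIntegral_le_succ ?_ ?_ ?_
    · intro n
      refine Measurable.stronglyMeasurable ?_
      intro s _
      exact ⟨Y ⁻¹' s, trivial, rfl⟩
    · exact fun n => integrable_bdd hP h σ (measurable_pre_fun h n Y) (fun r => hK _)
    · rintro n s ⟨T, _, rfl⟩
      have hm : MeasurableSet ((fun r : G.Run => pre h r n) ⁻¹' T) := measurable_pre h n (t := T) trivial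
      rw [← integral_indicator hm, ← integral_indicator hm]
      let V : List (Zt G) → ℝ := fun l => if l.take n ∈ T then Y l else 0
      have hK0 : 0 ≤ K := (abs_nonneg _).trans (hK [])
      have hV : ∀ l, |V l| ≤ K := fun l => by
        simp only [V]; split_ifs
        · exact hK l
        · simpa using hK0
      have h1 := integral_pre_succ hP σ n h V hV
      have h2 : (fun r => ((fun r : G.Run => pre h r n) ⁻¹' T).indicator (fun r => Y (pre h r (n + 1))) r) =
          fun r => V (pre h r (n + 1)) := by
        funext r
        simp only [V, Set.indicator_apply, Set.mem_preimage, pre_take h r (Nat.le_succ n)]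
      rw [h2, h1]
      refine integral_mono ?_ ?_ ?_
      · exact (integrable_bdd hP h σ (measurable_pre_fun h n Y) (fun r => hK _)).indicator hm
      · exact integrable_bdd hP h σ (measurable_pre_fun h n (fun l => oe (fun i => σ i (catH h l))
          (lastState (catH h l)) fun z => V (l ++ [z]))) (fun r => abs_oe_le _ _ fun z => hV _)
      · intro r
        have h3 : ∀ z, V (pre h r n ++ [z]) = if pre h r n ∈ T then Y (pre h r n ++ [z]) else 0 := by
          intro z
          simp only [V]
          rw [List.take_left' (pre_length h r n)]
        simp only [Set.indicator_apply, Set.mem_preimage, h3]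
        split_ifs with hT
        · exact hY _
        · rw [oe_const]
  refine hsub.exists_ae_tendsto_of_bdd (R := K.toNNReal) fun n => ?_
  refine (eLpNorm_le_of_ae_bound (C := K) (Eventually.of_forall fun r => hK _)).trans ?_
  simp [ENNReal.ofReal]

theorem submart_sum (hP : IsInducedFamily G P) (σ : G.Profile) (h : G.History) (Y : List (Zt G) → ℝ) {K : ℝ}
    (hK : ∀ l, |Y l| ≤ K)
    (hY : ∀ l, Y l ≤ oe (fun i => σ i (catH h l)) (lastState (catH h l)) (fun z => Y (l ++ [z]))) :
    ∀ᵐ r ∂(P h σ), Summable fun n => oe (fun i => σ i (catH h (pre h r n))) (lastState (catH h (pre h r n)))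
      (fun z => Y (pre h r n ++ [z])) - Y (pre h r n) := by
  have := hP.1
  set D : List (Zt G) → ℝ := fun l => oe (fun i => σ i (catH h l)) (lastState (catH h l)) (fun z => Y (l ++ [z])) - Y l
    with hD
  have hD0 : ∀ l, 0 ≤ D l := fun l => sub_nonneg.2 (hY l)
  have hDb : ∀ l, |D l| ≤ K + K := fun l => (abs_sub _ _).trans (add_le_add (abs_oe_le _ _ fun z => hK _) (hK l))
  have hDm : ∀ n, Measurable fun r : G.Run => D (pre h r n) := fun n => measurable_pre_fun h n D
  have hi : ∀ n, ∫ r, D (pre h r n) ∂(P h σ) = ∫ r, Y (pre h r (n + 1)) ∂(P h σ) - ∫ r, Y (pre h r n) ∂(P h σ) := by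
    intro n
    rw [integral_pre_succ hP σ n h Y hK, ← integral_sub]
    · exact integrable_bdd hP h σ (measurable_pre_fun h n (fun l => oe (fun i => σ i (catH h l))
          (lastState (catH h l)) fun z => Y (l ++ [z]))) (fun r => abs_oe_le _ _ fun z => hK _)
    · exact integrable_bdd hP h σ (measurable_pre_fun h n Y) (fun r => hK _)
  have hl : ∫⁻ r, ∑' n, ENNReal.ofReal (D (pre h r n)) ∂(P h σ) ≠ ∞ := by
    rw [lintegral_tsum fun n => (hDm n).ennreal_ofReal.aemeasurable]
    refine ne_top_of_le_ne_top (b := ENNReal.ofReal (K + K)) ENNReal.ofReal_ne_top ?_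
    refine ENNReal.tsum_le_of_sum_range_le fun m => ?_
    have h1 : ∀ n, ∫⁻ r, ENNReal.ofReal (D (pre h r n)) ∂(P h σ) = ENNReal.ofReal (∫ r, D (pre h r n) ∂(P h σ)) :=
      fun n => (ofReal_integral_eq_lintegral_ofReal (integrable_bdd hP h σ (hDm n) fun r => hDb _)
        (Eventually.of_forall fun r => hD0 _)).symm
    simp only [h1]
    rw [← ENNReal.ofReal_sum_of_nonneg fun n _ => integral_nonneg fun r => hD0 _]
    refine ENNReal.ofReal_le_ofReal ?_
    simp only [hi]
    rw [Finset.sum_range_sub (fun n => ∫ r, Y (pre h r n) ∂(P h σ))]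
    have h2 := abs_le.1 (abs_integral_le hP h σ (F := fun r => Y (pre h r m)) fun r => hK _)
    have h3 := abs_le.1 (abs_integral_le hP h σ (F := fun r => Y (pre h r 0)) fun r => hK _)
    linarith [h2.2, h3.1]
  have hm : Measurable fun r : G.Run => ∑' n, ENNReal.ofReal (D (pre h r n)) :=
    Measurable.ennreal_tsum fun n => (hDm n).ennreal_ofReal
  filter_upwards [ae_lt_top hm hl] with r hr
  have := ENNReal.summable_toReal hr.ne
  refine this.congr fun n => ?_
  rw [ENNReal.toReal_ofReal (hD0 _)]

end StochGame

namespace StochGame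
open Filter
variable {G : StochGame} {P : G.History → G.Profile → Measure G.Run}

/-- Nash equilibrium of the one-shot game with continuation payoffs `g` -/
theorem nash_oe (s : G.S) (g : G.I → Zt G → ℝ) {K : ℝ} (hK : ∀ i z, |g i z| ≤ K) :
    ∃ x : ∀ i, PMF (G.A i), ∀ i (y : PMF (G.A i)), oe (Function.update x i y) s (g i) ≤ oe x s (g i) := by
  obtain ⟨x, hx⟩ := Nash.nash (I := G.I) (A := G.A) (fun i a => ∑' t, (G.trans s a t).toReal * g i (a, t))
  refine ⟨x, fun i y => ?_⟩
  rw [oe_eq _ _ (hK i), oe_eq _ _ (hK i)]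
  convert hx i y using 6

theorem phase1 (hP : IsInducedFamily G P) {C : ℝ} (hC0 : 0 ≤ C)
    (hC : ∀ i r, |G.payoff i r| ≤ C) {κ : ℝ} (hκ : 0 < κ) :
    ∃ (h0 : G.History) (X g : G.I → List (Zt G) → ℝ) (σ : G.Profile) (bad : List (Zt G) → Prop),
      Valid h0 ∧ (∀ i, Cert i C h0 (X i)) ∧ (∀ i l, |g i l| ≤ C + 1) ∧
      (∀ i l, Dv i C (catH h0 l) ≤ g i l + 2 * κ) ∧
      (∀ i l (y : PMF (G.A i)), oe (Function.update (fun j => σ j (catH h0 l)) i y) (lastState (catH h0 l))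
        (fun z => g i (l ++ [z])) ≤ oe (fun j => σ j (catH h0 l)) (lastState (catH h0 l)) (fun z => g i (l ++ [z]))) ∧
      (∀ i l, ¬ bad l → g i l = X i l ∧
        g i l ≤ oe (fun j => σ j (catH h0 l)) (lastState (catH h0 l)) (fun z => g i (l ++ [z]))) ∧
      P h0 σ {r | ∀ n, ¬ bad (pre h0 r n)} ≠ 0 := by
  have := hP.1
  -- the starting history
  let SD : G.History → ℝ := fun h => ∑ i, Dv i C h
  let T : Set ℝ := SD '' {h | Valid h}
  have hTne : T.Nonempty := by
    obtain ⟨s⟩ := G.nonemptyS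
    exact ⟨_, (s, []), by simp [Valid, ValidFrom], rfl⟩
  have hTb : BddAbove T := by
    refine ⟨∑ _i : G.I, (C + 1), ?_⟩
    rintro _ ⟨h, _, rfl⟩
    exact Finset.sum_le_sum fun i _ => Dv_le hC0 (hC i) h
  set n : ℝ := (Fintype.card G.I : ℝ) with hn
  have hn0 : 0 ≤ n := by positivity
  let θ : ℝ := κ / (2 * (1 + n))
  have hθ : 0 < θ := by positivity
  have hθκ : (1 + n) * θ = κ / 2 := by simp only [θ]; field_simp
  have hθκ2 : θ ≤ 2 * κ := by nlinarith
  obtain ⟨_, ⟨h0, hv0, rfl⟩, hS⟩ := exists_lt_of_lt_csSup hTne (sub_lt_self (sSup T) hθ)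
  have hS' : ∀ h, Valid h → SD h ≤ sSup T := fun h hh => le_csSup hTb ⟨h, hh, rfl⟩
  choose X hX hX0 using fun i => exists_near_Dv hC0 (hC i) h0 hθ
  let g : G.I → List (Zt G) → ℝ := fun i l => if Dv i C (catH h0 l) ≤ X i l + 2 * κ then X i l else Dv i C (catH h0 l) - κ
  let bad : List (Zt G) → Prop := fun l => ∃ i, X i l + 2 * κ < Dv i C (catH h0 l)
  have hXb : ∀ i l, -(C + 1) ≤ X i l ∧ X i l ≤ C + 1 := fun i l => abs_le.1 ((hX i).1 l)
  have hgb : ∀ i l, |g i l| ≤ C + 1 := by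
    intro i l
    have h1 := hXb i l
    have h2 := Dv_le hC0 (hC i) (catH h0 l)
    simp only [g]
    split_ifs with h
    · exact (hX i).1 l
    · push Not at h
      exact abs_le.2 ⟨by linarith, by linarith⟩
  have hgX : ∀ i l, X i l ≤ g i l := by
    intro i l
    simp only [g]
    split_ifs with h
    · exact le_rfl
    · push Not at h; linarith
  have hgD : ∀ i l, g i l ≤ Dv i C (catH h0 l) := by
    intro i l
    simp only [g]
    split_ifs with h
    · exact (hX i).le_Dv l
    · linarith
  have hDg : ∀ i l, Dv i C (catH h0 l) ≤ g i l + 2 * κ := by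
    intro i l
    simp only [g]
    split_ifs with h
    · exact h
    · linarith
  have hnb : ∀ i l, ¬ bad l → g i l = X i l := by
    intro i l hl
    simp only [g]
    rw [if_pos]
    by_contra hc
    exact hl ⟨i, not_le.1 hc⟩
  have hbs : ∀ l, bad l → ∑ i, g i l ≤ SD (catH h0 l) - κ := by
    rintro l ⟨i, hi⟩
    have h1 : g i l = Dv i C (catH h0 l) - κ := by simp only [g]; rw [if_neg (not_le.2 hi)]
    have h2 : ∑ j, (Dv j C (catH h0 l) - g j l) ≥ Dv i C (catH h0 l) - g i l :=
      Finset.single_le_sum (f := fun j => Dv j C (catH h0 l) - g j l) (fun j _ => sub_nonneg.2 (hgD j l)) (Finset.mem_univ i)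
    rw [Finset.sum_sub_distrib] at h2
    simp only [SD]
    linarith
  have hgs : ∀ l, ∑ i, g i l ≤ SD (catH h0 l) := fun l => Finset.sum_le_sum fun i _ => hgD i l
  choose x hx using fun h : G.History => nash_oe (lastState h) (fun i z => g i ((h.2 ++ [z]).drop h0.2.length))
    (K := C + 1) (fun i z => hgb i _)
  have hdrop : ∀ l z, ((catH h0 l).2 ++ [z]).drop h0.2.length = l ++ [z] := by
    intro l z; simp [catH]
  let σ : G.Profile := fun i h => x h i
  have hN : ∀ i l (y : PMF (G.A i)), oe (Function.update (fun j => σ j (catH h0 l)) i y) (lastState (catH h0 l))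
        (fun z => g i (l ++ [z])) ≤ oe (fun j => σ j (catH h0 l)) (lastState (catH h0 l)) (fun z => g i (l ++ [z])) := by
    intro i l y
    have h1 := hx (catH h0 l) i y
    simp only [hdrop] at h1
    exact h1
  have hsub : ∀ i l, X i l ≤ oe (fun j => σ j (catH h0 l)) (lastState (catH h0 l)) (fun z => g i (l ++ [z])) := by
    intro i l
    obtain ⟨y, hy⟩ := ((hX i).2.1 l).2 (fun j => σ j (catH h0 l))
    refine hy.trans (le_trans ?_ (hN i l y))
    exact oe_mono _ _ (fun z => (hX i).1 _) (fun z => hgb i _) fun z => hgX i _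
  refine ⟨h0, X, g, σ, bad, hv0, hX, hgb, hDg, hN, fun i l hl => ⟨hnb i l hl, ?_⟩, ?_⟩
  · rw [hnb i l hl]; exact hsub i l
  -- probability of bad
  have hmeas : MeasurableSet {r : G.Run | ∀ n, ¬ bad (pre h0 r n)} := by
    rw [Set.ofPred_forall]
    exact MeasurableSet.iInter fun n => measurable_pre h0 n (t := {l | ¬ bad l}) trivial
  set E := {r : G.Run | ∀ n, ¬ bad (pre h0 r n)} with hE
  intro hzero
  let S := sSup T
  let V0 : List (Zt G) → ℝ := fun l => S - ∑ i, g i l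
  have hV0b : ∀ l, |V0 l| ≤ |S| + n * (C + 1) := by
    intro l
    refine (abs_sub _ _).trans (add_le_add le_rfl ?_)
    refine (Finset.abs_sum_le_sum_abs _ _).trans ((Finset.sum_le_sum fun i _ => hgb i l).trans ?_)
    simp only [Finset.sum_const, Finset.card_univ, nsmul_eq_mul]; exact le_rfl
  let V : List (Zt G) → ℝ := fun l => if contProb σ h0 l = 0 then 0 else V0 l
  have hVb : ∀ l, |V l| ≤ |S| + n * (C + 1) := by
    intro l
    simp only [V]
    split_ifs
    · simp; positivity
    · exact hV0b l
  have hval : ∀ l, contProb σ h0 l ≠ 0 → 0 ≤ V l ∧ (bad l → κ ≤ V l) := by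
    intro l hl
    have h1 := hS' _ (valid_of_contProb σ l h0 hv0 hl)
    have h2 := hgs l
    simp only [V, V0, if_neg hl]
    refine ⟨by simp only [S]; linarith, fun hb => ?_⟩
    have h3 := hbs l hb
    simp only [S]; linarith
  have main := optStopping hP σ (F := fun r => κ * Eᶜ.indicator 1 r) ((measurable_one.indicator hmeas.compl).const_mul κ)
    (C := κ) (fun r => by
      rw [abs_mul, abs_of_pos hκ]
      by_cases hr : r ∈ Eᶜ
      · simp only [Set.indicator_of_mem hr]; simp
      · simp only [Set.indicator_of_notMem hr]; simp [hκ.le]) h0 V bad hVb ?_ ?_ ?_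
  · rw [integral_const_mul, integral_indicator_one hmeas.compl, probReal_compl_eq_one_sub hmeas] at main
    have h1 : (P h0 σ).real E = 0 := by simp [Measure.real, hzero]
    have h2 : V [] = S - ∑ i, g i [] := by simp [V, V0, contProb]
    have h3 : ∑ i, (Dv i C h0 - θ) ≤ ∑ i, g i [] :=
      Finset.sum_le_sum fun i _ => (hX0 i).trans (hgX i [])
    rw [Finset.sum_sub_distrib] at h3
    simp only [Finset.sum_const, Finset.card_univ, nsmul_eq_mul] at h3
    rw [h1, h2] at main
    simp only [SD] at hS
    simp only [S] at main
    linarith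
  · intro l hl
    have hlb : ¬ bad l := hl l (List.prefix_rfl)
    by_cases hc : contProb σ h0 l = 0
    · have h1 : ∀ z, V (l ++ [z]) = 0 := fun z => by
        simp only [V]; rw [if_pos]; rw [contProb_append, hc, zero_mul]
      simp only [h1]
      rw [oe_const]; simp [V, hc]
    · have h1 : V l = V0 l := by simp only [V]; rw [if_neg hc]
      rw [h1]
      have h2 : oe (fun i => σ i (catH h0 l)) (lastState (catH h0 l)) (fun z => V (l ++ [z])) ≤
          oe (fun i => σ i (catH h0 l)) (lastState (catH h0 l)) (fun z => V0 (l ++ [z])) := by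
        refine oe_mono' _ _ (fun z => hVb _) (fun z => hV0b _) fun z hz => ?_
        simp only [V]
        rw [if_neg]
        rw [contProb_append, contProb_cons]
        simpa [contProb, hc] using hz
      refine h2.trans ?_
      have h3 : oe (fun i => σ i (catH h0 l)) (lastState (catH h0 l)) (fun z => V0 (l ++ [z])) =
          S - ∑ i, oe (fun i => σ i (catH h0 l)) (lastState (catH h0 l)) (fun z => g i (l ++ [z])) := by
        have h4 : ∀ z, V0 (l ++ [z]) = (-1) * (∑ i, g i (l ++ [z])) + S := fun z => by simp only [V0]; ring
        simp only [h4]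
        have h6 : ∀ z, |(-1) * ∑ i, g i (l ++ [z])| ≤ n * (C + 1) := by
          intro z
          rw [abs_mul]
          simp only [abs_neg, abs_one, one_mul]
          refine (Finset.abs_sum_le_sum_abs _ _).trans ((Finset.sum_le_sum fun i _ => hgb i _).trans ?_)
          simp only [Finset.sum_const, Finset.card_univ, nsmul_eq_mul]; exact le_rfl
        rw [oe_add_const _ _ h6, oe_smul, oe_sum _ _ _ _ (fun i z => hgb i (l ++ [z]))]
        ring
      rw [h3]
      have h5 : ∑ i, g i l ≤ ∑ i, oe (fun i => σ i (catH h0 l)) (lastState (catH h0 l)) (fun z => g i (l ++ [z])) :=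
        Finset.sum_le_sum fun i _ => by rw [hnb i l hlb]; exact hsub i l
      simp only [V0]
      linarith
  · intro e he _ hce
    refine le_trans ?_ ((hval e hce).2 he)
    rw [integral_const_mul, integral_indicator_one hmeas.compl]
    have : (P (catH h0 e) σ).real Eᶜ ≤ 1 := measureReal_le_one
    nlinarith
  · intro r hr hnbad η hη
    refine Eventually.of_forall fun m => ?_
    have hrE : r ∉ Eᶜ := by simpa [hE] using hnbad
    simp only [Set.indicator_of_notMem hrE, mul_zero]
    by_cases hc : contProb σ h0 (pre h0 r m) = 0
    · simp only [V, if_pos hc]; linarith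
    · linarith [(hval _ hc).1]

end StochGame

namespace StochGame
open Filter
variable {G : StochGame} {P : G.History → G.Profile → Measure G.Run}

/-- freezing at the first bad position -/
theorem exists_freeze {Z : Type*} (bad : List Z → Prop) : ∃ fz : List Z → List Z,
    (∀ l z, bad (fz l) → fz (l ++ [z]) = fz l) ∧
    (∀ l, ¬ bad (fz l) → fz l = l ∧ ∀ z, fz (l ++ [z]) = l ++ [z]) ∧
    (∀ l, (∀ l', l' <+: l → ¬ bad l') → fz l = l) := by
  obtain ⟨fz, h0, hs⟩ := exists_snocRec (Z := Z) (α := List Z) []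
    (fun l z R => if bad R then R else l ++ [z])
  have hpre : ∀ l, fz l <+: l ∧ (¬ bad (fz l) → fz l = l) := by
    intro l
    induction l using List.reverseRecOn with
    | nil => rw [h0]; exact ⟨List.prefix_rfl, fun _ => rfl⟩
    | append_singleton l z ih =>
      rw [hs]
      split_ifs with hb
      · exact ⟨ih.1.trans (List.prefix_append _ _), fun h => absurd hb h⟩
      · exact ⟨List.prefix_rfl, fun _ => rfl⟩
  refine ⟨fz, fun l z hb => by rw [hs, if_pos hb], fun l hb => ⟨(hpre l).2 hb, fun z => by rw [hs, if_neg hb]⟩,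
    fun l hl => (hpre l).2 (hl _ (hpre l).1)⟩

theorem phase2 (hP : IsInducedFamily G P) (hfm : ∀ i, Measurable (G.payoff i)) {C : ℝ} 
    {κ : ℝ} (hκ : 0 < κ) (h0 : G.History) (g : G.I → List (Zt G) → ℝ) (σ : G.Profile) (bad : List (Zt G) → Prop)
    (inc : G.I → List (Zt G) → ℝ)
    (hinc : ∀ i l, inc i l = max 0 (oe (fun j => σ j (catH h0 l)) (lastState (catH h0 l)) (fun z => g i (l ++ [z])) - g i l))
    (hgb : ∀ i l, |g i l| ≤ C + 1)
    (hgs : ∀ i l, ¬ bad l →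
        g i l ≤ oe (fun j => σ j (catH h0 l)) (lastState (catH h0 l)) (fun z => g i (l ++ [z])))
    (hpos : P h0 σ {r | ∀ n, ¬ bad (pre h0 r n)} ≠ 0) :
    ∃ (N : ℕ) (d c : G.I → ℝ) (Q : Set G.Run), MeasurableSet Q ∧ P h0 σ Q ≠ 0 ∧ ∀ r ∈ Q,
      (∀ n, ¬ bad (pre h0 r n)) ∧ ∀ i, (∀ n, N ≤ n → d i ≤ g i (pre h0 r n) ∧ g i (pre h0 r n) ≤ d i + κ) ∧
        (∀ m, ∑ k ∈ Finset.Ico N m, inc i (pre h0 r k) ≤ κ) ∧ c i ≤ G.payoff i r ∧ G.payoff i r ≤ c i + κ := by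
  have := hP.1
  obtain ⟨fz, hf1, hf2, hf3⟩ := exists_freeze bad
  let Y : G.I → List (Zt G) → ℝ := fun i l => g i (fz l)
  have hYb : ∀ i l, |Y i l| ≤ C + 1 := fun i l => hgb i _
  have hYs : ∀ i l, Y i l ≤ oe (fun j => σ j (catH h0 l)) (lastState (catH h0 l)) (fun z => Y i (l ++ [z])) := by
    intro i l
    simp only [Y]
    by_cases hb : bad (fz l)
    · simp only [hf1 l _ hb, oe_const]; exact le_rfl
    · have h1 := hf2 l hb
      simp only [h1.2]
      rw [h1.1] at hb ⊢
      exact hgs i l hb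
  have hconv : ∀ᵐ r ∂(P h0 σ), ∀ i, ∃ c, Tendsto (fun n => Y i (pre h0 r n)) atTop (nhds c) :=
    ae_all_iff.2 fun i => submart hP σ h0 (Y i) (hYb i) (hYs i)
  have hsum : ∀ᵐ r ∂(P h0 σ), ∀ i, Summable fun n => oe (fun j => σ j (catH h0 (pre h0 r n)))
      (lastState (catH h0 (pre h0 r n))) (fun z => Y i (pre h0 r n ++ [z])) - Y i (pre h0 r n) :=
    ae_all_iff.2 fun i => submart_sum hP σ h0 (Y i) (hYb i) (hYs i)
  let Q : ℕ × (G.I → ℤ) × (G.I → ℤ) → Set G.Run := fun p => {r | (∀ n, ¬ bad (pre h0 r n)) ∧ ∀ i,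
      (∀ n, p.1 ≤ n → (p.2.1 i : ℝ) * (κ / 2) ≤ g i (pre h0 r n) ∧ g i (pre h0 r n) ≤ (p.2.1 i : ℝ) * (κ / 2) + κ) ∧
        (∀ m, ∑ k ∈ Finset.Ico p.1 m, inc i (pre h0 r k) ≤ κ) ∧ (p.2.2 i : ℝ) * κ ≤ G.payoff i r ∧
          G.payoff i r ≤ (p.2.2 i : ℝ) * κ + κ}
  have hcov : P h0 σ (⋃ p, Q p) ≠ 0 := by
    intro hz
    apply hpos
    rw [measure_eq_zero_iff_ae_notMem] at hz ⊢
    filter_upwards [hz, hconv, hsum] with r h1 h2 h3 h4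
    apply h1
    have hNP : ∀ n, ∀ l', l' <+: pre h0 r n → ¬ bad l' := by
      intro n l' hl'
      rw [prefix_pre hl']; exact h4 _
    have hfr : ∀ n, fz (pre h0 r n) = pre h0 r n := fun n => hf3 _ (hNP n)
    have hYg : ∀ i n, Y i (pre h0 r n) = g i (pre h0 r n) := fun i n => by simp only [Y, hfr]
    have hYz : ∀ i n z, Y i (pre h0 r n ++ [z]) = g i (pre h0 r n ++ [z]) := fun i n z => by
      simp only [Y]
      rw [(hf2 (pre h0 r n) (by rw [hfr]; exact h4 n)).2]
    simp only [hYg, hYz] at h2 h3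
    choose L hL using h2
    have hincS : ∀ i, Summable fun n => inc i (pre h0 r n) := by
      intro i
      refine (h3 i).congr fun n => ?_
      rw [hinc, max_eq_right (sub_nonneg.2 (hgs i _ (h4 n)))]
    let dz : G.I → ℤ := fun i => ⌈L i / (κ / 2)⌉ - 1
    let cz : G.I → ℤ := fun i => ⌊G.payoff i r / κ⌋
    have hdz : ∀ i, (dz i : ℝ) * (κ / 2) < L i ∧ L i < (dz i : ℝ) * (κ / 2) + κ := by
      intro i
      have h5 := Int.le_ceil (L i / (κ / 2))
      have h6 := Int.ceil_lt_add_one (L i / (κ / 2))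
      have h7 : (dz i : ℝ) = ⌈L i / (κ / 2)⌉ - 1 := by simp [dz]
      rw [div_le_iff₀ (by positivity)] at h5
      rw [← sub_lt_iff_lt_add, lt_div_iff₀ (by positivity)] at h6
      rw [h7]
      exact ⟨h6, by linarith⟩
    have hcz : ∀ i, (cz i : ℝ) * κ ≤ G.payoff i r ∧ G.payoff i r ≤ (cz i : ℝ) * κ + κ := by
      intro i
      have h5 := Int.floor_le (G.payoff i r / κ)
      have h6 := Int.lt_floor_add_one (G.payoff i r / κ)
      rw [le_div_iff₀ hκ] at h5
      rw [div_lt_iff₀ hκ] at h6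
      exact ⟨h5, by simp only [cz]; linarith⟩
    have hev : ∀ᶠ N in atTop, ∀ i, (∀ n, N ≤ n → (dz i : ℝ) * (κ / 2) ≤ g i (pre h0 r n) ∧
        g i (pre h0 r n) ≤ (dz i : ℝ) * (κ / 2) + κ) ∧ ∀ m, ∑ k ∈ Finset.Ico N m, inc i (pre h0 r k) ≤ κ := by
      rw [eventually_all]
      intro i
      refine Eventually.and ?_ ?_
      · refine eventually_forall_ge_atTop.2 ?_
        filter_upwards [(hL i).eventually (Ioo_mem_nhds (hdz i).1 (hdz i).2)] with n hn
        exact ⟨hn.1.le, hn.2.le⟩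
      · have h5 := (hincS i).hasSum.tendsto_sum_nat
        filter_upwards [h5.eventually (Ioi_mem_nhds (sub_lt_self _ hκ))] with N hN m
        have h6 : ∀ k, 0 ≤ inc i (pre h0 r k) := fun k => by rw [hinc]; exact le_max_left _ _
        by_cases hm : N ≤ m
        · rw [Finset.sum_Ico_eq_sub _ hm]
          have h7 := (hincS i).sum_le_tsum (Finset.range m) (fun k _ => h6 k)
          have h8 : _ < _ := hN
          linarith
        · rw [Finset.Ico_eq_empty (fun h => hm h.le)]; simpa using hκ.le
    obtain ⟨N, hN⟩ := hev.exists
    exact Set.mem_iUnion.2 ⟨(N, dz, cz), h4, fun i => ⟨(hN i).1, (hN i).2, hcz i⟩⟩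
  have hex : ∃ p, P h0 σ (Q p) ≠ 0 := by
    by_contra hn
    push Not at hn
    exact hcov (measure_iUnion_null hn)
  obtain ⟨p, hp⟩ := hex
  refine ⟨p.1, fun i => (p.2.1 i : ℝ) * (κ / 2), fun i => (p.2.2 i : ℝ) * κ, Q p, ?_, hp, fun r hr => hr⟩
  have hg : ∀ i n, Measurable fun r : G.Run => g i (pre h0 r n) := fun i n => measurable_pre_fun h0 n (g i)
  have hi : ∀ i n, Measurable fun r : G.Run => inc i (pre h0 r n) := fun i n => measurable_pre_fun h0 n (inc i)
  have m1 : ∀ n, MeasurableSet {r : G.Run | ¬ bad (pre h0 r n)} := fun n => measurable_pre h0 n (t := {l | ¬ bad l}) trivial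
  refine MeasurableSet.inter (s₁ := {r : G.Run | ∀ n, ¬ bad (pre h0 r n)}) ?_ ?_
  · rw [Set.ofPred_forall]; exact MeasurableSet.iInter m1
  · refine measurableSet_setOf.2 (Measurable.forall fun i => ?_)
    refine Measurable.and (Measurable.forall fun n => Measurable.imp measurable_const ?_) (Measurable.and
      (Measurable.forall fun m => ?_) ?_)
    · exact measurableSet_setOf.1 ((measurableSet_le measurable_const (hg i n)).inter
        (measurableSet_le (hg i n) measurable_const))
    · exact measurableSet_setOf.1 (measurableSet_le (Finset.measurable_sum _ fun k _ => hi i k) measurable_const)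
    · exact measurableSet_setOf.1 ((measurableSet_le measurable_const (hfm i)).inter
        (measurableSet_le (hfm i) measurable_const))

end StochGame

namespace StochGame
open Filter
variable {G : StochGame} {P : G.History → G.Profile → Measure G.Run}

theorem final_aux (hP : IsInducedFamily G P) (hfm : ∀ i, Measurable (G.payoff i)) {C : ℝ} (hC0 : 0 ≤ C)
    (hC : ∀ i r, |G.payoff i r| ≤ C) {κ δ t : ℝ} (hκ : 0 < κ) (hκ1 : κ ≤ 1) (hδ : 0 < δ) (ht : 1 ≤ t)
    (hδt : 2 * δ * t ^ (Fintype.card (Option G.I)) < 1) :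
    ∃ h1 : G.History, Valid h1 ∧ ∃ σhat : G.Profile, ∀ (i : G.I) (τ : G.Strategy i),
      ∫ r, G.payoff i r ∂(P h1 (Function.update σhat i τ)) ≤ ∫ r, G.payoff i r ∂(P h1 σhat) +
        (6 * κ + (C + (C + 2)) * (Fintype.card (Option G.I) / t) + (2 * C + 1) * δ) := by
  have := hP.1
  have hδ1 : δ < 1 := by
    have h1 : 1 ≤ t ^ (Fintype.card (Option G.I)) := one_le_pow₀ ht
    nlinarith
  obtain ⟨h0, X, g, σ, bad, hv0, hX, hgb, hDg, hN, hnb, hpos⟩ := phase1 hP hC0 hC hκ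
  let inc : G.I → List (Zt G) → ℝ := fun i l =>
    max 0 (oe (fun j => σ j (catH h0 l)) (lastState (catH h0 l)) (fun z => g i (l ++ [z])) - g i l)
  have hinc0 : ∀ i l, 0 ≤ inc i l := fun i l => le_max_left _ _
  have hincg : ∀ i l, oe (fun j => σ j (catH h0 l)) (lastState (catH h0 l)) (fun z => g i (l ++ [z])) ≤ g i l + inc i l := by
    intro i l
    have : _ ≤ inc i l := le_max_right _ _
    linarith
  obtain ⟨N, d, c, Q, hQm, hQ0, hQ⟩ := phase2 hP hfm hκ h0 g σ bad inc (fun _ _ => rfl) hgb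
    (fun i l hl => (hnb i l hl).2) hpos
  obtain ⟨l1, hl1, hNl, hQc⟩ := density hP σ h0 hQm hQ0 hδ hδ1 N
  set h1 := catH h0 l1 with hh1
  obtain ⟨U, hQU, hU, hUP, hUo⟩ := open_nhd (P h1 σ) hQm.compl (η := ENNReal.ofReal (δ - (P h1 σ).real Qᶜ))
    (by simpa using hQc)
  have hUP' : (P h1 σ).real U ≤ δ := by
    have := ENNReal.toReal_mono (by simp) hUP
    rw [ENNReal.toReal_add (measure_ne_top _ _) (by simp), ENNReal.toReal_ofReal (by linarith)] at this
    have h2 : ((P h1 σ) Qᶜ).toReal = (P h1 σ).real Qᶜ := rfl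
    have h3 : ((P h1 σ) U).toReal = (P h1 σ).real U := rfl
    linarith
  set B : List (Zt G) → Prop := fun l => cyl (catH h1 l) ⊆ U with hB
  have hB0 : NP B [] := by
    rw [NP_nil]
    intro hb
    have h2 : P h1 σ U = 1 := le_antisymm prob_le_one (by
      rw [← P_cyl hP h1 σ]; refine measure_mono ?_; simpa [hB, catH_nil] using hb)
    simp [Measure.real, h2] at hUP'
    linarith
  -- points of Q through positions that are still inside
  have hpt : ∀ l, NP B l → ∃ r ∈ Q, r ∈ cyl h0 ∧ ∀ k, k ≤ l.length → pre h0 r (l1.length + k) = l1 ++ l.take k := by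
    intro l hl
    obtain ⟨r, hr1, hr2⟩ := Set.not_subset.1 (hl l List.prefix_rfl)
    have hrQ : r ∈ Q := by by_contra hc; exact hr2 (hQU hc)
    rw [hh1, catH_catH] at hr1
    have h2 := mem_cyl_catH.1 hr1
    refine ⟨r, hrQ, h2.1, fun k hk => ?_⟩
    rw [← pre_take h0 r (m := (l1 ++ l).length) (by simp; exact hk), h2.2, List.take_length_add_append]
  let A : G.I → List (Zt G) → ℝ := fun i l => ∑ k ∈ Finset.range l.length, inc i (l1 ++ l.take k)
  have hA0 : ∀ i l, 0 ≤ A i l := fun i l => Finset.sum_nonneg fun k _ => hinc0 i _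
  have hAs : ∀ i l z, A i (l ++ [z]) = A i l + inc i (l1 ++ l) := by
    intro i l z
    simp only [A, List.length_append, List.length_singleton, Finset.sum_range_succ]
    congr 1
    · refine Finset.sum_congr rfl fun k hk => ?_
      rw [List.take_append_of_le_length (Finset.mem_range.1 hk).le]
    · rw [List.take_left' rfl]
  have hAκ : ∀ i l, NP B l → A i l + inc i (l1 ++ l) ≤ κ := by
    intro i l hl
    obtain ⟨r, hrQ, hr0, hr⟩ := hpt l hl
    have h2 := ((hQ r hrQ).2 i).2.1 (l1.length + (l.length + 1))
    have h3 : A i l + inc i (l1 ++ l) = ∑ k ∈ Finset.range (l.length + 1), inc i (pre h0 r (l1.length + k)) := by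
      rw [Finset.sum_range_succ, hr _ le_rfl, List.take_length]
      congr 1
      exact Finset.sum_congr rfl fun k hk => by rw [hr k (Finset.mem_range.1 hk).le]
    have h4 := Finset.sum_Ico_consecutive (fun k => inc i (pre h0 r k)) hNl (Nat.le_add_right l1.length (l.length + 1))
    have h5 : ∑ k ∈ Finset.Ico l1.length (l1.length + (l.length + 1)), inc i (pre h0 r k) =
        ∑ k ∈ Finset.range (l.length + 1), inc i (pre h0 r (l1.length + k)) := by
      rw [Finset.sum_Ico_eq_sum_range]; simp
    have h6 : 0 ≤ ∑ k ∈ Finset.Ico N l1.length, inc i (pre h0 r k) := Finset.sum_nonneg fun k _ => hinc0 i _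
    linarith
  have hg : ∀ i l, NP B l → d i ≤ g i (l1 ++ l) ∧ g i (l1 ++ l) ≤ d i + κ := by
    intro i l hl
    obtain ⟨r, hrQ, hr0, hr⟩ := hpt l hl
    have h2 := ((hQ r hrQ).2 i).1 (l1.length + l.length) (by omega)
    rwa [hr _ le_rfl, List.take_length] at h2
  let W : G.I → List (Zt G) → ℝ := fun i l => g i (l1 ++ l) - min κ (A i l)
  have hm : ∀ i l, 0 ≤ min κ (A i l) ∧ min κ (A i l) ≤ κ := fun i l => ⟨le_min hκ.le (hA0 i l), min_le_left _ _⟩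
  have hWn : ∀ i l, NP B l → W i l = g i (l1 ++ l) - A i l := fun i l hl => by
    simp only [W]; rw [min_eq_right]; linarith [hAκ i l hl, hinc0 i (l1 ++ l)]
  have hWz : ∀ i l z, NP B l → W i (l ++ [z]) = g i ((l1 ++ l) ++ [z]) + -(A i l + inc i (l1 ++ l)) := fun i l z hl => by
    simp only [W]; rw [hAs, min_eq_right (hAκ i l hl), List.append_assoc]; ring
  have hv1 : Valid h1 := valid_of_contProb σ l1 h0 hv0 hl1
  obtain ⟨r0, hr0Q, hr0c, hr0⟩ := hpt [] hB0
  refine ⟨h1, hv1, solve_at hP hfm hC0 hC hκ hδ ht hδt h1 σ hU (fun r hr hrc => ?_) hUP' W d c ?_ ?_ ?_ ?_ ?_ ?_ ?_ ?_⟩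
  · obtain ⟨n, _, hn⟩ := hUo h1 r hr hrc 0
    exact ⟨n, hn⟩
  · intro i l
    have h2 := abs_le.1 (hgb i (l1 ++ l))
    have h3 := hm i l
    simp only [W]
    exact abs_le.2 ⟨by linarith, by linarith⟩
  · intro i l hl y
    rw [hWn i l hl]
    simp only [fun z => hWz i l z hl]
    rw [oe_add_const _ _ (fun z => hgb i _)]
    have h2 := hN i (l1 ++ l) y
    have h3 := hincg i (l1 ++ l)
    simp only [hh1, catH_catH]
    linarith
  · intro i l hl
    rw [hWn i l hl]
    linarith [hAκ i l hl, hinc0 i (l1 ++ l), (hg i l hl).1]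
  · intro i
    have h2 := (hg i [] hB0).2
    have h3 := hm i []
    simp only [W]
    linarith
  · intro i e _
    have h2 := hDg i (l1 ++ e)
    have h3 := hm i e
    simp only [W, hh1, catH_catH]
    linarith
  · intro i r _ hrU
    have hrQ : r ∈ Q := by by_contra hc; exact hrU (hQU hc)
    exact ((hQ r hrQ).2 i).2.2
  · intro i
    have h2 := (hQ r0 hr0Q).2 i
    have h3 : d i ≤ G.payoff i r0 := by
      by_contra hlt
      push Not at hlt
      obtain ⟨k, hk⟩ := exists_nat_one_div_lt (sub_pos.2 hlt)
      have h4 := ((hX i).2.2 r0 hr0c k).and_eventually (eventually_ge_atTop N)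
      obtain ⟨n, hn1, hn2⟩ := h4.exists
      have h5 := (h2.1 n hn2).1
      rw [(hnb i _ ((hQ r0 hr0Q).1 n)).1] at h5
      linarith
    linarith [h2.2.2.2]
  · intro i
    have h2 := ((hQ r0 hr0Q).2 i).2.2
    have h3 := abs_le.1 (hC i r0)
    exact abs_le.2 ⟨by linarith, by linarith⟩

end StochGame

namespace StochGame

/-- **Theorem (existence of ε-solvable subgames).**
In every stochastic game, for every `ε > 0`, there is a history `h ∈ H` such that the
subgame `Γ_h` admits an `ε`-equilibrium: a strategy profile `σ̂` such that no player `i`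
can gain more than `ε` in the subgame at `h` by unilaterally deviating from `σ̂`, i.e.
`E_{s_h,σ_i,σ̂_{-i}}[f_{i,h}] ≤ E_{s_h,σ̂}[f_{i,h}] + ε` for every `i` and every `σ_i`. -/
theorem exists_solvable_subgame (G : StochGame)
    (P : G.History → G.Profile → Measure G.Run) (hP : IsInducedFamily G P)
    (hfm : ∀ i, Measurable (G.payoff i))
    (hfb : ∀ i, ∃ C : ℝ, ∀ r : G.Run, |G.payoff i r| ≤ C)
    (ε : ℝ) (hε : 0 < ε) :
    ∃ h : G.History, Valid h ∧
      ∃ σhat : G.Profile, ∀ (i : G.I) (σi : G.Strategy i),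
        expPay P h (Function.update σhat i σi) i - ε ≤ expPay P h σhat i := by
  choose Cf hCf using hfb
  let C : ℝ := ∑ i, |Cf i|
  have hC0 : 0 ≤ C := Finset.sum_nonneg fun i _ => abs_nonneg _
  have hC : ∀ i r, |G.payoff i r| ≤ C := fun i r => (hCf i r).trans ((le_abs_self _).trans
    (Finset.single_le_sum (f := fun i => |Cf i|) (fun j _ => abs_nonneg _) (Finset.mem_univ i)))
  set n := Fintype.card (Option G.I) with hn
  let κ : ℝ := min 1 (ε / 24)
  have hκ : 0 < κ := lt_min one_pos (by positivity)
  have hκε : 6 * κ ≤ ε / 4 := by have : κ ≤ ε / 24 := min_le_right _ _; linarith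
  let t : ℝ := max 1 ((C + (C + 2)) * n / (ε / 4))
  have ht : 1 ≤ t := le_max_left _ _
  have ht0 : 0 < t := by linarith
  have htε : (C + (C + 2)) * (n / t) ≤ ε / 4 := by
    have h1 : (C + (C + 2)) * n / (ε / 4) ≤ t := le_max_right _ _
    rw [div_le_iff₀ (by positivity)] at h1
    rw [← mul_div_assoc, div_le_iff₀ ht0]
    linarith
  let δ : ℝ := min (1 / (4 * t ^ n)) (ε / 4 / (2 * C + 1))
  have hδ : 0 < δ := lt_min (by positivity) (by positivity)
  have hδt : 2 * δ * t ^ n < 1 := by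
    have h1 : δ ≤ 1 / (4 * t ^ n) := min_le_left _ _
    rw [le_div_iff₀ (by positivity)] at h1
    linarith
  have hδε : (2 * C + 1) * δ ≤ ε / 4 := by
    have h1 : δ ≤ ε / 4 / (2 * C + 1) := min_le_right _ _
    rw [le_div_iff₀ (by positivity)] at h1
    linarith
  obtain ⟨h, hv, σhat, H⟩ := final_aux hP hfm hC0 hC hκ (min_le_left _ _) hδ ht hδt
  refine ⟨h, hv, σhat, fun i σi => ?_⟩
  have h1 := H i σi
  unfold expPay
  linarith

end StochGame
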